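/- For every integer k ≥ 1, every k-planar finite simple graph of girth at least 5 on n ≥ 2 vertices whose number m of edges satisfies m ≥ 3.05·n also satisfies m ≤ √(11163·k/1600)·n; in particular m < 2.642·√k·n. -/

import Mathlib

open unitInterval

/-- A (good) drawing of a simple graph in the plane: vertices map to distinct
points, each edge is drawn as a simple continuous arc between its endpoints,
arcs avoid vertex points other than their endpoints, two arcs meet in finitely
many points, and no three arcs pass through a common interior point. -/
structure PlaneDrawing {V : Type*} (G : SimpleGraph V) where
  pos : V → ℝ × ℝ
  pos_inj : Function.Injective pos
  arc : ∀ ⦃u v : V⦄, G.Adj u v → Path (pos u) (pos v)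
  arc_symm : ∀ ⦃u v : V⦄ (h : G.Adj u v), arc h.symm = (arc h).symm
  arc_inj : ∀ ⦃u v : V⦄ (h : G.Adj u v), Function.Injective (arc h)
  no_vertex_mem : ∀ ⦃u v : V⦄ (h : G.Adj u v) (w : V) (t : I),
      arc h t = pos w → w = u ∨ w = v
  finite_inter : ∀ ⦃u v x y : V⦄ (h₁ : G.Adj u v) (h₂ : G.Adj x y),
      s(u, v) ≠ s(x, y) →
      (Set.range (arc h₁) ∩ Set.range (arc h₂)).Finite
  no_triple_point : ∀ ⦃u₁ v₁ u₂ v₂ u₃ v₃ : V⦄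
      (h₁ : G.Adj u₁ v₁) (h₂ : G.Adj u₂ v₂) (h₃ : G.Adj u₃ v₃),
      s(u₁, v₁) ≠ s(u₂, v₂) → s(u₁, v₁) ≠ s(u₃, v₃) → s(u₂, v₂) ≠ s(u₃, v₃) →
      ∀ t₁ t₂ t₃ : I, t₁ ≠ 0 → t₁ ≠ 1 → t₂ ≠ 0 → t₂ ≠ 1 → t₃ ≠ 0 → t₃ ≠ 1 →
      arc h₁ t₁ = arc h₂ t₂ → arc h₂ t₂ = arc h₃ t₃ → False

namespace PlaneDrawing

variable {V : Type*} {G : SimpleGraph V} (D : PlaneDrawing G)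

/-- `p` is an interior point of the arc of the edge `uv`. -/
def IsInteriorPoint {u v : V} (h : G.Adj u v) (p : ℝ × ℝ) : Prop :=
  ∃ t : I, t ≠ 0 ∧ t ≠ 1 ∧ D.arc h t = p

/-- The set of crossing points of the drawing: points where the interiors of
the arcs of two distinct edges meet. -/
def crossings : Set (ℝ × ℝ) :=
  {p | ∃ (u v x y : V) (h₁ : G.Adj u v) (h₂ : G.Adj x y),
    s(u, v) ≠ s(x, y) ∧ D.IsInteriorPoint h₁ p ∧ D.IsInteriorPoint h₂ p}

/-- The number of crossings of the drawing. -/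
noncomputable def crossingCount : ℕ := D.crossings.ncard

/-- The set of crossing points lying on the edge `uv`. -/
def edgeCrossings {u v : V} (h : G.Adj u v) : Set (ℝ × ℝ) :=
  {p | D.IsInteriorPoint h p ∧
    ∃ (x y : V) (h₂ : G.Adj x y), s(u, v) ≠ s(x, y) ∧ D.IsInteriorPoint h₂ p}

/-- A drawing is `k`-plane if every edge is involved in at most `k` crossings. -/
def IsKPlane (k : ℕ) : Prop :=
  ∀ ⦃u v : V⦄ (h : G.Adj u v), (D.edgeCrossings h).ncard ≤ k

end PlaneDrawing

/-- The crossing number of a graph: the minimum number of crossings over all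
drawings. -/
noncomputable def crossingNumber {V : Type*} (G : SimpleGraph V) : ℕ :=
  sInf {c : ℕ | ∃ D : PlaneDrawing G, D.crossingCount = c}

/-- A graph is `k`-planar if it admits a drawing in which every edge is
involved in at most `k` crossings. -/
def KPlanar {V : Type*} (G : SimpleGraph V) (k : ℕ) : Prop :=
  ∃ D : PlaneDrawing G, D.IsKPlane k

/-- `G` has no cycle of length `ℓ`. -/
def HasNoCycleOfLength {V : Type*} (G : SimpleGraph V) (ℓ : ℕ) : Prop :=
  ∀ (v : V) (c : G.Walk v v), c.IsCycle → c.length ≠ ℓ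

set_option linter.unusedSectionVars false

section CycleCounting

open Equiv Finset

variable {A : Type*} [Fintype A]

/-- If the weights on every cycle of `f` add up to at least `t`, then `f` has at most
`(∑ w) / t` cycles. -/
lemma mul_card_cycles_le_sum (f : Perm A) (w : A → ℚ) (t : ℚ)
    (h : ∀ a, ∃ s : Finset A, (∀ b ∈ s, f.SameCycle a b) ∧ t ≤ ∑ b ∈ s, w b)
    (hw : ∀ a, 0 ≤ w a) :
    t * Nat.card (Quotient (Perm.SameCycle.setoid f)) ≤ ∑ a, w a := by
  classical
  rw [Nat.card_eq_fintype_card]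
  rw [← Finset.sum_fiberwise univ (fun a => (⟦a⟧ : Quotient (Perm.SameCycle.setoid f)))]
  have : ∀ q ∈ (univ : Finset (Quotient (Perm.SameCycle.setoid f))),
      t ≤ ∑ a ∈ univ.filter (fun a => (⟦a⟧ : Quotient (Perm.SameCycle.setoid f)) = q), w a := by
    intro q _
    induction q using Quotient.inductionOn with
    | h a =>
      obtain ⟨s, hs, ht⟩ := h a
      refine ht.trans (Finset.sum_le_sum_of_subset_of_nonneg ?_ fun _ _ _ => hw _)
      intro b hb
      simp only [mem_filter, mem_univ, true_and]
      exact Quotient.sound (hs b hb).symm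
  have := Finset.card_nsmul_le_sum _ _ _ this
  simpa [mul_comm] using this

/-- Euler-type inequality: if every `z` summing to zero over the fibres of `v` and the cycles of
`ψ` is the coboundary along `ν` of a `φ`-invariant function, then `φ` has many cycles. -/
lemma card_le_card_cycles {S : Type*} [Fintype S] (ν φ ψ : Perm A) (v : A → S)
    (h : ∀ z : A → ZMod 2,
      (∀ x, ∀ s : Finset A, (∀ a, a ∈ s ↔ v a = x) → ∑ a ∈ s, z a = 0) →
      (∀ b, ∀ s : Finset A, (∀ a, a ∈ s ↔ ψ.SameCycle b a) → ∑ a ∈ s, z a = 0) →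
      ∃ c : A → ZMod 2, (∀ a, c (φ a) = c a) ∧ ∀ a, c a + c (ν.symm a) = z a) :
    Fintype.card A ≤ Fintype.card S + Nat.card (Quotient (Perm.SameCycle.setoid ψ)) +
      Nat.card (Quotient (Perm.SameCycle.setoid φ)) := by
  classical
  let Qψ := Quotient (Perm.SameCycle.setoid ψ)
  let Qφ := Quotient (Perm.SameCycle.setoid φ)
  let T : (A → ZMod 2) →ₗ[ZMod 2] ((S → ZMod 2) × (Qψ → ZMod 2)) :=
    { toFun := fun z => (fun s => ∑ a, if v a = s then z a else 0,
        fun q => ∑ a, if (⟦a⟧ : Qψ) = q then z a else 0)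
      map_add' := by
        intro x y
        ext s <;> simp only [Prod.fst_add, Prod.snd_add, Pi.add_apply, ← Finset.sum_add_distrib] <;>
          exact Finset.sum_congr rfl fun a _ => by split_ifs <;> simp
      map_smul' := by
        intro r x
        ext s <;> simp [Finset.mul_sum] }
  have hker : ∀ z ∈ LinearMap.ker T, ∃ c : Qφ → ZMod 2, ∀ a, c ⟦a⟧ + c ⟦ν.symm a⟧ = z a := by
    intro z hz
    have hz' : T z = 0 := hz
    have h1 := congrArg Prod.fst hz'
    have h2 := congrArg Prod.snd hz'
    obtain ⟨c, hc, hc'⟩ := h z (fun x s hs => by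
      have := congrFun h1 x
      simp only [T, LinearMap.coe_mk, AddHom.coe_mk, ← Finset.sum_filter] at this
      rw [← show univ.filter (fun a => v a = x) = s by ext; simp [hs]]
      exact this) (fun b s hs => by
      have := congrFun h2 (⟦b⟧ : Qψ)
      simp only [T, LinearMap.coe_mk, AddHom.coe_mk, ← Finset.sum_filter] at this
      rw [← show univ.filter (fun a => (⟦a⟧ : Qψ) = ⟦b⟧) = s by
        ext a
        simp only [mem_filter, mem_univ, true_and, hs, Quotient.eq]
        exact Perm.sameCycle_comm]
      exact this)
    have hinv : ∀ a b, φ.SameCycle a b → c a = c b := by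
      intro a b hab
      obtain ⟨n, rfl⟩ := hab.exists_nat_pow_eq
      clear hab
      induction n with
      | zero => simp
      | succ n ih => rw [pow_succ', Perm.mul_apply, hc]; exact ih
    exact ⟨Quotient.lift c hinv, hc'⟩
  let R : (Qφ → ZMod 2) →ₗ[ZMod 2] (A → ZMod 2) :=
    { toFun := fun c a => c ⟦a⟧ + c ⟦ν.symm a⟧
      map_add' := by intro x y; ext a; simp; ring
      map_smul' := by intro r x; ext a; simp; ring }
  have hle : LinearMap.ker T ≤ LinearMap.range R := by
    intro z hz
    obtain ⟨c, hc⟩ := hker z hz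
    exact ⟨c, funext hc⟩
  have e1 := LinearMap.finrank_range_add_finrank_ker T
  have e2 := LinearMap.finrank_range_add_finrank_ker R
  have e3 := Submodule.finrank_mono hle
  have e4 := Submodule.finrank_le (LinearMap.range T)
  have e5 : Module.finrank (ZMod 2) ((S → ZMod 2) × (Qψ → ZMod 2)) =
      Fintype.card S + Fintype.card Qψ := by simp
  rw [Module.finrank_fintype_fun_eq_card] at e1 e2
  rw [e5] at e4
  rw [Nat.card_eq_fintype_card, Nat.card_eq_fintype_card]
  change Fintype.card A ≤ Fintype.card S + Fintype.card Qψ + Fintype.card Qφ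
  omega

end CycleCounting

section Discharging

open Equiv Finset

variable {V : Type*} {H : SimpleGraph V}

lemma SimpleGraph.Dart.eq_of_fst_snd {a b : H.Dart} (h1 : a.fst = b.fst) (h2 : a.snd = b.snd) :
    a = b :=
  SimpleGraph.Dart.ext _ _ (Prod.ext h1 h2)

/-- The combinatorial data of a drawing in which every edge is crossed at most once, always by an
edge with four distinct endpoints in total. The permutation `rot` is the rotation at the vertices.
The permutation `turn` fixes the uncrossed darts and sends a crossed dart `a` to the dart along
which one continues when turning left at the crossing on `a`. -/
structure OnePlaneRotation (H : SimpleGraph V) [Fintype H.Dart] where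
  rot : Perm H.Dart
  turn : Perm H.Dart
  rot_fst : ∀ a, (rot a).fst = a.fst
  rot_sameCycle : ∀ a b : H.Dart, a.fst = b.fst → rot.SameCycle a b
  turn_turn : ∀ a, turn a ≠ a → turn (turn a) = a.symm
  turn_indep : ∀ a, turn a ≠ a →
    (turn a).fst ≠ a.fst ∧ (turn a).fst ≠ a.snd ∧ (turn a).snd ≠ a.fst ∧ (turn a).snd ≠ a.snd
  planar : ∀ z : H.Dart → ZMod 2,
    (∀ v, ∀ s : Finset H.Dart, (∀ a, a ∈ s ↔ a.fst = v) → ∑ a ∈ s, z a = 0) →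
    (∀ a, turn a = a → z a.symm = z a) →
    (∀ a, turn a ≠ a → z a + z (turn a) + z a.symm + z (turn a).symm = 0) →
    ∃ c : H.Dart → ZMod 2, (∀ a, c (rot.symm (turn a).symm) = c a) ∧
      ∀ a, c a + c (rot.symm a) = z a

namespace OnePlaneRotation

variable [Fintype H.Dart] (P : OnePlaneRotation H)

lemma turn_crossed {a : H.Dart} (h : P.turn a ≠ a) : P.turn (P.turn a) ≠ P.turn a :=
  fun h' => h (P.turn.injective h')

lemma turn_symm_crossed {a : H.Dart} (h : P.turn a ≠ a) : P.turn a.symm ≠ a.symm := by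
  rw [← P.turn_turn a h]; exact P.turn_crossed (P.turn_crossed h)

lemma turn_symm_fixed {a : H.Dart} (h : P.turn a = a) : P.turn a.symm = a.symm := by
  by_contra h'
  exact P.turn_symm_crossed h' (by simpa using h)

lemma turn_symm {a : H.Dart} (h : P.turn a ≠ a) : P.turn a.symm = (P.turn a).symm := by
  rw [← P.turn_turn a h, ← P.turn_turn _ (P.turn_crossed h)]

lemma turn_turn_symm {a : H.Dart} (h : P.turn a ≠ a) : P.turn (P.turn a).symm = a := by
  rw [← P.turn_symm h, P.turn_turn _ (P.turn_symm_crossed h), SimpleGraph.Dart.symm_symm]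

/-- The permutation whose cycles are the faces. -/
def face : Perm H.Dart :=
  P.turn.trans ((Function.Involutive.toPerm SimpleGraph.Dart.symm
    SimpleGraph.Dart.symm_involutive).trans P.rot.symm)

lemma face_apply (a : H.Dart) : P.face a = P.rot.symm (P.turn a).symm := rfl

lemma rot_symm_fst (a : H.Dart) : (P.rot.symm a).fst = a.fst := by
  conv_rhs => rw [← P.rot.apply_symm_apply a]
  exact (P.rot_fst _).symm

lemma face_fst (a : H.Dart) : (P.face a).fst = (P.turn a).snd := by
  rw [face_apply, rot_symm_fst]; rfl

open Classical in
/-- The permutation whose cycles are the uncrossed edges and the crossings. -/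
noncomputable def node : Perm H.Dart :=
  (Function.Involutive.toPerm (fun a : H.Dart => if P.turn a = a then a.symm else a)
    (by
      intro a
      by_cases h : P.turn a = a
      · simp [h, P.turn_symm_fixed h]
      · simp [h])).trans P.turn

lemma node_of_fixed {a : H.Dart} (h : P.turn a = a) : P.node a = a.symm := by
  simp [node, Function.Involutive.toPerm, h, P.turn_symm_fixed h]

lemma node_of_crossed {a : H.Dart} (h : P.turn a ≠ a) : P.node a = P.turn a := by
  simp [node, Function.Involutive.toPerm, h]

lemma sameCycle_node_fixed {a b : H.Dart} (h : P.turn a = a) :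
    P.node.SameCycle a b ↔ b = a ∨ b = a.symm := by
  constructor
  · intro hab
    obtain ⟨n, rfl⟩ := hab.exists_nat_pow_eq
    clear hab
    induction n with
    | zero => simp
    | succ n ih =>
      rw [pow_succ', Perm.mul_apply]
      rcases ih with ih | ih <;> rw [ih]
      · exact Or.inr (P.node_of_fixed h)
      · rw [P.node_of_fixed (P.turn_symm_fixed h)]; simp
  · rintro (rfl | rfl)
    · exact Perm.SameCycle.refl _ _
    · exact ⟨1, by simpa using P.node_of_fixed h⟩

lemma sameCycle_node_crossed {a b : H.Dart} (h : P.turn a ≠ a) :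
    P.node.SameCycle a b ↔
      b = a ∨ b = P.turn a ∨ b = a.symm ∨ b = (P.turn a).symm := by
  have e1 := P.node_of_crossed h
  have e2 : P.node (P.turn a) = a.symm := by
    rw [P.node_of_crossed (P.turn_crossed h), P.turn_turn a h]
  have e3 : P.node a.symm = (P.turn a).symm := by
    rw [P.node_of_crossed (P.turn_symm_crossed h), P.turn_symm h]
  have e4 : P.node (P.turn a).symm = a := by
    rw [P.node_of_crossed (P.turn_symm_crossed (P.turn_crossed h)), P.turn_turn_symm h]
  constructor
  · intro hab
    obtain ⟨n, rfl⟩ := hab.exists_nat_pow_eq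
    clear hab
    induction n with
    | zero => simp
    | succ n ih =>
      rw [pow_succ', Perm.mul_apply]
      rcases ih with ih | ih | ih | ih <;> rw [ih]
      · exact Or.inr (Or.inl e1)
      · exact Or.inr (Or.inr (Or.inl e2))
      · exact Or.inr (Or.inr (Or.inr e3))
      · exact Or.inl e4
  · rintro (rfl | rfl | rfl | rfl)
    · exact Perm.SameCycle.refl _ _
    · exact ⟨1, by simpa using e1⟩
    · exact ⟨2, by rw [← e2, ← e1]; rfl⟩
    · exact ⟨3, by rw [← e3, ← e2, ← e1]; rfl⟩

lemma crossed_ne {a : H.Dart} (h : P.turn a ≠ a) : a ≠ a.symm ∧ a ≠ (P.turn a).symm ∧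
    P.turn a ≠ a.symm ∧ P.turn a ≠ (P.turn a).symm ∧ a.symm ≠ (P.turn a).symm := by
  obtain ⟨h1, h2, h3, h4⟩ := P.turn_indep a h
  refine ⟨a.symm_ne.symm, ?_, ?_, (P.turn a).symm_ne.symm, ?_⟩ <;> intro e
  · exact h3 (congrArg (fun d : H.Dart => d.fst) e).symm
  · exact h2 (congrArg (fun d : H.Dart => d.fst) e)
  · exact h (by simpa using (congrArg SimpleGraph.Dart.symm e).symm)

open Classical in
lemma card_le_faces (S : Finset V) (hS : ∀ a : H.Dart, a.fst ∈ S) :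
    (∑ a : H.Dart, if P.turn a = a then (2 : ℚ) else 3) ≤
      4 * S.card + 4 * Nat.card (Quotient (Perm.SameCycle.setoid P.face)) := by
  have h1 := card_le_card_cycles P.rot P.face P.node (fun a => (⟨a.fst, hS a⟩ : S)) (by
    intro z hz hz'
    refine P.planar z (fun v s hs => ?_) (fun a ha => ?_) (fun a ha => ?_)
    · rcases s.eq_empty_or_nonempty with rfl | ⟨b, hb⟩
      · simp
      · refine hz ⟨v, (hs b).1 hb ▸ hS b⟩ s fun a => ?_
        simp [hs]
    · have := hz' a {a, a.symm} (fun b => by simp [P.sameCycle_node_fixed ha])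
      rw [Finset.sum_pair a.symm_ne.symm] at this
      exact (CharTwo.add_eq_zero.mp this).symm
    · have := hz' a {a, P.turn a, a.symm, (P.turn a).symm}
        (fun b => by simp [P.sameCycle_node_crossed ha])
      obtain ⟨n1, n2, n3, n4, n5⟩ := P.crossed_ne ha
      rw [Finset.sum_insert (by simp [n1, n2, Ne.symm ha]),
        Finset.sum_insert (by simp [n3, n4]), Finset.sum_pair n5] at this
      rw [← this]; ring)
  have h2 := mul_card_cycles_le_sum P.node (fun a => if P.turn a = a then (2 : ℚ) else 1) 4 (by
    intro a
    by_cases ha : P.turn a = a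
    · refine ⟨{a, a.symm}, fun b hb => ?_, ?_⟩
      · rw [P.sameCycle_node_fixed ha]; simpa using hb
      · rw [Finset.sum_pair a.symm_ne.symm, if_pos ha, if_pos (P.turn_symm_fixed ha)]; norm_num
    · obtain ⟨n1, n2, n3, n4, n5⟩ := P.crossed_ne ha
      refine ⟨{a, P.turn a, a.symm, (P.turn a).symm}, fun b hb => ?_, ?_⟩
      · rw [P.sameCycle_node_crossed ha]; simpa using hb
      · rw [Finset.sum_insert (by simp [n1, n2, Ne.symm ha]),
          Finset.sum_insert (by simp [n3, n4]), Finset.sum_pair n5, if_neg ha,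
          if_neg (P.turn_crossed ha), if_neg (P.turn_symm_crossed ha),
          if_neg (P.turn_symm_crossed (P.turn_crossed ha))]
        norm_num) (fun a => by split_ifs <;> norm_num)
  have h3 : (Fintype.card H.Dart : ℚ) ≤ S.card +
      Nat.card (Quotient (Perm.SameCycle.setoid P.node)) +
      Nat.card (Quotient (Perm.SameCycle.setoid P.face)) := by
    have := h1
    rw [Fintype.card_coe] at this
    exact_mod_cast this
  have h4 : (∑ a : H.Dart, if P.turn a = a then (2 : ℚ) else 3) =
      4 * Fintype.card H.Dart - ∑ a : H.Dart, if P.turn a = a then (2 : ℚ) else 1 := by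
    rw [eq_sub_iff_add_eq, ← Finset.sum_add_distrib, Finset.sum_congr rfl
      (g := fun _ => (4 : ℚ)) (fun a _ => by split_ifs <;> norm_num)]
    simp [mul_comm]
  linarith

lemma face_ne (a : H.Dart) : P.face a ≠ a := by
  intro h
  have := P.face_fst a
  rw [h] at this
  by_cases ha : P.turn a = a
  · rw [ha] at this; exact a.adj.ne this
  · exact (P.turn_indep a ha).2.2.1 this.symm

lemma sum_pow_ge {w : H.Dart → ℚ} (a : H.Dart) {t : ℚ}
    (h : (P.face (P.face a) = a ∧ t ≤ w a + w (P.face a)) ∨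
      (P.face (P.face a) ≠ a ∧ P.face (P.face (P.face a)) = a ∧
        t ≤ w a + w (P.face a) + w (P.face (P.face a))) ∨
      (P.face (P.face a) ≠ a ∧ P.face (P.face (P.face a)) ≠ a ∧
        t ≤ w a + w (P.face a) + w (P.face (P.face a)) + w (P.face (P.face (P.face a))))) :
    ∃ s : Finset H.Dart, (∀ b ∈ s, P.face.SameCycle a b) ∧ t ≤ ∑ b ∈ s, w b := by
  classical
  have n1 := P.face_ne
  have c1 : P.face.SameCycle a (P.face a) := ⟨1, rfl⟩
  have c2 : P.face.SameCycle a (P.face (P.face a)) := ⟨2, rfl⟩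
  have c3 : P.face.SameCycle a (P.face (P.face (P.face a))) := ⟨3, rfl⟩
  rcases h with ⟨_, h⟩ | ⟨h2, _, h⟩ | ⟨h2, h3, h⟩
  · refine ⟨{a, P.face a}, by simp [c1, Perm.SameCycle.refl], ?_⟩
    rwa [Finset.sum_pair (n1 a).symm]
  · refine ⟨{a, P.face a, P.face (P.face a)}, by simp [c1, c2, Perm.SameCycle.refl], ?_⟩
    rw [Finset.sum_insert (by simp [(n1 a).symm, Ne.symm h2]),
      Finset.sum_pair (n1 _).symm]
    linarith
  · refine ⟨{a, P.face a, P.face (P.face a), P.face (P.face (P.face a))},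
      by simp [c1, c2, c3, Perm.SameCycle.refl], ?_⟩
    have h2' : P.face (P.face (P.face a)) ≠ P.face a := fun e => h2 (P.face.injective e)
    rw [Finset.sum_insert (by simp [(n1 a).symm, Ne.symm h2, Ne.symm h3]),
      Finset.sum_insert (by simp [(n1 _).symm, Ne.symm h2']),
      Finset.sum_pair (n1 _).symm]
    linarith

end OnePlaneRotation

end Discharging

section Discharging

open Equiv Finset

namespace OnePlaneRotation

variable {V : Type*} {H : SimpleGraph V} [Fintype H.Dart] (P : OnePlaneRotation H)

lemma face_of_fixed_ne {a : H.Dart} (hR : ∀ a, P.rot a ≠ a) (ha : P.turn a = a) :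
    P.face a ≠ a.symm := by
  intro h
  rw [face_apply, ha, Equiv.symm_apply_eq] at h
  exact hR _ h.symm

lemma face_face_ne_of_fixed {a : H.Dart} (hR : ∀ a, P.rot a ≠ a) (ha : P.turn a = a)
    (hb : P.turn (P.face a) = P.face a) : P.face (P.face a) ≠ a := by
  intro h
  refine P.face_of_fixed_ne hR ha (SimpleGraph.Dart.eq_of_fst_snd ?_ ?_)
  · rw [P.face_fst, ha]; rfl
  · have := P.face_fst (P.face a)
    rw [h, hb] at this
    exact this.symm

lemma card_dart_le_of_uncrossed (hT : ∀ a b c, H.Adj a b → H.Adj b c → H.Adj c a → False)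
    (hC : ∀ a b c d, a ≠ c → b ≠ d → H.Adj a b → H.Adj b c → H.Adj c d → H.Adj d a → False)
    (hR : ∀ a, P.rot a ≠ a) (hU : ∀ a, P.turn a = a) (S : Finset V)
    (hS : ∀ a : H.Dart, a.fst ∈ S) : 3 * Fintype.card H.Dart ≤ 10 * S.card := by
  classical
  have n1 := P.face_ne
  have n2 : ∀ a, P.face (P.face a) ≠ a := fun a => P.face_face_ne_of_fixed hR (hU _) (hU _)
  have e : ∀ a, (P.face a).fst = a.snd := fun a => by rw [P.face_fst, hU]
  have n3 : ∀ a, P.face (P.face (P.face a)) ≠ a := by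
    intro a h
    have h1 := e a
    have h2 := e (P.face a)
    have h3 := e (P.face (P.face a))
    rw [h] at h3
    have d1 := a.adj
    have d2 := (P.face a).adj
    have d3 := (P.face (P.face a)).adj
    rw [h1] at d2
    rw [h2, ← h3] at d3
    exact hT _ _ _ d1 d2 d3
  have n4 : ∀ a, P.face (P.face (P.face (P.face a))) ≠ a := by
    intro a h
    have h1 := e a
    have h2 := e (P.face a)
    have h3 := e (P.face (P.face a))
    have h4 := e (P.face (P.face (P.face a)))
    rw [h] at h4
    have d1 := a.adj
    have d2 := (P.face a).adj
    have d3 := (P.face (P.face a)).adj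
    have d4 := (P.face (P.face (P.face a))).adj
    rw [h1] at d2
    rw [h2] at d3
    rw [h3, ← h4] at d4
    refine hC _ _ _ _ ?_ ?_ d1 d2 d3 d4
    · intro h
      exact P.face_of_fixed_ne hR (hU a) (SimpleGraph.Dart.eq_of_fst_snd h1 h.symm)
    · intro h
      exact P.face_of_fixed_ne hR (hU _) (SimpleGraph.Dart.eq_of_fst_snd h2 (h.symm.trans h1.symm))
  have h5 := mul_card_cycles_le_sum P.face (fun _ => 1) 5 (by
    intro a
    set b := P.face a with hb
    set c := P.face b with hc
    set d := P.face c with hd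
    set f := P.face d with hf
    have m1 := n1 a; have m2 := n1 b; have m3 := n1 c; have m4 := n1 d
    have m5 := n2 a; have m6 := n2 b; have m7 := n2 c
    have m8 := n3 a; have m9 := n3 b; have m10 := n4 a
    simp only [← hb, ← hc, ← hd, ← hf] at m1 m2 m3 m4 m5 m6 m7 m8 m9 m10
    refine ⟨{a, b, c, d, f}, ?_, ?_⟩
    · have c1 : P.face.SameCycle a b := ⟨1, rfl⟩
      have c2 : P.face.SameCycle a c := ⟨2, rfl⟩
      have c3 : P.face.SameCycle a d := ⟨3, rfl⟩
      have c4 : P.face.SameCycle a f := ⟨4, rfl⟩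
      simp [c1, c2, c3, c4, Perm.SameCycle.refl]
    · rw [Finset.sum_const,
        Finset.card_insert_of_notMem (by simp [m1.symm, m5.symm, m8.symm, m10.symm]),
        Finset.card_insert_of_notMem (by simp [m2.symm, m6.symm, m9.symm]),
        Finset.card_insert_of_notMem (by simp [m3.symm, m7.symm]), Finset.card_pair m4.symm]
      norm_num) (fun _ => by norm_num)
  have h6 := P.card_le_faces S hS
  simp only [hU, if_true, Finset.sum_const, Finset.card_univ, nsmul_eq_mul, mul_one] at h5 h6
  have : (3 * Fintype.card H.Dart : ℚ) ≤ 10 * S.card := by linarith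
  exact_mod_cast this

/-- The dart `a` is crossed, and the two end vertices of the sector to its left at the crossing
are joined by an uncrossed edge. -/
def Tri (a : H.Dart) : Prop :=
  P.turn a ≠ a ∧ ∃ b, P.turn b = b ∧ b.fst = a.fst ∧ b.snd = (P.turn a).snd

lemma tri_turn {a : H.Dart} (ha : P.turn a ≠ a) (h : P.Tri (P.turn a)) :
    ∃ b, P.turn b = b ∧ b.fst = (P.turn a).fst ∧ b.snd = a.fst := by
  obtain ⟨-, b, hb, h1, h2⟩ := h
  rw [P.turn_turn a ha] at h2
  exact ⟨b, hb, h1, h2⟩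

lemma tri_turn_symm {a : H.Dart} (ha : P.turn a ≠ a) (h : P.Tri (P.turn a).symm) :
    ∃ b, P.turn b = b ∧ b.fst = (P.turn a).snd ∧ b.snd = a.snd := by
  obtain ⟨-, b, hb, h1, h2⟩ := h
  rw [P.turn_turn_symm ha] at h2
  exact ⟨b, hb, h1, h2⟩

lemma not_tri_turn (hT : ∀ a b c, H.Adj a b → H.Adj b c → H.Adj c a → False) {a : H.Dart}
    (h : P.Tri a) : ¬ P.Tri (P.turn a) := by
  intro h'
  obtain ⟨b, -, b1, b2⟩ := h.2
  obtain ⟨c, -, c1, c2⟩ := P.tri_turn h.1 h'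
  have d1 := b.adj
  have d2 := c.adj
  rw [b1, b2] at d1
  rw [c1, c2] at d2
  exact hT _ _ _ d1 (P.turn a).adj.symm d2

lemma not_tri_turn_symm (hT : ∀ a b c, H.Adj a b → H.Adj b c → H.Adj c a → False) {a : H.Dart}
    (h : P.Tri a) : ¬ P.Tri (P.turn a).symm := by
  intro h'
  obtain ⟨b, -, b1, b2⟩ := h.2
  obtain ⟨c, -, c1, c2⟩ := P.tri_turn_symm h.1 h'
  have d1 := b.adj
  have d2 := c.adj
  rw [b1, b2] at d1
  rw [c1, c2] at d2
  exact hT _ _ _ d1 d2 a.adj.symm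

lemma not_tri_turn_and
    (hC : ∀ a b c d, a ≠ c → b ≠ d → H.Adj a b → H.Adj b c → H.Adj c d → H.Adj d a → False)
    {a : H.Dart} (ha : P.turn a ≠ a) (h : P.Tri (P.turn a)) : ¬ P.Tri (P.turn a).symm := by
  intro h'
  obtain ⟨b, -, b1, b2⟩ := P.tri_turn ha h
  obtain ⟨c, -, c1, c2⟩ := P.tri_turn_symm ha h'
  have d1 := b.adj
  have d2 := c.adj
  rw [b1, b2] at d1
  rw [c1, c2] at d2
  obtain ⟨h1, h2, h3, h4⟩ := P.turn_indep a ha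
  exact hC _ _ _ _ h2 h3.symm d1 a.adj d2.symm (P.turn a).adj.symm

lemma not_bad_pair
    (hC : ∀ a b c d, a ≠ c → b ≠ d → H.Adj a b → H.Adj b c → H.Adj c d → H.Adj d a → False)
    {a b : H.Dart} (ha : P.turn a ≠ a) (hb : P.turn b ≠ b) (hab : b.fst = (P.turn a).snd)
    (hba : a.fst = (P.turn b).snd) (ha' : P.Tri (P.turn a) ∨ P.Tri (P.turn a).symm) :
    ¬ (P.Tri (P.turn b) ∨ P.Tri (P.turn b).symm) := by
  intro hb'
  have key : ∀ {x y}, H.Adj x a.fst → H.Adj x b.fst → H.Adj y a.fst → H.Adj y b.fst → x = y := by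
    intro x y h1 h2 h3 h4
    by_contra hxy
    exact hC _ _ _ _ (by rw [hab]; exact (P.turn_indep a ha).2.2.1.symm) hxy h1.symm h2 h4.symm h3
  have ea := a.adj
  have eb := b.adj
  have eta := (P.turn a).adj
  have etb := (P.turn b).adj
  rw [← hab] at eta
  rw [← hba] at etb
  rcases ha' with h | h
  · obtain ⟨e, he, e1, e2⟩ := P.tri_turn ha h
    have ee := e.adj
    rw [e1, e2] at ee
    rcases hb' with h' | h'
    · obtain ⟨f, hf, f1, f2⟩ := P.tri_turn hb h'
      have ef := f.adj
      rw [f1, f2] at ef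
      have := key ee eta etb ef
      have : e = P.turn b := SimpleGraph.Dart.eq_of_fst_snd (e1.trans this) (e2.trans hba)
      exact P.turn_crossed hb (this ▸ he)
    · obtain ⟨f, hf, f1, f2⟩ := P.tri_turn_symm hb h'
      have ef := f.adj
      rw [f1, f2, ← hba] at ef
      have := key ee eta ef.symm eb.symm
      have : b = (P.turn a).symm := SimpleGraph.Dart.eq_of_fst_snd hab this.symm
      rw [this, P.turn_turn_symm ha] at hba
      exact ea.ne hba
  · obtain ⟨e, he, e1, e2⟩ := P.tri_turn_symm ha h
    have ee := e.adj
    rw [e1, e2, ← hab] at ee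
    rcases hb' with h' | h'
    · obtain ⟨f, hf, f1, f2⟩ := P.tri_turn hb h'
      have ef := f.adj
      rw [f1, f2] at ef
      have := key ea.symm ee.symm etb ef
      have : P.turn b = a.symm := SimpleGraph.Dart.eq_of_fst_snd this.symm hba.symm
      rw [← P.turn_turn a ha] at this
      rw [P.turn.injective this] at hab
      exact (P.turn a).adj.ne hab
    · obtain ⟨f, hf, f1, f2⟩ := P.tri_turn_symm hb h'
      have ef := f.adj
      rw [f1, f2, ← hba] at ef
      have := key ea.symm ee.symm ef.symm eb.symm
      have : e = b := SimpleGraph.Dart.eq_of_fst_snd (e1.trans hab.symm) (e2.trans this)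
      exact hb (this ▸ he)

open Classical in
lemma five_mul_card_dart_le (hT : ∀ a b c, H.Adj a b → H.Adj b c → H.Adj c a → False)
    (hC : ∀ a b c d, a ≠ c → b ≠ d → H.Adj a b → H.Adj b c → H.Adj c d → H.Adj d a → False)
    (hR : ∀ a, P.rot a ≠ a) (S : Finset V)
    (hS : ∀ a : H.Dart, a.fst ∈ S) : 5 * Fintype.card H.Dart ≤ 24 * S.card := by
  let tri : H.Dart → ℚ := fun a => if P.Tri a then 1 else 0
  have tri_pos : ∀ {a}, P.Tri a → tri a = 1 := fun h => if_pos h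
  have tri_neg : ∀ {a}, ¬ P.Tri a → tri a = 0 := fun h => if_neg h
  let w : H.Dart → ℚ := fun a => (if P.turn a = a then 7 / 2 else 13 / 2) + 2 * tri a -
    tri (P.turn a) - tri (P.turn a).symm
  have w_fixed : ∀ {a}, P.turn a = a → w a = 7 / 2 := by
    intro a ha
    have h1 : ¬ P.Tri a := fun h => h.1 ha
    have h2 : ¬ P.Tri a.symm := fun h => h.1 (P.turn_symm_fixed ha)
    simp only [w, ha, if_true, tri_neg h1, tri_neg h2]; norm_num
  have w_tri : ∀ {a}, P.Tri a → w a = 17 / 2 := by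
    intro a ha
    simp only [w, if_neg ha.1, tri_pos ha, tri_neg (P.not_tri_turn hT ha),
      tri_neg (P.not_tri_turn_symm hT ha)]
    norm_num
  have w_crossed : ∀ {a}, P.turn a ≠ a → 11 / 2 ≤ w a := by
    intro a ha
    by_cases h : P.Tri a
    · rw [w_tri h]; norm_num
    · simp only [w, if_neg ha, tri_neg h]
      by_cases h1 : P.Tri (P.turn a)
      · rw [tri_pos h1, tri_neg (P.not_tri_turn_and hC ha h1)]; norm_num
      · rw [tri_neg h1]
        simp only [tri]; split_ifs <;> norm_num
  have w_good : ∀ {a}, P.turn a ≠ a → ¬ (P.Tri (P.turn a) ∨ P.Tri (P.turn a).symm) →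
      13 / 2 ≤ w a := by
    intro a ha h
    push Not at h
    simp only [w, if_neg ha, tri_neg h.1, tri_neg h.2]
    simp only [tri]; split_ifs <;> norm_num
  have w_ge : ∀ a, 7 / 2 ≤ w a := by
    intro a
    by_cases ha : P.turn a = a
    · rw [w_fixed ha]
    · exact le_trans (by norm_num) (w_crossed ha)
  have hw := mul_card_cycles_le_sum P.face w 12 (by
    intro a
    apply P.sum_pow_ge
    by_cases h2 : P.face (P.face a) = a
    · refine Or.inl ⟨h2, ?_⟩
      have e1 := P.face_fst a
      have e2 := P.face_fst (P.face a)
      have hne := fun ha hb => P.face_face_ne_of_fixed (a := a) hR ha hb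
      rw [h2] at e2
      revert hne e1 e2
      generalize P.face a = b at *
      intro e1 e2 hne
      by_cases ha : P.turn a = a
      · by_cases hb : P.turn b = b
        · exact (hne ha hb h2).elim
        · rw [ha] at e1
          rw [w_fixed ha, w_tri ⟨hb, a.symm, P.turn_symm_fixed ha, e1.symm, e2⟩]
          norm_num
      · by_cases hb : P.turn b = b
        · rw [hb] at e2
          rw [w_fixed hb, w_tri ⟨ha, b.symm, P.turn_symm_fixed hb, e2.symm, e1⟩]
          norm_num
        · by_cases ha' : P.Tri (P.turn a) ∨ P.Tri (P.turn a).symm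
          · have := w_good hb (P.not_bad_pair hC ha hb e1 e2 ha')
            have := w_crossed ha
            linarith
          · have := w_good ha ha'
            have := w_crossed hb
            linarith
    · right
      by_cases h3 : P.face (P.face (P.face a)) = a
      · refine Or.inl ⟨h2, h3, ?_⟩
        have e1 := P.face_fst a
        have e2 := P.face_fst (P.face a)
        have e3 := P.face_fst (P.face (P.face a))
        rw [h3] at e3
        have g1 := w_ge a
        have g2 := w_ge (P.face a)
        have g3 := w_ge (P.face (P.face a))
        by_cases ha : P.turn a = a
        · by_cases hb : P.turn (P.face a) = P.face a
          · by_cases hc : P.turn (P.face (P.face a)) = P.face (P.face a)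
            · rw [ha] at e1
              rw [hb] at e2
              rw [hc] at e3
              have d2 := (P.face a).adj
              have d3 := (P.face (P.face a)).adj
              rw [e1] at d2
              rw [e2, ← e3] at d3
              exact (hT _ _ _ a.adj d2 d3).elim
            · have := w_crossed hc; linarith
          · have := w_crossed hb; linarith
        · have := w_crossed ha; linarith
      · refine Or.inr ⟨h2, h3, ?_⟩
        have g1 := w_ge a
        have g2 := w_ge (P.face a)
        have g3 := w_ge (P.face (P.face a))
        have g4 := w_ge (P.face (P.face (P.face a)))
        linarith) (fun a => le_trans (by norm_num) (w_ge a))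
  have hs : ∑ a, w a = ∑ a : H.Dart, if P.turn a = a then (7 / 2 : ℚ) else 13 / 2 := by
    simp only [w, Finset.sum_sub_distrib, Finset.sum_add_distrib, ← Finset.mul_sum]
    have h1 : ∑ a, tri (P.turn a) = ∑ a, tri a := Equiv.sum_comp P.turn tri
    have h2 : ∑ a, tri (P.turn a).symm = ∑ a, tri a :=
      Equiv.sum_comp (P.turn.trans (Function.Involutive.toPerm SimpleGraph.Dart.symm
        SimpleGraph.Dart.symm_involutive)) tri
    rw [h1, h2]; ring
  have h6 := P.card_le_faces S hS
  have h7 : 3 * (∑ a : H.Dart, if P.turn a = a then (2 : ℚ) else 3) -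
      (∑ a : H.Dart, if P.turn a = a then (7 / 2 : ℚ) else 13 / 2) =
      5 / 2 * Fintype.card H.Dart := by
    rw [Finset.mul_sum, ← Finset.sum_sub_distrib, Finset.sum_congr rfl
      (g := fun _ => (5 / 2 : ℚ)) (fun a _ => by split_ifs <;> norm_num)]
    simp [mul_comm]
  rw [hs] at hw
  have : (5 * Fintype.card H.Dart : ℚ) ≤ 24 * S.card := by linarith
  exact_mod_cast this

end OnePlaneRotation

end Discharging

section FirstReturn

open Equiv

/-- The first return permutation: a permutation `τ` all of whose orbits through the range of the
injection `r` are finite induces a permutation of the source of `r`. -/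
lemma exists_firstReturn {A D : Type*} [Finite A] (τ : Perm D) (r : A → D)
    (hr : Function.Injective r) (hrec : ∀ a, ∃ n > 0, (τ ^ n) (r a) = r a) :
    ∃ ρ : Perm A, (∀ a b, ρ.SameCycle a b ↔ τ.SameCycle (r a) (r b)) ∧
      ∀ c : D → ZMod 2, (∀ a d, τ.SameCycle (r a) d → (∀ b, r b ≠ d) → c (τ.symm d) = c d) →
        ∀ a, c (r (ρ.symm a)) = c (τ.symm (r a)) := by
  classical
  have hex : ∀ a, ∃ n, 0 < n ∧ ∃ b, (τ ^ n) (r a) = r b := fun a =>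
    let ⟨n, hn, h⟩ := hrec a; ⟨n, hn, a, h⟩
  let k : A → ℕ := fun a => Nat.find (hex a)
  have hk : ∀ a, 0 < k a := fun a => (Nat.find_spec (hex a)).1
  have hk' : ∀ a, ∃ b, (τ ^ k a) (r a) = r b := fun a => (Nat.find_spec (hex a)).2
  have hmin : ∀ a n, 0 < n → n < k a → ∀ b, (τ ^ n) (r a) ≠ r b := fun a n h1 h2 b hb =>
    Nat.find_min (hex a) h2 ⟨h1, b, hb⟩
  choose f hf using hk'
  have hinj : Function.Injective f := by
    have key : ∀ a b, f a = f b → k a ≤ k b → a = b := by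
      intro a b hab hle
      have h1 : (τ ^ k a) (r a) = (τ ^ k b) (r b) := by rw [hf, hf, hab]
      obtain ⟨m, hm⟩ := Nat.exists_eq_add_of_le hle
      rw [hm, pow_add, Perm.mul_apply] at h1
      have h2 := (τ ^ k a).injective h1
      rcases Nat.eq_zero_or_pos m with rfl | hpos
      · exact hr (by simpa using h2)
      · have := hk a
        exact (hmin b m hpos (by omega) a h2.symm).elim
    intro a b hab
    rcases le_total (k a) (k b) with h | h
    · exact key a b hab h
    · exact (key b a hab.symm h).symm
  let ρ : Perm A := Equiv.ofBijective f (Finite.injective_iff_bijective.1 hinj)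
  have hρ : ∀ a, r (ρ a) = (τ ^ k a) (r a) := fun a => (hf a).symm
  refine ⟨ρ, fun a b => ⟨fun h => ?_, fun h => ?_⟩, fun c hc a => ?_⟩
  · obtain ⟨n, rfl⟩ := h.exists_nat_pow_eq
    clear h
    induction n with
    | zero => exact Perm.SameCycle.refl _ _
    | succ n ih =>
      rw [pow_succ', Perm.mul_apply, hρ]
      exact ih.trans ⟨k ((ρ ^ n) a), by simp⟩
  · have hn : ∃ n : ℕ, (τ ^ n) (r a) = r b := by
      obtain ⟨i, hi⟩ := h
      obtain ⟨N, hN, hN'⟩ := hrec a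
      refine ⟨(i % N).toNat, ?_⟩
      rw [← hi, ← zpow_natCast, Int.toNat_of_nonneg (Int.emod_nonneg _ (by omega))]
      conv_rhs => rw [← Int.emod_add_mul_ediv i N, zpow_add, Perm.mul_apply, zpow_mul]
      rw [zpow_natCast, Perm.zpow_apply_eq_self_of_apply_eq_self hN']
    obtain ⟨n, hn⟩ := hn
    clear h
    induction n using Nat.strong_induction_on generalizing a with
    | _ n ih =>
      rcases Nat.eq_zero_or_pos n with rfl | hpos
      · rw [show a = b from hr (by simpa using hn)]
      · have hle : k a ≤ n := by
          by_contra hlt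
          exact hmin a n hpos (by omega) b hn
        obtain ⟨m, rfl⟩ := Nat.exists_eq_add_of_le' hle
        have := hk a
        refine Perm.SameCycle.trans ⟨1, rfl⟩ (ih m (by omega) (ρ a) ?_)
        rw [hρ, ← hn, pow_add, Perm.mul_apply]
  · obtain ⟨b, rfl⟩ := ρ.surjective a
    rw [Equiv.symm_apply_apply, hρ]
    have : ∀ n, n < k b → c ((τ ^ n) (r b)) = c (r b) := by
      intro n hn
      induction n with
      | zero => simp
      | succ n ih =>
        rw [← ih (by omega), ← hc b ((τ ^ (n + 1)) (r b)) ⟨(n + 1 : ℕ), by rw [zpow_natCast]⟩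
          (fun b' hb' => hmin b (n + 1) (by omega) hn b' hb'.symm), pow_succ', Perm.mul_apply,
          Equiv.symm_apply_apply]
    obtain ⟨m, hm⟩ : ∃ m, k b = m + 1 := ⟨k b - 1, by have := hk b; omega⟩
    rw [hm, pow_succ', Perm.mul_apply, Equiv.symm_apply_apply, this m (by omega)]

end FirstReturn

section Planarization

open Equiv

/-- The combinatorial data of a graph drawn in the plane without crossings, with vertices of two
kinds: arbitrary ones (`V`) and vertices of degree four (`X`). The permutation `rot` is the rotation
at the vertices and `rev` reverses the darts. -/
structure Planarization (V X D : Type*) where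
  rot : Perm D
  rev : D → D
  vt : D → V ⊕ X
  rev_rev : ∀ d, rev (rev d) = d
  sameCycle : ∀ d d', rot.SameCycle d d' ↔ vt d = vt d'
  card_crossing : ∀ x, Nat.card {d // vt d = Sum.inr x} = 4
  planar : ∀ Z : D → ZMod 2, (∀ d, Z (rev d) = Z d) →
    (∀ w, ∀ s : Finset D, (∀ d, d ∈ s ↔ vt d = w) → ∑ d ∈ s, Z d = 0) →
    ∃ c : D → ZMod 2, ∀ d, c (rot.symm d) = c (rev d) ∧ c d + c (rev d) = Z d

namespace Planarization

variable {V X D : Type*} (M : Planarization V X D)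

lemma vt_rot (d : D) : M.vt (M.rot d) = M.vt d :=
  ((M.sameCycle _ _).1 ⟨1, rfl⟩).symm

lemma rev_injective : Function.Injective M.rev := Function.LeftInverse.injective M.rev_rev

variable [Fintype D]

lemma exists_iterate {h d : D} {x : X} (hh : M.vt h = Sum.inr x) (hd : M.vt d = Sum.inr x) :
    d = h ∨ d = M.rot h ∨ d = M.rot (M.rot h) ∨ d = M.rot (M.rot (M.rot h)) := by
  classical
  let s : Finset D := Finset.univ.filter fun d => M.vt d = Sum.inr x
  have hs : s.card = 4 := by
    rw [← M.card_crossing x, Nat.card_eq_fintype_card, Fintype.card_subtype]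
  have hcyc : M.rot.IsCycleOn (s : Set D) := by
    refine ⟨⟨fun d hd => ?_, M.rot.injective.injOn, fun d hd => ⟨M.rot.symm d, ?_, by simp⟩⟩,
      fun d hd d' hd' => ?_⟩
    · simpa [s, M.vt_rot] using hd
    · have := M.vt_rot (M.rot.symm d)
      simp only [Equiv.apply_symm_apply] at this
      simpa [s, ← this] using hd
    · rw [M.sameCycle]
      simp only [s, Finset.coe_filter, Finset.mem_univ, true_and, Set.mem_ofPred_eq] at hd hd'
      rw [hd, hd']
  obtain ⟨n, hn, rfl⟩ := hcyc.exists_pow_eq (a := h) (b := d) (by simp [s, hh]) (by simp [s, hd])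
  rw [hs] at hn
  interval_cases n <;> simp [pow_succ]

lemma rot_four {h : D} {x : X} (hh : M.vt h = Sum.inr x) :
    M.rot (M.rot (M.rot (M.rot h))) = h ∧ h ≠ M.rot h ∧ h ≠ M.rot (M.rot h) ∧
      h ≠ M.rot (M.rot (M.rot h)) := by
  classical
  let s : Finset D := Finset.univ.filter fun d => M.vt d = Sum.inr x
  have hs : s.card = 4 := by
    rw [← M.card_crossing x, Nat.card_eq_fintype_card, Fintype.card_subtype]
  have hsub : s ⊆ {h, M.rot h, M.rot (M.rot h), M.rot (M.rot (M.rot h))} := by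
    intro d hd
    simpa using M.exists_iterate hh (by simpa [s] using hd)
  have hcard : ({h, M.rot h, M.rot (M.rot h), M.rot (M.rot (M.rot h))} : Finset D).card = 4 :=
    le_antisymm Finset.card_le_four (hs ▸ Finset.card_le_card hsub)
  have n1 : h ≠ M.rot h := by
    intro e
    rw [← e, ← e, ← e] at hcard
    simp at hcard
  have n2 : h ≠ M.rot (M.rot h) := by
    intro e
    rw [← e] at hcard
    have : ({h, M.rot h, h, M.rot h} : Finset D) ⊆ {h, M.rot h} := by
      intro d; simp only [Finset.mem_insert, Finset.mem_singleton]; tauto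
    have := (Finset.card_le_card this).trans Finset.card_le_two
    omega
  have n3 : h ≠ M.rot (M.rot (M.rot h)) := by
    intro e
    rw [← e] at hcard
    have : ({h, M.rot h, M.rot (M.rot h), h} : Finset D) ⊆ {h, M.rot h, M.rot (M.rot h)} := by
      intro d; simp only [Finset.mem_insert, Finset.mem_singleton]; tauto
    have := (Finset.card_le_card this).trans Finset.card_le_three
    omega
  refine ⟨?_, n1, n2, n3⟩
  have h4 : M.vt (M.rot (M.rot (M.rot (M.rot h)))) = Sum.inr x := by simp [M.vt_rot, hh]
  rcases M.exists_iterate hh h4 with e | e | e | e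
  · exact e
  · exact (n3 (M.rot.injective e).symm).elim
  · exact (n2 (M.rot.injective (M.rot.injective e)).symm).elim
  · exact (n1 (M.rot.injective (M.rot.injective (M.rot.injective e))).symm).elim

end Planarization

end Planarization

section ListPairs

variable {D : Type*}

lemma List.pair_infix_append_iff {d d' : D} {A B : List D} :
    [d, d'] <:+: A ++ B ↔ [d, d'] <:+: A ∨ [d, d'] <:+: B ∨
      ∃ A' B', A = A' ++ [d] ∧ B = d' :: B' := by
  constructor
  · intro h
    induction A with
    | nil => exact Or.inr (Or.inl h)
    | cons e A ih =>
      rw [List.cons_append, List.infix_cons_iff] at h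
      rcases h with h | h
      · rcases A with _ | ⟨f, A⟩
        · rcases B with _ | ⟨g, B⟩
          · simp at h
          · simp at h
            obtain ⟨rfl, rfl⟩ := h
            exact Or.inr (Or.inr ⟨[], B, rfl, rfl⟩)
        · simp at h
          obtain ⟨rfl, rfl⟩ := h
          exact Or.inl ⟨[], A, rfl⟩
      · rcases ih h with h | h | ⟨A', B', rfl, rfl⟩
        · exact Or.inl (List.infix_cons h)
        · exact Or.inr (Or.inl h)
        · exact Or.inr (Or.inr ⟨e :: A', B', rfl, rfl⟩)
  · rintro (⟨s, t, rfl⟩ | ⟨s, t, rfl⟩ | ⟨A', B', rfl, rfl⟩)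
    · exact ⟨s, t ++ B, by simp⟩
    · exact ⟨A ++ s, t, by simp⟩
    · exact ⟨A', B', by simp⟩

lemma List.Nodup.pair_infix_right_unique {d d' d'' : D} {l : List D} (hl : l.Nodup)
    (h : [d, d'] <:+: l) (h' : [d, d''] <:+: l) : d' = d'' := by
  obtain ⟨s, t, rfl⟩ := h
  rw [List.append_assoc] at h' hl
  rcases List.pair_infix_append_iff.1 h' with h | h | ⟨A', B', rfl, h⟩
  · have := h.subset (List.mem_cons_self)
    simp only [List.nodup_append] at hl
    exact (hl.2.2 d this d (by simp) rfl).elim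
  · rw [List.cons_append, List.infix_cons_iff] at h
    rcases h with h | h
    · simpa [eq_comm] using h
    · have := h.subset (List.mem_cons_self)
      simp [List.nodup_append] at hl this
      grind
  · simp [List.nodup_append] at hl h

lemma List.pair_infix_map_reverse {D' : Type*} (f : D → D') {d d' : D} {l : List D}
    (h : [d, d'] <:+: l) : [f d', f d] <:+: (l.map f).reverse := by
  obtain ⟨s, t, rfl⟩ := h
  exact ⟨(t.map f).reverse, (s.map f).reverse, by simp⟩

end ListPairs

namespace Planarization

open Equiv

variable {V X D : Type*} (M : Planarization V X D)

/-- `d'` can follow `d` on a trail: they are incident at a vertex in `X`. -/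
def Step (d d' : D) : Prop := ∃ x, M.vt (M.rev d) = Sum.inr x ∧ M.vt d' = Sum.inr x

/-- The reversal of a list of darts. -/
def revList (l : List D) : List D := (l.map M.rev).reverse

lemma revList_revList (l : List D) : M.revList (M.revList l) = l := by
  simp [revList, List.map_reverse, Function.comp_def, M.rev_rev]

lemma mem_revList {d : D} {l : List D} : d ∈ M.revList l ↔ M.rev d ∈ l := by
  simp only [revList, List.mem_reverse, List.mem_map]
  exact ⟨fun ⟨e, he, h⟩ => by rw [← h, M.rev_rev]; exact he, fun h => ⟨_, h, M.rev_rev d⟩⟩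

lemma pair_infix_revList {d d' : D} {l : List D} :
    [d, d'] <:+: M.revList l ↔ [M.rev d', M.rev d] <:+: l := by
  constructor <;> intro h
  · have := List.pair_infix_map_reverse M.rev h
    rwa [← revList, revList_revList] at this
  · have := List.pair_infix_map_reverse M.rev h
    rwa [← revList, M.rev_rev, M.rev_rev] at this

/-- A trail from the vertex `u` to the vertex `v` whose inner vertices are in `X`. -/
def IsTrail (u v : V) (l : List D) : Prop :=
  l.IsChain M.Step ∧ l.head?.map M.vt = some (Sum.inl u) ∧
    l.getLast?.map (fun d => M.vt (M.rev d)) = some (Sum.inl v)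

variable {M}

lemma Step.rev {d d' : D} (h : M.Step d d') : M.Step (M.rev d') (M.rev d) := by
  obtain ⟨x, h1, h2⟩ := h
  exact ⟨x, by rwa [M.rev_rev], h1⟩

lemma IsTrail.revList {u v : V} {l : List D} (h : M.IsTrail u v l) :
    M.IsTrail v u (M.revList l) := by
  obtain ⟨h1, h2, h3⟩ := h
  refine ⟨?_, ?_, ?_⟩
  · rw [Planarization.revList, List.isChain_reverse, List.isChain_map]
    exact h1.imp fun a b hab => hab.rev
  · rw [Planarization.revList, List.head?_reverse, List.getLast?_map, Option.map_map]; exact h3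
  · rw [Planarization.revList, List.getLast?_reverse, List.head?_map, Option.map_map, ← h2]
    congr 1
    ext d
    simp [M.rev_rev]

lemma IsTrail.splice {u v u' v' : V} {A A' B B' : List D} {p p' q q' : D}
    (h : M.IsTrail u v (A ++ p :: q :: B)) (h' : M.IsTrail u' v' (A' ++ p' :: q' :: B'))
    (hs : M.Step p q') : M.IsTrail u v' (A ++ p :: q' :: B') := by
  obtain ⟨h1, h2, h3⟩ := h
  obtain ⟨h1', h2', h3'⟩ := h'
  refine ⟨?_, ?_, ?_⟩
  · simp only [List.isChain_append, List.isChain_cons_cons] at h1 h1' ⊢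
    exact ⟨h1.1, ⟨hs, h1'.2.1.2⟩, by simpa using h1.2.2⟩
  · rw [← h2]; cases A <;> simp
  · rw [← h3']
    simp [List.getLast?_cons]

variable (M)

/-- A family of trails, one for each dart of `H`, drawing `H` along the planarization `M` in such a
way that every dart of `M` is used at most once. -/
structure TrailSystem (H : SimpleGraph V) where
  trail : H.Dart → List D
  isTrail : ∀ a, M.IsTrail a.fst a.snd (trail a)
  trail_symm : ∀ a, trail a.symm = M.revList (trail a)
  nodup : ∀ a, (trail a).Nodup
  disjoint : ∀ a b d, d ∈ trail a → d ∈ trail b → a = b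

namespace TrailSystem

variable {M} {H : SimpleGraph V} (T : M.TrailSystem H)

/-- The dart `d'` follows `d` on some trail. -/
def Pass (d d' : D) : Prop := ∃ a, [d, d'] <:+: T.trail a

lemma step_of_consecutive {a : H.Dart} {d d' : D} (h : [d, d'] <:+: T.trail a) : M.Step d d' := by
  obtain ⟨s, t, h⟩ := h
  exact List.isChain_iff_forall_rel_of_append_cons_cons.1 (T.isTrail a).1
    (l₁ := s) (l₂ := t) (by simp [← h])

variable {T}

lemma Pass.step {d d' : D} (h : T.Pass d d') : M.Step d d' :=
  let ⟨_, h⟩ := h; T.step_of_consecutive h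

lemma infix_symm {a : H.Dart} {d d' : D} (h : [d, d'] <:+: T.trail a) :
    [M.rev d', M.rev d] <:+: T.trail a.symm := by
  rw [T.trail_symm, M.pair_infix_revList, M.rev_rev, M.rev_rev]; exact h

lemma Pass.symm {d d' : D} (h : T.Pass d d') : T.Pass (M.rev d') (M.rev d) :=
  let ⟨a, h⟩ := h; ⟨a.symm, infix_symm h⟩

lemma Pass.right_unique {d d' d'' : D} (h : T.Pass d d') (h' : T.Pass d d'') : d' = d'' := by
  obtain ⟨a, h⟩ := h
  obtain ⟨b, h'⟩ := h'
  obtain rfl := T.disjoint a b d (h.subset (by simp)) (h'.subset (by simp))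
  exact (T.nodup a).pair_infix_right_unique h h'

variable (T)

/-- The two trails through the vertex of `h` cross there, the first one entering along the reversal
of `h` and the second one entering along the reversal of the dart following `h`. -/
def Crossed (h : D) : Prop :=
  T.Pass (M.rev h) (M.rot (M.rot h)) ∧ T.Pass (M.rev (M.rot h)) (M.rot (M.rot (M.rot h)))

/-- The set of crossings of a trail system. -/
def crossings : Set X := {x | ∃ h, M.vt h = Sum.inr x ∧ T.Crossed h}

variable {T} [Fintype D]

lemma Crossed.rot {h : D} {x : X} (hx : M.vt h = Sum.inr x) (hc : T.Crossed h) :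
    T.Crossed (M.rot h) := by
  refine ⟨hc.2, ?_⟩
  rw [(M.rot_four hx).1]
  have := hc.1.symm
  rwa [M.rev_rev] at this

lemma Crossed.of_vt_eq {h h' : D} {x : X} (hx : M.vt h = Sum.inr x) (hx' : M.vt h' = Sum.inr x)
    (hc : T.Crossed h) : T.Crossed h' := by
  have h1 := hc.rot hx
  have h2 := h1.rot (by rwa [M.vt_rot])
  have h3 := h2.rot (by rwa [M.vt_rot, M.vt_rot])
  rcases M.exists_iterate hx hx' with rfl | rfl | rfl | rfl <;> assumption

lemma crossings_ssubset {T' : M.TrailSystem H} {h : D} {x : X} (hx : M.vt h = Sum.inr x)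
    (hc : T.Crossed h) (hp : T'.Pass (M.rev h) (M.rot (M.rot (M.rot h))))
    (hT : ∀ d d', T'.Pass d d' → T.Pass d d' ∨ M.vt d' = Sum.inr x) :
    T'.crossings ⊂ T.crossings := by
  have hxT' : x ∉ T'.crossings := by
    rintro ⟨h', hx', hc'⟩
    have := ((hc'.of_vt_eq hx' hx).1).right_unique hp
    exact (M.rot_four (h := M.rot (M.rot h)) (x := x) (by simpa [M.vt_rot] using hx)).2.1 this
  refine Set.ssubset_iff_of_subset ?_ |>.2 ⟨x, ⟨h, hx, hc⟩, hxT'⟩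
  rintro y ⟨h', hy, hc'⟩
  have hne : x ≠ y := by rintro rfl; exact hxT' ⟨h', hy, hc'⟩
  have key : ∀ d d', M.vt d' = Sum.inr y → T'.Pass d d' → T.Pass d d' := by
    intro d d' hd hp
    refine (hT d d' hp).resolve_right fun h => hne ?_
    rw [hd] at h
    exact (Sum.inr_injective h).symm
  exact ⟨h', hy, key _ _ (by simpa [M.vt_rot] using hy) hc'.1,
    key _ _ (by simpa [M.vt_rot] using hy) hc'.2⟩

end TrailSystem

end Planarization

namespace Planarization

open Equiv

variable {V X D : Type*} {M : Planarization V X D}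

lemma pair_infix_splice {d d' p q : D} {A B : List D} (h : [d, d'] <:+: A ++ p :: q :: B) :
    [d, d'] <:+: A ++ [p] ∨ [d, d'] <:+: q :: B ∨ d = p ∧ d' = q := by
  rw [show A ++ p :: q :: B = (A ++ [p]) ++ q :: B by simp, List.pair_infix_append_iff] at h
  rcases h with h | h | ⟨A', B', h1, h2⟩
  · exact Or.inl h
  · exact Or.inr (Or.inl h)
  · have := List.append_inj' h1 rfl
    simp at this h2
    exact Or.inr (Or.inr ⟨this.2.symm, h2.1.symm⟩)

open Classical in
lemma count_revList (d : D) (l : List D) : (M.revList l).count d = l.count (M.rev d) := by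
  conv_lhs => rw [← M.rev_rev d]
  rw [revList, List.count_reverse, List.count_map_of_injective _ _ M.rev_injective]

open Classical in
/-- Replacing the trail of `a`, and correspondingly the trail of `a.symm`. -/
noncomputable def setTrail (M : Planarization V X D) {H : SimpleGraph V}
    (f : H.Dart → List D) (a : H.Dart) (l : List D) : H.Dart → List D :=
  Function.update (Function.update f a l) a.symm (M.revList l)

section setTrail

variable {H : SimpleGraph V} {f : H.Dart → List D} {a : H.Dart} {l : List D}

open Classical in
lemma setTrail_self : M.setTrail f a l a = l := by
  unfold setTrail
  rw [Function.update_of_ne a.symm_ne.symm, Function.update_self]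

open Classical in
lemma setTrail_symm_self : M.setTrail f a l a.symm = M.revList l := by
  unfold setTrail
  rw [Function.update_self]

open Classical in
lemma setTrail_of_ne {c : H.Dart} (h : c ≠ a) (h' : c ≠ a.symm) : M.setTrail f a l c = f c := by
  unfold setTrail
  rw [Function.update_of_ne h', Function.update_of_ne h]

lemma isTrail_setTrail (hf : ∀ c, M.IsTrail c.fst c.snd (f c)) (hl : M.IsTrail a.fst a.snd l)
    (c : H.Dart) : M.IsTrail c.fst c.snd (M.setTrail f a l c) := by
  by_cases h : c = a
  · rw [h, setTrail_self]; exact hl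
  by_cases h' : c = a.symm
  · rw [h', setTrail_symm_self]; exact hl.revList
  · rw [setTrail_of_ne h h']; exact hf c

lemma setTrail_symm (hf : ∀ c, f c.symm = M.revList (f c)) (c : H.Dart) :
    M.setTrail f a l c.symm = M.revList (M.setTrail f a l c) := by
  by_cases h : c = a
  · rw [h, setTrail_symm_self, setTrail_self]
  by_cases h' : c = a.symm
  · rw [h', setTrail_symm_self, SimpleGraph.Dart.symm_symm, setTrail_self, revList_revList]
  · rw [setTrail_of_ne h h', setTrail_of_ne, hf]
    · rintro rfl; simp at h'
    · intro e; exact h (SimpleGraph.Dart.symm_involutive.injective e)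

lemma pair_infix_setTrail {d d' : D} {c : H.Dart} (h : [d, d'] <:+: M.setTrail f a l c) :
    [d, d'] <:+: f c ∨ [d, d'] <:+: l ∨ [M.rev d', M.rev d] <:+: l := by
  by_cases h1 : c = a
  · rw [h1, setTrail_self] at h; exact Or.inr (Or.inl h)
  by_cases h2 : c = a.symm
  · rw [h2, setTrail_symm_self, pair_infix_revList] at h; exact Or.inr (Or.inr h)
  · rw [setTrail_of_ne h1 h2] at h; exact Or.inl h

open Classical in
lemma sum_count_setTrail [Fintype H.Dart] (hf : f a.symm = M.revList (f a)) (d : D) :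
    ∑ c, (M.setTrail f a l c).count d + (f a).count d + (f a).count (M.rev d) =
      ∑ c, (f c).count d + l.count d + l.count (M.rev d) := by
  have key : ∀ (g : H.Dart → List D) (b : H.Dart) (m : List D),
      ∑ c, (Function.update g b m c).count d + (g b).count d = ∑ c, (g c).count d + m.count d := by
    intro g b m
    rw [← Finset.add_sum_erase _ _ (Finset.mem_univ b),
      ← Finset.add_sum_erase (a := b) (f := fun c => (g c).count d) _ (Finset.mem_univ b),
      Function.update_self, Finset.sum_congr rfl (g := fun c => (g c).count d)
      (fun c hc => by rw [Function.update_of_ne (Finset.ne_of_mem_erase hc)])]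
    ring
  have h1 := key (Function.update f a l) a.symm (M.revList l)
  have h2 := key f a l
  rw [Function.update_of_ne a.symm_ne, hf, count_revList, count_revList] at h1
  unfold setTrail
  omega

end setTrail

namespace TrailSystem

variable {H : SimpleGraph V} (T : M.TrailSystem H)

open Classical in
lemma sum_count_le_one [Fintype H.Dart] (d : D) : ∑ c, (T.trail c).count d ≤ 1 := by
  by_cases h : ∃ a, d ∈ T.trail a
  · obtain ⟨a, ha⟩ := h
    rw [Finset.sum_eq_single a (fun b _ hb => ?_) (by simp)]
    · exact List.nodup_iff_count_le_one.1 (T.nodup a) d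
    · exact List.count_eq_zero_of_not_mem fun hd => hb (T.disjoint _ _ d hd ha)
  · push Not at h
    simp [List.count_eq_zero_of_not_mem (h _)]

open Classical in
/-- A trail system from a family of trails using every dart at most once. -/
def ofCount [Fintype H.Dart] (f : H.Dart → List D) (h1 : ∀ a, M.IsTrail a.fst a.snd (f a))
    (h2 : ∀ a, f a.symm = M.revList (f a)) (h3 : ∀ d, ∑ c, (f c).count d ≤ 1) :
    M.TrailSystem H where
  trail := f
  isTrail := h1
  trail_symm := h2
  nodup a := List.nodup_iff_count_le_one.2 fun d =>
    (Finset.single_le_sum (f := fun c => (f c).count d) (fun _ _ => Nat.zero_le _)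
      (Finset.mem_univ a)).trans (h3 d)
  disjoint a b d ha hb := by
    by_contra hab
    have := (Finset.sum_le_sum_of_subset (f := fun c => (f c).count d)
      (Finset.subset_univ {a, b})).trans (h3 d)
    rw [Finset.sum_pair hab] at this
    have := List.count_pos_iff.2 ha
    have := List.count_pos_iff.2 hb
    omega

variable {T} [Fintype H.Dart]

/-- Two trails from the same vertex that cross can be exchanged up to the crossing. -/
lemma exists_swap [Fintype D] {a b : H.Dart} {h : D} {x : X} (hx : M.vt h = Sum.inr x)
    (ha : [M.rev h, M.rot (M.rot h)] <:+: T.trail a)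
    (hb : [M.rev (M.rot h), M.rot (M.rot (M.rot h))] <:+: T.trail b)
    (hab : a ≠ b) (hfst : a.fst = b.fst) :
    ∃ T' : M.TrailSystem H, T'.crossings ⊂ T.crossings := by
  obtain ⟨A, B, hA⟩ := ha
  obtain ⟨A', B', hA'⟩ := hb
  have hA0 : [M.rev h, M.rot (M.rot h)] <:+: T.trail a := ⟨A, B, hA⟩
  have hB0 : [M.rev (M.rot h), M.rot (M.rot (M.rot h))] <:+: T.trail b := ⟨A', B', hA'⟩
  set p := M.rev h with hp
  set q := M.rot (M.rot h) with hq
  set p' := M.rev (M.rot h) with hp'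
  set q' := M.rot q with hq'
  have hpx : M.vt (M.rev p) = Sum.inr x := by rw [hp, M.rev_rev, hx]
  have hqx : M.vt q = Sum.inr x := by rw [hq, M.vt_rot, M.vt_rot, hx]
  have hpx' : M.vt (M.rev p') = Sum.inr x := by rw [hp', M.rev_rev, M.vt_rot, hx]
  have hqx' : M.vt q' = Sum.inr x := by rw [hq', M.vt_rot, hqx]
  replace hA : T.trail a = A ++ p :: q :: B := by rw [← hA]; simp
  replace hA' : T.trail b = A' ++ p' :: q' :: B' := by rw [← hA']; simp
  have ta := T.isTrail a
  have tb := T.isTrail b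
  rw [hA] at ta
  rw [hA'] at tb
  have na := tb.splice ta ⟨x, hpx', hqx⟩
  have nb := ta.splice tb ⟨x, hpx, hqx'⟩
  rw [← hfst] at na
  rw [hfst] at nb
  have hba' : b ≠ a.symm := by
    rintro rfl
    exact a.adj.ne hfst
  let f := M.setTrail (M.setTrail T.trail a (A' ++ p' :: q :: B)) b (A ++ p :: q' :: B')
  have hf1 := T.trail_symm
  have hf2 := setTrail_symm (a := a) (l := A' ++ p' :: q :: B) hf1
  let T' : M.TrailSystem H := ofCount f
    (isTrail_setTrail (isTrail_setTrail T.isTrail na) nb) (setTrail_symm hf2) (by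
      classical
      intro d
      have h1 := sum_count_setTrail (l := A' ++ p' :: q :: B) (hf1 a) d
      have h2 := sum_count_setTrail (l := A ++ p :: q' :: B') (hf2 b) d
      rw [setTrail_of_ne hab.symm hba'] at h2
      have h3 := T.sum_count_le_one d
      rw [hA] at h1
      rw [hA'] at h2
      simp only [List.count_append, List.count_cons] at h1 h2
      simp only [f]
      omega)
  have hinf : ∀ {d d'}, ([d, d'] <:+: A' ++ p' :: q :: B ∨ [d, d'] <:+: A ++ p :: q' :: B') →
      T.Pass d d' ∨ M.vt (M.rev d) = Sum.inr x ∧ M.vt d' = Sum.inr x := by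
    intro d d' h
    rcases h with h | h <;> rcases pair_infix_splice h with h | h | ⟨rfl, rfl⟩
    · exact Or.inl ⟨b, h.trans ⟨[], q' :: B', by simp [hA']⟩⟩
    · exact Or.inl ⟨a, h.trans ⟨A ++ [p], [], by simp [hA]⟩⟩
    · exact Or.inr ⟨hpx', hqx⟩
    · exact Or.inl ⟨a, h.trans ⟨[], q :: B, by simp [hA]⟩⟩
    · exact Or.inl ⟨b, h.trans ⟨A' ++ [p'], [], by simp [hA']⟩⟩
    · exact Or.inr ⟨hpx, hqx'⟩
  have hinf' : ∀ {d d'}, ([M.rev d', M.rev d] <:+: A' ++ p' :: q :: B ∨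
      [M.rev d', M.rev d] <:+: A ++ p :: q' :: B') → T.Pass d d' ∨ M.vt d' = Sum.inr x := by
    intro d d' h
    rcases hinf h with h | h
    · have := h.symm
      rw [M.rev_rev, M.rev_rev] at this
      exact Or.inl this
    · rw [M.rev_rev] at h
      exact Or.inr h.1
  refine ⟨T', crossings_ssubset hx ⟨⟨a, hA0⟩, ⟨b, hB0⟩⟩ ⟨b, ?_⟩ ?_⟩
  · change _ <:+: M.setTrail _ b _ b
    rw [setTrail_self]
    exact ⟨A, B', by simp [p, q', q]⟩
  · rintro d d' ⟨c, hc⟩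
    rcases pair_infix_setTrail hc with hc | hc | hc
    · rcases pair_infix_setTrail hc with hc | hc | hc
      · exact Or.inl ⟨c, hc⟩
      · exact (hinf (Or.inl hc)).imp_right And.right
      · exact hinf' (Or.inl hc)
    · exact (hinf (Or.inr hc)).imp_right And.right
    · exact hinf' (Or.inr hc)

/-- A loop of a trail can be cut off. -/
lemma exists_shortcut {a : H.Dart} {x : X} {A B C : List D} {p q p' q' : D}
    (h1 : T.trail a = A ++ p :: q :: B) (h2 : q :: B = C ++ p' :: q' :: B')
    (hp : M.vt (M.rev p) = Sum.inr x) (hq' : M.vt q' = Sum.inr x) :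
    ∃ T' : M.TrailSystem H, T'.Pass p q' ∧
      ∀ d d', T'.Pass d d' → T.Pass d d' ∨ M.vt d' = Sum.inr x := by
  have h3 : T.trail a = (A ++ p :: C) ++ p' :: q' :: B' := by simp [h1, h2]
  have ta := T.isTrail a
  have tb := T.isTrail a
  rw [h1] at ta
  rw [h3] at tb
  have n := ta.splice tb ⟨x, hp, hq'⟩
  let T' : M.TrailSystem H := ofCount (M.setTrail T.trail a (A ++ p :: q' :: B'))
    (isTrail_setTrail T.isTrail n) (setTrail_symm T.trail_symm) (by
      classical
      intro d
      have h4 := sum_count_setTrail (l := A ++ p :: q' :: B') (T.trail_symm a) d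
      have h5 := T.sum_count_le_one d
      rw [h3] at h4
      simp only [List.count_append, List.count_cons] at h4
      omega)
  have hinf : ∀ {d d'}, [d, d'] <:+: A ++ p :: q' :: B' →
      T.Pass d d' ∨ M.vt (M.rev d) = Sum.inr x ∧ M.vt d' = Sum.inr x := by
    intro d d' h
    rcases pair_infix_splice h with h | h | ⟨rfl, rfl⟩
    · exact Or.inl ⟨a, h.trans ⟨[], q :: B, by simp [h1]⟩⟩
    · exact Or.inl ⟨a, h.trans ⟨A ++ p :: C ++ [p'], [], by simp [h3]⟩⟩
    · exact Or.inr ⟨hp, hq'⟩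
  refine ⟨T', ⟨a, ?_⟩, ?_⟩
  · change _ <:+: M.setTrail _ a _ a
    rw [setTrail_self]
    exact ⟨A, B', by simp⟩
  · rintro d d' ⟨c, hc⟩
    rcases pair_infix_setTrail hc with hc | hc | hc
    · exact Or.inl ⟨c, hc⟩
    · exact (hinf hc).imp_right And.right
    · rcases hinf hc with h | h
      · have := h.symm
        rw [M.rev_rev, M.rev_rev] at this
        exact Or.inl this
      · rw [M.rev_rev] at h
        exact Or.inr h.1

variable [Fintype D]

lemma exists_uncross {a : H.Dart} {h : D} {x : X} (hx : M.vt h = Sum.inr x)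
    (ha : [M.rev h, M.rot (M.rot h)] <:+: T.trail a)
    (hb : [M.rev (M.rot h), M.rot (M.rot (M.rot h))] <:+: T.trail a) :
    ∃ T' : M.TrailSystem H, T'.crossings ⊂ T.crossings := by
  have hc : T.Crossed h := ⟨⟨a, ha⟩, ⟨a, hb⟩⟩
  obtain ⟨A, B, hA⟩ := ha
  replace hA : T.trail a = A ++ M.rev h :: M.rot (M.rot h) :: B := by rw [← hA]; simp
  have hb' := hb
  rw [hA] at hb'
  obtain ⟨n1, n2, n3, n4⟩ := M.rot_four hx
  rcases pair_infix_splice hb' with ⟨C, E, hC⟩ | ⟨C, E, hC⟩ | ⟨h1, h2⟩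
  · have hA' : T.trail a = C ++ M.rev (M.rot h) :: M.rot (M.rot (M.rot h)) ::
        (E ++ M.rot (M.rot h) :: B) := by
      rw [hA, show A ++ M.rev h :: M.rot (M.rot h) :: B =
        (A ++ [M.rev h]) ++ M.rot (M.rot h) :: B by simp, ← hC]
      simp
    have hm : ∃ C', M.rot (M.rot (M.rot h)) :: E = C' ++ [M.rev h] := by
      rw [List.append_assoc, List.cons_append] at hC
      have : (M.rot (M.rot (M.rot h)) :: E).getLast? = some (M.rev h) := by
        have := congrArg List.getLast? hC
        simpa [List.getLast?_cons] using this
      exact (List.getLast?_eq_some_iff.1 this)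
    obtain ⟨C', hC'⟩ := hm
    obtain ⟨T', hp, hT⟩ := exists_shortcut (T := T) (x := x) (C := C') (p' := M.rev h)
      (q' := M.rot (M.rot h)) (B' := B) hA' (by rw [← List.cons_append, hC']; simp)
      (by rw [M.rev_rev, M.vt_rot, hx]) (by rw [M.vt_rot, M.vt_rot, hx])
    refine ⟨T', crossings_ssubset (h := M.rot (M.rot h)) (by rw [M.vt_rot, M.vt_rot, hx])
      ((hc.rot hx).rot (by rw [M.vt_rot, hx])) ?_ hT⟩
    rw [n1]
    have := hp.symm
    rwa [M.rev_rev] at this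
  · obtain ⟨T', hp, hT⟩ := exists_shortcut (T := T) (x := x) (C := C) (p' := M.rev (M.rot h))
      (q' := M.rot (M.rot (M.rot h))) (B' := E) hA (by rw [← hC]; simp)
      (by rw [M.rev_rev, hx]) (by rw [M.vt_rot, M.vt_rot, M.vt_rot, hx])
    exact ⟨T', crossings_ssubset hx hc hp hT⟩
  · exact (n2 (M.rev_injective h1).symm).elim

/-- All crossings are between trails of edges without common ends. -/
def Independent (T : M.TrailSystem H) : Prop :=
  ∀ a b h x, M.vt h = Sum.inr x → [M.rev h, M.rot (M.rot h)] <:+: T.trail a →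
    [M.rev (M.rot h), M.rot (M.rot (M.rot h))] <:+: T.trail b →
    b.fst ≠ a.fst ∧ b.fst ≠ a.snd ∧ b.snd ≠ a.fst ∧ b.snd ≠ a.snd

lemma exists_ssubset_of_not_independent (hT : ¬ T.Independent) :
    ∃ T' : M.TrailSystem H, T'.crossings ⊂ T.crossings := by
  have key : ∀ {a b h x}, M.vt h = Sum.inr x → [M.rev h, M.rot (M.rot h)] <:+: T.trail a →
    [M.rev (M.rot h), M.rot (M.rot (M.rot h))] <:+: T.trail b → a.fst = b.fst →
    ∃ T' : M.TrailSystem H, T'.crossings ⊂ T.crossings := by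
    intro a b h x hx ha hb hab
    by_cases e : a = b
    · subst e; exact exists_uncross hx ha hb
    · exact exists_swap hx ha hb e hab
  have rot : ∀ {a h x}, M.vt h = Sum.inr x → [M.rev h, M.rot (M.rot h)] <:+: T.trail a →
      [M.rev (M.rot (M.rot h)), M.rot (M.rot (M.rot (M.rot h)))] <:+: T.trail a.symm := by
    intro a h x hx ha
    rw [(M.rot_four hx).1]
    have := infix_symm ha
    rwa [M.rev_rev] at this
  unfold Independent at hT
  push Not at hT
  obtain ⟨a, b, h, x, hx, ha, hb, hab⟩ := hT
  have hx1 : M.vt (M.rot h) = Sum.inr x := by rw [M.vt_rot, hx]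
  have hx2 : M.vt (M.rot (M.rot h)) = Sum.inr x := by rw [M.vt_rot, hx1]
  have hx3 : M.vt (M.rot (M.rot (M.rot h))) = Sum.inr x := by rw [M.vt_rot, hx2]
  have ha' := rot hx ha
  have hb' := rot hx1 hb
  by_cases e1 : b.fst = a.fst
  · exact key hx ha hb e1.symm
  by_cases e2 : b.fst = a.snd
  · exact key hx1 hb ha' e2
  by_cases e3 : b.snd = a.fst
  · refine key hx3 hb' ?_ e3
    have := rot hx2 ha'
    simpa using this
  · exact key hx2 ha' hb' (hab e1 e2 e3).symm

/-- Among all trail systems, one with the fewest crossings is independent. -/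
lemma exists_independent [Finite X] (T : M.TrailSystem H) :
    ∃ T' : M.TrailSystem H, T'.Independent := by
  obtain ⟨n, hn⟩ : ∃ n, n = T.crossings.ncard := ⟨_, rfl⟩
  induction n using Nat.strong_induction_on generalizing T with
  | _ n ih =>
    by_cases h : T.Independent
    · exact ⟨T, h⟩
    · obtain ⟨T', hT'⟩ := exists_ssubset_of_not_independent h
      exact ih _ (hn ▸ Set.ncard_lt_ncard hT') T' rfl

end TrailSystem

end Planarization

lemma List.Nodup.append_cons_inj {D : Type*} {A B A' B' : List D} {p : D}
    (h : (A ++ p :: B).Nodup) (e : A ++ p :: B = A' ++ p :: B') : A = A' ∧ B = B' := by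
  classical
  have key : ∀ {A B : List D}, (A ++ p :: B).Nodup → (A ++ p :: B).idxOf p = A.length := by
    intro A B h
    rw [List.idxOf_append_of_notMem, List.idxOf_cons_self, Nat.add_zero]
    intro hp
    simp only [List.nodup_append] at h
    exact h.2.2 p hp p (by simp) rfl
  have hlen : A.length = A'.length := by rw [← key h, e, key (e ▸ h)]
  have := List.append_inj e hlen
  exact ⟨this.1, (List.cons.inj this.2).2⟩

namespace Planarization

open Equiv

variable {V X D : Type*} {M : Planarization V X D}

namespace TrailSystem

variable {H : SimpleGraph V} (T : M.TrailSystem H)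

/-- The trails of `a` and `b` cross at the vertex of `h`. -/
def Cross (a b : H.Dart) (h : D) : Prop :=
  (∃ x, M.vt h = Sum.inr x) ∧ [M.rev h, M.rot (M.rot h)] <:+: T.trail a ∧
    [M.rev (M.rot h), M.rot (M.rot (M.rot h))] <:+: T.trail b

/-- Every trail is crossed at most once. -/
def CrossedOnce : Prop :=
  ∀ a b b' h h', T.Cross a b h → T.Cross a b' h' → M.vt h = M.vt h'

variable {T}

lemma Cross.crossed {a b : H.Dart} {h : D} (hc : T.Cross a b h) : T.Crossed h :=
  ⟨⟨a, hc.2.1⟩, ⟨b, hc.2.2⟩⟩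

variable (T) in
/-- The trails are cut in two halves at the crossings. -/
structure Halving where
  left : H.Dart → List D
  right : H.Dart → List D
  append : ∀ a, T.trail a = left a ++ right a
  left_ne_nil : ∀ a, left a ≠ []
  right_eq_nil : ∀ a, (∀ b h, ¬ T.Cross a b h) → right a = []
  left_eq : ∀ a b h, T.Cross a b h → ∃ l, left a = l ++ [M.rev h]
  right_eq : ∀ a b h, T.Cross a b h → ∃ l, right a = M.rot (M.rot h) :: l

lemma trail_ne_nil (a : H.Dart) : T.trail a ≠ [] := by
  intro h
  have := (T.isTrail a).2.1
  simp [h] at this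

lemma ne_symm_of_mem {a : H.Dart} {d : D} (hd : d ∈ T.trail a) : M.rev d ∉ T.trail a := by
  intro h
  refine a.symm_ne (T.disjoint _ _ d ?_ hd)
  rw [T.trail_symm, mem_revList]
  exact h

lemma rev_mem_trail_symm {a : H.Dart} {d : D} : M.rev d ∈ T.trail a.symm ↔ d ∈ T.trail a := by
  rw [T.trail_symm, mem_revList, M.rev_rev]

lemma eq_head_of_mem {a : H.Dart} {d : D} {v : V} (hd : d ∈ T.trail a)
    (hv : M.vt d = Sum.inl v) : (T.trail a).head? = some d := by
  obtain ⟨A, B, h⟩ := List.append_of_mem hd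
  rcases List.eq_nil_or_concat A with rfl | ⟨A', e, rfl⟩
  · simp [h]
  · obtain ⟨x, -, hx⟩ := T.step_of_consecutive (a := a) (d := e) (d' := d) ⟨A', B, by simp [h]⟩
    rw [hx] at hv
    cases hv

lemma exists_pass {a : H.Dart} {d : D} {x : X} (hd : d ∈ T.trail a)
    (hx : M.vt (M.rev d) = Sum.inr x) : ∃ d', [d, d'] <:+: T.trail a := by
  obtain ⟨A, B, h⟩ := List.append_of_mem hd
  rcases B with _ | ⟨d', B⟩
  · have := (T.isTrail a).2.2
    rw [h] at this
    simp [hx] at this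
  · exact ⟨d', A, B, by simp [h]⟩

lemma Pass.rev_ne {d d' : D} (h : T.Pass d d') : d' ≠ M.rev d := by
  rintro rfl
  obtain ⟨a, h⟩ := h
  exact ne_symm_of_mem (d := d) (h.subset (by simp)) (h.subset (by simp))

variable [Fintype D]

lemma Cross.rot {a b : H.Dart} {h : D} (hc : T.Cross a b h) : T.Cross b a.symm (M.rot h) := by
  obtain ⟨⟨x, hx⟩, ha, hb⟩ := hc
  refine ⟨⟨x, by rw [M.vt_rot, hx]⟩, hb, ?_⟩
  rw [(M.rot_four hx).1]
  have := infix_symm ha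
  rwa [M.rev_rev] at this

lemma Cross.unique (hI : T.Independent) (h1 : T.CrossedOnce) {a b b' : H.Dart} {h h' : D}
    (hc : T.Cross a b h) (hc' : T.Cross a b' h') : h' = h ∧ b' = b := by
  have hvt := h1 _ _ _ _ _ hc hc'
  obtain ⟨x, hx⟩ := hc.1
  have hind := hI a b h x hx hc.2.1 hc.2.2
  have ha' : M.rev h' ∈ T.trail a := hc'.2.1.subset (by simp)
  have hb : M.rev (M.rot h) ∈ T.trail b := hc.2.2.subset (by simp)
  have ha2 : M.rev (M.rot (M.rot h)) ∈ T.trail a.symm := hc.rot.2.2.subset (by simp)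
  have hb2 : M.rev (M.rot (M.rot (M.rot h))) ∈ T.trail b.symm := hc.rot.rot.2.2.subset (by simp)
  rcases M.exists_iterate hx (hvt ▸ hx : M.vt h' = _) with rfl | rfl | rfl | rfl
  · refine ⟨rfl, T.disjoint _ _ _ ?_ hb⟩
    exact hc'.2.2.subset (by simp)
  · exact (hind.1 (by rw [T.disjoint _ _ _ ha' hb])).elim
  · exact (a.symm_ne (T.disjoint _ _ _ ha2 ha')).elim
  · refine (hind.2.2.1 ?_).elim
    rw [T.disjoint _ _ _ ha' hb2]
    rfl

lemma exists_halving (hI : T.Independent) (h1 : T.CrossedOnce) : Nonempty T.Halving := by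
  have : ∀ a, ∃ P Q : List D, T.trail a = P ++ Q ∧ P ≠ [] ∧
      ((∀ b h, ¬ T.Cross a b h) → Q = []) ∧ (∀ b h, T.Cross a b h → ∃ l, P = l ++ [M.rev h]) ∧
      (∀ b h, T.Cross a b h → ∃ l, Q = M.rot (M.rot h) :: l) := by
    intro a
    by_cases hex : ∃ b h, T.Cross a b h
    · obtain ⟨b, h, hc⟩ := hex
      obtain ⟨A, B, hAB⟩ := hc.2.1
      refine ⟨A ++ [M.rev h], M.rot (M.rot h) :: B, by simp [← hAB], by simp,
        fun h' => (h' b h hc).elim, fun b' h' hc' => ?_, fun b' h' hc' => ?_⟩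
      · rw [(hc.unique hI h1 hc').1]; exact ⟨A, rfl⟩
      · rw [(hc.unique hI h1 hc').1]; exact ⟨B, rfl⟩
    · push Not at hex
      exact ⟨T.trail a, [], by simp, trail_ne_nil a, fun _ => rfl,
        fun b h hc => (hex b h hc).elim, fun b h hc => (hex b h hc).elim⟩
  choose P Q h1 h2 h3 h4 h5 using this
  exact ⟨⟨P, Q, h1, h2, h3, h4, h5⟩⟩

namespace Halving

variable (K : T.Halving)

lemma left_symm {a b : H.Dart} {h : D} (hc : T.Cross a b h) :
    K.left a.symm = M.revList (K.right a) := by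
  obtain ⟨x, hx⟩ := hc.1
  obtain ⟨l, hl⟩ := K.left_eq _ _ _ hc.rot.rot
  obtain ⟨m, hm⟩ := K.right_eq _ _ _ hc
  have h1 := K.append a.symm
  have h2 := T.nodup a.symm
  rw [h1] at h2
  rw [T.trail_symm, K.append a, hm, revList, List.map_append, List.reverse_append] at h1
  simp only [List.map_cons, List.reverse_cons] at h1
  rw [hl] at h1 h2
  rw [List.append_assoc, List.append_assoc, List.singleton_append, List.singleton_append] at h1
  rw [List.append_assoc, List.singleton_append] at h2
  rw [hl, hm, revList, (h2.append_cons_inj h1.symm).1]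
  simp

lemma mem_trail_of_mem_left {a : H.Dart} {d : D} (h : d ∈ K.left a) : d ∈ T.trail a := by
  rw [K.append]; exact List.mem_append_left _ h

/-- The dart `d` or its reversal belongs to the first half of the trail of `a`. -/
def Half (a : H.Dart) (d : D) : Prop := d ∈ K.left a ∨ M.rev d ∈ K.left a

lemma half_rev {a : H.Dart} {d : D} : K.Half a (M.rev d) ↔ K.Half a d := by
  unfold Half; rw [M.rev_rev, or_comm]

lemma exists_cross_of_mem_right {a : H.Dart} {d : D} (h : d ∈ K.right a) :
    ∃ b h, T.Cross a b h := by
  by_contra! hn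
  rw [K.right_eq_nil a hn] at h
  simp at h

lemma half_of_mem_right {a : H.Dart} {d : D} (h : d ∈ K.right a) : K.Half a.symm d := by
  obtain ⟨b, g, hc⟩ := K.exists_cross_of_mem_right h
  right
  rwa [K.left_symm hc, mem_revList, M.rev_rev]

lemma Half.exists_mem {a : H.Dart} {d : D} (h : K.Half a d) : ∃ b, d ∈ T.trail b := by
  rcases h with h | h
  · exact ⟨a, K.mem_trail_of_mem_left h⟩
  · refine ⟨a.symm, ?_⟩
    have := rev_mem_trail_symm.2 (K.mem_trail_of_mem_left h)
    rwa [M.rev_rev] at this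

variable {K}

/-- A function on the darts of `H` that is symmetric on uncrossed darts. -/
def SymmUncrossed (T : M.TrailSystem H) (z : H.Dart → ZMod 2) : Prop :=
  ∀ a, (∀ b h, ¬ T.Cross a b h) → z a.symm = z a

variable {z : H.Dart → ZMod 2}

lemma Half.eq (hz : SymmUncrossed T z) {a a' : H.Dart} {d : D} (h : K.Half a d)
    (h' : K.Half a' d) : z a = z a' := by
  have key : ∀ {a a' : H.Dart} {d : D}, d ∈ K.left a → M.rev d ∈ K.left a' → z a = z a' := by
    intro a a' d h h'
    have h1 := K.mem_trail_of_mem_left h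
    have h2 := rev_mem_trail_symm.2 (K.mem_trail_of_mem_left h')
    rw [M.rev_rev] at h2
    have h3 : a' = a.symm := by rw [T.disjoint _ _ _ h1 h2, SimpleGraph.Dart.symm_symm]
    subst h3
    by_cases hc : ∃ b g, T.Cross a b g
    · obtain ⟨b, g, hc⟩ := hc
      rw [K.left_symm hc, mem_revList, M.rev_rev] at h'
      have := T.nodup a
      rw [K.append, List.nodup_append] at this
      exact (this.2.2 d h d h' rfl).elim
    · push Not at hc
      exact (hz a hc).symm
  rcases h with h | h <;> rcases h' with h' | h'
  · rw [T.disjoint _ _ _ (K.mem_trail_of_mem_left h) (K.mem_trail_of_mem_left h')]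
  · exact key h h'
  · exact (key h' h).symm
  · rw [T.disjoint _ _ _ (K.mem_trail_of_mem_left h) (K.mem_trail_of_mem_left h')]

open Classical in
variable (K z) in
/-- The function on the darts of the planarization induced by `z`. -/
noncomputable def lift (d : D) : ZMod 2 := if h : ∃ a, K.Half a d then z h.choose else 0

lemma lift_eq (hz : SymmUncrossed T z) {a : H.Dart} {d : D} (h : K.Half a d) :
    K.lift z d = z a := by
  have hex : ∃ a, K.Half a d := ⟨a, h⟩
  rw [lift, dif_pos hex]
  exact hex.choose_spec.eq hz h

open Classical in
lemma lift_rev (d : D) : K.lift z (M.rev d) = K.lift z d := by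
  have key : ∀ p q : H.Dart → Prop, p = q →
      (if h : ∃ a, p a then z h.choose else 0) = if h : ∃ a, q a then z h.choose else 0 := by
    rintro p _ rfl; rfl
  exact key _ _ (funext fun a => propext K.half_rev)

lemma exists_mem_of_lift_ne_zero {d : D} (h : K.lift z d ≠ 0) : ∃ a, d ∈ T.trail a := by
  by_cases hex : ∃ a, K.Half a d
  · exact hex.choose_spec.exists_mem
  · rw [lift, dif_neg hex] at h
    exact (h rfl).elim

lemma crossed_or_consecutive {a : H.Dart} {d d' : D} (h : [d, d'] <:+: T.trail a) :
    T.Crossed (M.rev d) ∨ [d, d'] <:+: K.left a ∨ [d, d'] <:+: K.right a := by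
  rw [K.append, List.pair_infix_append_iff] at h
  rcases h with h | h | ⟨A, B, h1, h2⟩
  · exact Or.inr (Or.inl h)
  · exact Or.inr (Or.inr h)
  · obtain ⟨b, g, hc⟩ := K.exists_cross_of_mem_right (a := a) (d := d') (by simp [h2])
    obtain ⟨l, hl⟩ := K.left_eq _ _ _ hc
    rw [h1] at hl
    have := List.append_inj' hl rfl
    simp only [List.cons.injEq, and_true] at this
    rw [this.2, M.rev_rev]
    exact Or.inl hc.crossed

lemma not_crossed_of_consecutive {a : H.Dart} {d d' : D}
    (h : [d, d'] <:+: K.left a ∨ [d, d'] <:+: K.right a) : ¬ T.Crossed (M.rev d) := by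
  intro hc
  have hd : [d, d'] <:+: T.trail a := by
    rw [K.append, List.pair_infix_append_iff]; tauto
  obtain ⟨x, hx, -⟩ := T.step_of_consecutive hd
  obtain ⟨b, hb⟩ := hc.2
  have h1 := hc.1
  rw [M.rev_rev] at h1
  obtain rfl := h1.right_unique ⟨a, hd⟩
  have hcr : T.Cross a b (M.rev d) := ⟨⟨x, hx⟩, by rwa [M.rev_rev], hb⟩
  obtain ⟨A, hA⟩ := K.left_eq _ _ _ hcr
  obtain ⟨B, hB⟩ := K.right_eq _ _ _ hcr
  rw [M.rev_rev] at hA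
  have hn := T.nodup a
  rw [K.append, List.nodup_append] at hn
  rw [hA, hB] at hn
  rw [hA, hB] at h
  rcases h with h | h
  · have : d ∈ A := by
      rcases List.pair_infix_append_iff.1 h with h | h | ⟨A', B', rfl, h⟩
      · exact h.subset (by simp)
      · have := h.length_le
        simp at this
      · simp
    have h2 := hn.1
    rw [List.nodup_append] at h2
    exact h2.2.2 d this d (by simp) rfl
  · have hmem : d ∈ M.rot (M.rot (M.rev d)) :: B := h.subset (by simp)
    exact hn.2.2 d (by simp) d hmem rfl

lemma lift_eq_of_consecutive (hz : SymmUncrossed T z) {a : H.Dart} {d d' : D}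
    (h : [d, d'] <:+: T.trail a) (hc : ¬ T.Crossed (M.rev d)) : K.lift z d = K.lift z d' := by
  rcases (K.crossed_or_consecutive h).resolve_left hc with h | h
  · rw [lift_eq hz (Or.inl (h.subset (by simp)) : K.Half a d),
      lift_eq hz (Or.inl (h.subset (by simp)) : K.Half a d')]
  · rw [lift_eq hz (K.half_of_mem_right (h.subset (by simp)) : K.Half _ d),
      lift_eq hz (K.half_of_mem_right (h.subset (by simp)) : K.Half _ d')]

end Halving

end TrailSystem

end Planarization

namespace Planarization

open Equiv

variable {V X D : Type*} {M : Planarization V X D}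

namespace TrailSystem

variable {H : SimpleGraph V} {T : M.TrailSystem H} [Fintype D]

variable (T) in
/-- The dart `g'` is the continuation at its vertex of the trail arriving along `g`. -/
def Mate (g g' : D) : Prop := T.Pass (M.rev g) g'

lemma Mate.symm {g g' : D} (h : T.Mate g g') : T.Mate g' g := by
  have := Pass.symm h
  rwa [M.rev_rev] at this

lemma Mate.ne {g g' : D} (h : T.Mate g g') : g' ≠ g := by
  have := Pass.rev_ne h
  rwa [M.rev_rev] at this

lemma Mate.unique {g g' g'' : D} (h : T.Mate g g') (h' : T.Mate g g'') : g' = g'' :=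
  Pass.right_unique h h'

lemma Mate.vt_eq {g g' : D} (h : T.Mate g g') : M.vt g' = M.vt g := by
  obtain ⟨x, h1, h2⟩ := Pass.step h
  rw [M.rev_rev] at h1
  rw [h1, h2]

lemma exists_mate {a : H.Dart} {g : D} {x : X} (hg : g ∈ T.trail a) (hx : M.vt g = Sum.inr x) :
    ∃ g', T.Mate g g' := by
  obtain ⟨g', h⟩ := exists_pass (x := x) (rev_mem_trail_symm.2 hg) (by rw [M.rev_rev, hx])
  exact ⟨g', _, h⟩

namespace Halving

variable {K : T.Halving} {z : H.Dart → ZMod 2}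

lemma lift_cross (hz : SymmUncrossed T z) {a b : H.Dart} {h : D} (hc : T.Cross a b h) :
    K.lift z h = z a := by
  obtain ⟨l, hl⟩ := K.left_eq _ _ _ hc
  exact lift_eq hz (Or.inr (by simp [hl]))

lemma lift_mate (hz : SymmUncrossed T z) {g g' : D} (h : T.Mate g g') (hc : ¬ T.Crossed g) :
    K.lift z g = K.lift z g' := by
  obtain ⟨a, h⟩ := h
  rw [← lift_rev, lift_eq_of_consecutive hz h (by rwa [M.rev_rev])]

lemma lift_eq_zero {g : D} {x : X} (hx : M.vt g = Sum.inr x) (h : ∀ g', ¬ T.Mate g g') :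
    K.lift z g = 0 := by
  by_contra hne
  obtain ⟨a, ha⟩ := exists_mem_of_lift_ne_zero hne
  obtain ⟨g', hg'⟩ := exists_mate ha hx
  exact h g' hg'

lemma sum_lift_inr (hz : SymmUncrossed T z)
    (hz' : ∀ a b h, T.Cross a b h → z a + z b + z a.symm + z b.symm = 0)
    (x : X) (s : Finset D) (hs : ∀ d, d ∈ s ↔ M.vt d = Sum.inr x) : ∑ d ∈ s, K.lift z d = 0 := by
  classical
  by_cases hc : ∃ h ∈ s, T.Crossed h
  · obtain ⟨h, hh, ⟨a, ha⟩, ⟨b, hb⟩⟩ := hc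
    rw [hs] at hh
    have hc : T.Cross a b h := ⟨⟨x, hh⟩, ha, hb⟩
    obtain ⟨h4, n1, n2, n3⟩ := M.rot_four hh
    have hse : s = {h, M.rot h, M.rot (M.rot h), M.rot (M.rot (M.rot h))} := by
      ext d
      rw [hs]
      simp only [Finset.mem_insert, Finset.mem_singleton]
      refine ⟨fun hd => M.exists_iterate hh hd, ?_⟩
      rintro (rfl | rfl | rfl | rfl) <;> simp only [M.vt_rot, hh]
    rw [hse, Finset.sum_insert, Finset.sum_insert, Finset.sum_pair, lift_cross hz hc,
      lift_cross hz hc.rot, lift_cross hz hc.rot.rot, lift_cross hz hc.rot.rot.rot,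
      ← hz' a b h hc]
    · ring
    · simpa using n1
    · simpa using ⟨n1, n2⟩
    · simpa using ⟨n1, n2, n3⟩
  · push Not at hc
    let g : D → D := fun d => if h : ∃ d', T.Mate d d' then h.choose else d
    have hg : ∀ {d d'}, T.Mate d d' → g d = d' := by
      intro d d' h
      have hex : ∃ d', T.Mate d d' := ⟨d', h⟩
      simp only [g, dif_pos hex]
      exact hex.choose_spec.unique h
    have hg' : ∀ {d}, (∀ d', ¬ T.Mate d d') → g d = d := by
      intro d h
      simp only [g]
      rw [dif_neg (by simpa using h)]
    refine Finset.sum_involution (fun d _ => g d) (fun d hd => ?_) (fun d hd hne => ?_)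
      (fun d hd => ?_) (fun d hd => ?_) <;> by_cases hm : ∃ d', T.Mate d d'
    · obtain ⟨d', h⟩ := hm
      rw [hg h, lift_mate hz h (hc d hd), CharTwo.add_self_eq_zero]
    · push Not at hm
      rw [hg' hm, CharTwo.add_self_eq_zero]
    · obtain ⟨d', h⟩ := hm
      rw [hg h]; exact h.ne
    · push Not at hm
      exact (hne (lift_eq_zero ((hs d).1 hd) hm)).elim
    · obtain ⟨d', h⟩ := hm
      rw [hg h, hs, h.vt_eq, (hs d).1 hd]
    · push Not at hm
      rwa [hg' hm]
    · obtain ⟨d', h⟩ := hm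
      rw [hg h, hg h.symm]
    · push Not at hm
      rw [hg' hm, hg' hm]

/-- The first dart of the trail of `a`. -/
noncomputable def first (T : M.TrailSystem H) (a : H.Dart) : D := (T.trail a).head (trail_ne_nil a)

lemma head?_trail (a : H.Dart) : (T.trail a).head? = some (first T a) :=
  List.head?_eq_some_head _

lemma vt_first (a : H.Dart) : M.vt (first T a) = Sum.inl a.fst := by
  have := (T.isTrail a).2.1
  rw [head?_trail] at this
  simpa using this

lemma first_mem (a : H.Dart) : first T a ∈ T.trail a := List.head_mem _

lemma first_injective : Function.Injective (first T) := fun a b h =>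
  T.disjoint a b _ (first_mem a) (h ▸ first_mem b)

lemma eq_first {a : H.Dart} {d : D} {v : V} (hd : d ∈ T.trail a) (hv : M.vt d = Sum.inl v) :
    d = first T a := by
  have := eq_head_of_mem hd hv
  rw [head?_trail] at this
  simpa using this.symm

lemma first_mem_left (a : H.Dart) : first T a ∈ K.left a := by
  have h := head?_trail (T := T) a
  rw [K.append, List.head?_append_of_ne_nil _ (K.left_ne_nil a)] at h
  exact List.mem_of_mem_head? h

lemma lift_first (hz : SymmUncrossed T z) (a : H.Dart) : K.lift z (first T a) = z a :=
  lift_eq hz (Or.inl (first_mem_left a))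

lemma lift_eq_zero_of_inl {d : D} {v : V} (hv : M.vt d = Sum.inl v) (h : ∀ a, first T a ≠ d) :
    K.lift z d = 0 := by
  by_contra hne
  obtain ⟨a, ha⟩ := exists_mem_of_lift_ne_zero hne
  exact h a (eq_first ha hv).symm

lemma sum_lift_inl [Fintype H.Dart] (hz : SymmUncrossed T z)
    (hz' : ∀ v, ∀ s : Finset H.Dart, (∀ a, a ∈ s ↔ a.fst = v) → ∑ a ∈ s, z a = 0)
    (v : V) (s : Finset D) (hs : ∀ d, d ∈ s ↔ M.vt d = Sum.inl v) : ∑ d ∈ s, K.lift z d = 0 := by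
  classical
  rw [← hz' v (Finset.univ.filter fun a => a.fst = v) (by simp),
    ← Finset.sum_congr rfl (fun a _ => lift_first (K := K) hz a),
    ← Finset.sum_image (g := first T) (f := K.lift z) first_injective.injOn]
  symm
  refine Finset.sum_subset ?_ ?_
  · intro d
    simp only [Finset.mem_image, Finset.mem_filter, Finset.mem_univ, true_and, hs]
    rintro ⟨a, rfl, rfl⟩
    exact vt_first a
  · intro d hd hd'
    rw [hs] at hd
    refine lift_eq_zero_of_inl hd fun a ha => hd' ?_
    simp only [Finset.mem_image, Finset.mem_filter, Finset.mem_univ, true_and]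
    refine ⟨a, ?_, ha⟩
    rw [← ha, vt_first] at hd
    exact Sum.inl_injective hd

variable {c : D → ZMod 2}

lemma color_eq_of_consecutive (hz : SymmUncrossed T z)
    (hc : ∀ d, c (M.rot.symm d) = c (M.rev d) ∧ c d + c (M.rev d) = K.lift z d)
    {a : H.Dart} {d d' : D} (h : [d, d'] <:+: T.trail a) (hd : ¬ T.Crossed (M.rev d)) :
    c d = c d' := by
  obtain ⟨g, rfl⟩ : ∃ g, d = M.rev g := ⟨M.rev d, (M.rev_rev d).symm⟩
  rw [M.rev_rev] at hd
  have hm : T.Mate g d' := ⟨a, h⟩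
  obtain ⟨x, hx, hx'⟩ := Pass.step hm
  rw [M.rev_rev] at hx
  have h1 : ∀ e, c (M.rot e) = c e + K.lift z (M.rot e) := by
    intro e
    have h2 := (hc (M.rot e)).1
    rw [Equiv.symm_apply_apply] at h2
    rw [← (hc (M.rot e)).2, h2]
    rw [add_left_comm, CharTwo.add_self_eq_zero, add_zero]
  have h0 : c g = c (M.rev g) + K.lift z g := by
    rw [← (hc g).2, add_left_comm, CharTwo.add_self_eq_zero, add_zero]
  have hl := lift_mate (K := K) hz hm hd
  rcases M.exists_iterate hx hx' with rfl | rfl | rfl | rfl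
  · exact (hm.ne rfl).elim
  · rw [h1, h0, ← hl, add_assoc, CharTwo.add_self_eq_zero, add_zero]
  · have hz0 : K.lift z (M.rot g) = 0 := by
      refine lift_eq_zero (x := x) (by rw [M.vt_rot, hx]) fun e he => hd ⟨hm, ?_⟩
      have hvt := he.vt_eq
      rw [M.vt_rot, hx] at hvt
      rcases M.exists_iterate hx hvt with rfl | rfl | rfl | rfl
      · exact ((M.rot_four hx).2.1 (M.rot.injective (he.symm.unique hm))).elim
      · exact (he.ne rfl).elim
      · exact ((M.rot_four hx).2.1 (he.symm.unique hm.symm).symm).elim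
      · exact he
    rw [h1, h1, h0, hz0, ← hl, add_zero, add_assoc, CharTwo.add_self_eq_zero, add_zero]
  · rw [← (hc g).1]
    congr 1
    rw [Equiv.symm_apply_eq, (M.rot_four hx).1]

lemma eq_of_forall_consecutive {l : List D} (h : ∀ d d', [d, d'] <:+: l → c d = c d') {d d' : D}
    (hd : d ∈ l) (hd' : d' ∈ l) : c d = c d' := by
  have key : ∀ (l : List D) (e : D), (∀ d d', [d, d'] <:+: e :: l → c d = c d') →
      ∀ d ∈ e :: l, c d = c e := by
    intro l
    induction l with
    | nil => simp
    | cons f l ih =>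
      intro e h d hd
      rcases List.mem_cons.1 hd with rfl | hd
      · rfl
      · rw [ih f (fun d d' hi => h d d' (List.infix_cons hi)) d hd]
        exact (h e f ⟨[], l, by simp⟩).symm
  rcases l with _ | ⟨e, l⟩
  · simp at hd
  · rw [key l e h d hd, key l e h d' hd']

lemma color_left (hz : SymmUncrossed T z)
    (hc : ∀ d, c (M.rot.symm d) = c (M.rev d) ∧ c d + c (M.rev d) = K.lift z d)
    {a : H.Dart} {d d' : D} (hd : d ∈ K.left a) (hd' : d' ∈ K.left a) : c d = c d' := by
  refine eq_of_forall_consecutive (fun e e' h => color_eq_of_consecutive (a := a) hz hc ?_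
    (not_crossed_of_consecutive (Or.inl h))) hd hd'
  rw [K.append, List.pair_infix_append_iff]
  exact Or.inl h

lemma color_right (hz : SymmUncrossed T z)
    (hc : ∀ d, c (M.rot.symm d) = c (M.rev d) ∧ c d + c (M.rev d) = K.lift z d)
    {a : H.Dart} {d d' : D} (hd : d ∈ K.right a) (hd' : d' ∈ K.right a) : c d = c d' := by
  refine eq_of_forall_consecutive (fun e e' h => color_eq_of_consecutive (a := a) hz hc ?_
    (not_crossed_of_consecutive (Or.inr h))) hd hd'
  rw [K.append, List.pair_infix_append_iff]
  exact Or.inr (Or.inl h)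

lemma rev_first_symm_eq_getLast (a : H.Dart) :
    (T.trail a).getLast? = some (M.rev (first T a.symm)) := by
  have h := head?_trail (T := T) a.symm
  rw [T.trail_symm, revList, List.head?_reverse, List.getLast?_map, Option.map_eq_some_iff] at h
  obtain ⟨d, hd, h⟩ := h
  rw [hd, ← h, M.rev_rev]

end Halving

open Halving in
/-- A trail system in which every trail is crossed at most once gives a rotation system for a
drawing in which every edge is crossed at most once. -/
theorem exists_onePlaneRotation [Fintype H.Dart] (hI : T.Independent) (h1 : T.CrossedOnce) :
    ∃ P : OnePlaneRotation H, ∀ a, P.turn a ≠ a → ∃ b h, T.Cross a b h := by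
  classical
  obtain ⟨K⟩ := exists_halving hI h1
  let t : H.Dart → H.Dart := fun a => if h : ∃ b g, T.Cross a b g then h.choose else a
  have ht : ∀ {a b h}, T.Cross a b h → t a = b := by
    intro a b h hc
    have hex : ∃ b g, T.Cross a b g := ⟨b, h, hc⟩
    simp only [t, dif_pos hex]
    exact (hc.unique hI h1 hex.choose_spec.choose_spec).2
  have ht' : ∀ {a}, (∀ b h, ¬ T.Cross a b h) → t a = a := by
    intro a h
    simp only [t]
    rw [dif_neg (by simpa using h)]
  have hne : ∀ {a}, t a ≠ a → ∃ b h, T.Cross a b h := by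
    intro a ha
    by_contra! h
    exact ha (ht' h)
  have hind : ∀ {a b h}, T.Cross a b h →
      b.fst ≠ a.fst ∧ b.fst ≠ a.snd ∧ b.snd ≠ a.fst ∧ b.snd ≠ a.snd := by
    rintro a b h ⟨⟨x, hx⟩, ha, hb⟩
    exact hI a b h x hx ha hb
  have hcne : ∀ {a b h}, T.Cross a b h → t a ≠ a := by
    intro a b h hc e
    rw [ht hc] at e
    exact (hind hc).1 (by rw [e])
  have hinj : Function.Injective t := by
    intro a a' haa
    by_cases ha : ∃ b h, T.Cross a b h <;> by_cases ha' : ∃ b h, T.Cross a' b h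
    · obtain ⟨b, h, hc⟩ := ha
      obtain ⟨b', h', hc'⟩ := ha'
      rw [ht hc, ht hc'] at haa
      subst haa
      apply SimpleGraph.Dart.symm_involutive.injective
      rw [← ht hc.rot, ← ht hc'.rot]
    · obtain ⟨b, h, hc⟩ := ha
      push Not at ha'
      rw [ht hc, ht' ha'] at haa
      subst haa
      exact (ha' _ _ hc.rot).elim
    · obtain ⟨b, h, hc⟩ := ha'
      push Not at ha
      rw [ht hc, ht' ha] at haa
      subst haa
      exact (ha _ _ hc.rot).elim
    · push Not at ha ha'
      rwa [ht' ha, ht' ha'] at haa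
  let turn : Perm H.Dart := Equiv.ofBijective t (Finite.injective_iff_bijective.1 hinj)
  have hturn : ∀ a, turn a = t a := fun _ => rfl
  obtain ⟨ρ, hρ, hcol⟩ := exists_firstReturn M.rot (first T) first_injective
    (fun a => ⟨orderOf M.rot, orderOf_pos _, by rw [pow_orderOf_eq_one]; rfl⟩)
  have hcyc : ∀ a b : H.Dart, ρ.SameCycle a b ↔ a.fst = b.fst := by
    intro a b
    rw [hρ, M.sameCycle, vt_first, vt_first, Sum.inl_injective.eq_iff]
  refine ⟨⟨ρ, turn, fun a => ((hcyc _ _).1 ⟨1, rfl⟩).symm, fun a b h => (hcyc a b).2 h,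
    fun a ha => ?_, fun a ha => ?_, fun z hz1 hz2 hz3 => ?_⟩, fun a ha => hne ha⟩
  · obtain ⟨b, h, hc⟩ := hne ha
    rw [hturn, hturn, ht hc, ht hc.rot]
  · obtain ⟨b, h, hc⟩ := hne ha
    rw [hturn, ht hc]
    exact hind hc
  · have hz : SymmUncrossed T z := fun a ha => hz2 a (ht' ha)
    have hz' : ∀ a b h, T.Cross a b h → z a + z b + z a.symm + z b.symm = 0 := by
      intro a b h hc
      have := hz3 a (hcne hc)
      rwa [hturn, ht hc] at this
    obtain ⟨c, hc⟩ := M.planar (K.lift z) lift_rev (by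
      rintro (v | x)
      · exact sum_lift_inl hz hz1 v
      · exact sum_lift_inr hz hz' x)
    have hc' : ∀ a, c (first T (ρ.symm a)) = c (M.rev (first T a)) := by
      intro a
      rw [hcol c (fun b d hd hd' => ?_) a, (hc _).1]
      rw [M.sameCycle, vt_first] at hd
      rw [(hc d).1, ← sub_eq_zero, CharTwo.sub_eq_add, add_comm, (hc d).2]
      exact lift_eq_zero_of_inl hd.symm hd'
    refine ⟨fun a => c (first T a), fun a => ?_, fun a => ?_⟩
    · simp only [hc', hturn]
      by_cases hx : ∃ b h, T.Cross a b h
      · obtain ⟨b, h, hx⟩ := hx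
        rw [ht hx]
        obtain ⟨l, hl⟩ := K.left_eq _ _ _ hx
        obtain ⟨m, hm⟩ := K.right_eq _ _ _ hx.rot
        have hlast := rev_first_symm_eq_getLast (T := T) b
        rw [K.append, hm, List.getLast?_append_cons] at hlast
        have e1 : c (M.rev (first T b.symm)) = c (M.rot (M.rot (M.rot h))) :=
          color_right (K := K) hz hc (a := b) (by rw [hm]; exact List.mem_of_getLast? hlast)
            (by simp [hm])
        have e2 : c (first T a) = c (M.rev h) :=
          color_left (K := K) hz hc (first_mem_left a) (by simp [hl])
        obtain ⟨x, hxx⟩ := hx.1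
        rw [e1, e2, ← (hc h).1]
        congr 1
        rw [Equiv.eq_symm_apply, (M.rot_four hxx).1]
      · push Not at hx
        rw [ht' hx]
        have hlast := rev_first_symm_eq_getLast (T := T) a
        rw [K.append, K.right_eq_nil a hx, List.append_nil] at hlast
        exact color_left (K := K) hz hc (List.mem_of_getLast? hlast) (first_mem_left a)
    · change c _ + c _ = z a
      rw [hc', (hc _).2]
      exact lift_first hz a

end TrailSystem

end Planarization

section NoShortCycles

variable {V : Type*}

/-- The graph contains no cycle of length three or four. -/
def SimpleGraph.NoShortCycles (H : SimpleGraph V) : Prop :=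
  (∀ a b c, H.Adj a b → H.Adj b c → H.Adj c a → False) ∧
    ∀ a b c d, a ≠ c → b ≠ d → H.Adj a b → H.Adj b c → H.Adj c d → H.Adj d a → False

lemma SimpleGraph.NoShortCycles.mono {H H' : SimpleGraph V} (h : H.NoShortCycles) (hle : H' ≤ H) :
    H'.NoShortCycles :=
  ⟨fun _ _ _ h1 h2 h3 => h.1 _ _ _ (hle h1) (hle h2) (hle h3),
    fun _ _ _ _ n1 n2 h1 h2 h3 h4 => h.2 _ _ _ _ n1 n2 (hle h1) (hle h2) (hle h3) (hle h4)⟩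

instance SimpleGraph.finite_dart [Finite V] (H : SimpleGraph V) : Finite H.Dart :=
  Finite.of_injective _ SimpleGraph.Dart.toProd_injective

lemma SimpleGraph.natCard_dart [Finite V] (H : SimpleGraph V) :
    Nat.card H.Dart = 2 * H.edgeSet.ncard := by
  classical
  let _ := Fintype.ofFinite V
  rw [Set.ncard_eq_toFinset_card', ← SimpleGraph.edgeFinset, ← H.dart_card_eq_twice_card_edges,
    Nat.card_eq_fintype_card]

lemma SimpleGraph.card_dart [Finite V] (H : SimpleGraph V) [Fintype H.Dart] :
    Fintype.card H.Dart = 2 * H.edgeSet.ncard := by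
  rw [← H.natCard_dart, Nat.card_eq_fintype_card]

lemma SimpleGraph.ncard_edgeSet_deleteEdges [Finite V] {H : SimpleGraph V} (a : H.Dart) :
    (H.deleteEdges {a.edge}).edgeSet.ncard + 1 = H.edgeSet.ncard := by
  rw [SimpleGraph.edgeSet_deleteEdges, Set.ncard_sdiff_singleton_add_one a.edge_mem]

end NoShortCycles

namespace Planarization

open Equiv

variable {V X D : Type*} {M : Planarization V X D}

namespace TrailSystem

variable {H H' : SimpleGraph V} {T : M.TrailSystem H}

/-- The trail system restricted to a subgraph. -/
def restrict (T : M.TrailSystem H) (hle : H' ≤ H) : M.TrailSystem H' where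
  trail a := T.trail ⟨a.toProd, hle a.adj⟩
  isTrail a := T.isTrail ⟨a.toProd, hle a.adj⟩
  trail_symm a := T.trail_symm ⟨a.toProd, hle a.adj⟩
  nodup a := T.nodup _
  disjoint a b d ha hb := by
    have := congrArg SimpleGraph.Dart.toProd (T.disjoint _ _ d ha hb)
    exact SimpleGraph.Dart.toProd_injective this

lemma restrict_pass {hle : H' ≤ H} {d d' : D} (h : (T.restrict hle).Pass d d') : T.Pass d d' :=
  let ⟨_, h⟩ := h; ⟨_, h⟩

lemma restrict_cross {hle : H' ≤ H} {a b : H'.Dart} {h : D} (hc : (T.restrict hle).Cross a b h) :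
    T.Cross ⟨a.toProd, hle a.adj⟩ ⟨b.toProd, hle b.adj⟩ h := hc

lemma Crossed.exists_cross {h : D} {x : X} (hx : M.vt h = Sum.inr x) (hc : T.Crossed h) :
    ∃ a b, T.Cross a b h := by
  obtain ⟨⟨a, ha⟩, ⟨b, hb⟩⟩ := hc
  exact ⟨a, b, ⟨x, hx⟩, ha, hb⟩

lemma restrict_crossings (hle : H' ≤ H) : (T.restrict hle).crossings ⊆ T.crossings :=
  fun _ ⟨h, hx, hc⟩ => ⟨h, hx, restrict_pass hc.1, restrict_pass hc.2⟩

lemma Independent.restrict (hI : T.Independent) (hle : H' ≤ H) : (T.restrict hle).Independent :=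
  fun _ _ h x hx ha hb => hI _ _ h x hx ha hb

lemma CrossedOnce.restrict (h1 : T.CrossedOnce) (hle : H' ≤ H) : (T.restrict hle).CrossedOnce :=
  fun _ _ _ _ _ hc hc' => h1 _ _ _ _ _ (restrict_cross hc) (restrict_cross hc')

variable [Fintype D]

lemma adj_of_mem_restrict_crossings {hle : H' ≤ H} {a b : H.Dart} {h : D} {x : X}
    (hx : M.vt h = Sum.inr x) (hc : T.Cross a b h) (hx' : x ∈ (T.restrict hle).crossings) :
    H'.Adj a.fst a.snd ∧ H'.Adj b.fst b.snd := by
  obtain ⟨h', hh', hc'⟩ := hx'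
  obtain ⟨⟨a', ha'⟩, ⟨b', hb'⟩⟩ := hc'.of_vt_eq hh' hx
  have e1 := T.disjoint _ _ (M.rev h) (ha'.subset (by simp)) (hc.2.1.subset (by simp))
  have e2 := T.disjoint _ _ (M.rev (M.rot h)) (hb'.subset (by simp)) (hc.2.2.subset (by simp))
  subst e1 e2
  exact ⟨a'.adj, b'.adj⟩

lemma notMem_restrict_crossings {a b : H.Dart} {h : D} {x : X}
    (hx : M.vt h = Sum.inr x) (hc : T.Cross a b h) :
    x ∉ (T.restrict (H.deleteEdges_le {a.edge})).crossings := by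
  intro hx'
  have := (adj_of_mem_restrict_crossings hx hc hx').1
  rw [SimpleGraph.deleteEdges_adj] at this
  exact this.2 rfl

variable [Finite V]

lemma card_le_of_crossedOnce (hg : H.NoShortCycles) (hI : T.Independent) (h1 : T.CrossedOnce)
    (S : Finset V) (hS : ∀ a : H.Dart, a.fst ∈ S) :
    5 * H.edgeSet.ncard ≤ 12 * S.card ∧
      (T.crossings = ∅ → 3 * H.edgeSet.ncard ≤ 5 * S.card) := by
  classical
  obtain ⟨n, hn⟩ : ∃ n, n = S.card := ⟨_, rfl⟩
  induction n generalizing H S with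
  | zero =>
    have : H.edgeSet = ∅ := by
      by_contra hne
      obtain ⟨e, he⟩ := Set.nonempty_iff_ne_empty.2 hne
      induction e with
      | h u v =>
        have := hS ⟨(u, v), he⟩
        rw [Finset.card_eq_zero.1 hn.symm] at this
        simp at this
    simp [this]
  | succ n ih =>
    let _ := Fintype.ofFinite H.Dart
    obtain ⟨P, hP⟩ := exists_onePlaneRotation hI h1
    by_cases hR : ∀ a, P.rot a ≠ a
    · have e1 := P.five_mul_card_dart_le hg.1 hg.2 hR S hS
      rw [H.card_dart] at e1
      refine ⟨by omega, fun h0 => ?_⟩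
      have e2 := P.card_dart_le_of_uncrossed hg.1 hg.2 hR (fun a => ?_) S hS
      · rw [H.card_dart] at e2
        omega
      · by_contra ha
        obtain ⟨b, h, hc⟩ := hP a ha
        obtain ⟨x, hx⟩ := hc.1
        have : x ∈ T.crossings := ⟨h, hx, hc.crossed⟩
        simp [h0] at this
    · push Not at hR
      obtain ⟨a, ha⟩ := hR
      have huniq : ∀ b : H.Dart, b.fst = a.fst → b = a := by
        intro b hb
        obtain ⟨i, hi⟩ := P.rot_sameCycle a b hb.symm
        rw [← hi, Perm.zpow_apply_eq_self_of_apply_eq_self ha]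
      have hle := H.deleteEdges_le {a.edge}
      have hcard := SimpleGraph.ncard_edgeSet_deleteEdges a
      have hne : ∀ b : (H.deleteEdges {a.edge}).Dart, b.fst ≠ a.fst := by
        intro b hb
        have h2 := b.adj
        rw [SimpleGraph.deleteEdges_adj] at h2
        have h3 := huniq ⟨b.toProd, h2.1⟩ hb
        exact h2.2 (congrArg SimpleGraph.Dart.edge h3)
      obtain ⟨h5, h3⟩ := ih (hg.mono hle) (hI.restrict hle) (h1.restrict hle) (S.erase a.fst)
        (fun b => Finset.mem_erase.2 ⟨hne b, hS ⟨b.toProd, hle b.adj⟩⟩)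
        (by rw [Finset.card_erase_of_mem (hS a), ← hn]; rfl)
      rw [Finset.card_erase_of_mem (hS a), ← hn] at h5 h3
      refine ⟨by omega, fun h0 => ?_⟩
      have := h3 (Set.subset_empty_iff.1 (h0 ▸ restrict_crossings hle))
      omega

variable [Finite X]

/-- A lower bound for the number of crossings, by removing one edge per crossing. -/
lemma three_mul_ncard_edgeSet_le (hg : H.NoShortCycles) (hI : T.Independent)
    (S : Finset V) (hS : ∀ a : H.Dart, a.fst ∈ S) :
    3 * H.edgeSet.ncard ≤ 3 * T.crossings.ncard + 5 * S.card := by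
  obtain ⟨n, hn⟩ : ∃ n, n = H.edgeSet.ncard := ⟨_, rfl⟩
  induction n generalizing H with
  | zero => omega
  | succ n ih =>
    by_cases h0 : T.crossings = ∅
    · have := (card_le_of_crossedOnce hg hI (fun a b b' h h' hc _ => ?_) S hS).2 h0
      · omega
      · obtain ⟨x, hx⟩ := hc.1
        have : x ∈ T.crossings := ⟨h, hx, hc.crossed⟩
        simp [h0] at this
    · obtain ⟨x, h, hx, hc⟩ := Set.nonempty_iff_ne_empty.2 h0
      obtain ⟨a, b, hab⟩ := hc.exists_cross hx
      have hle := H.deleteEdges_le {a.edge}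
      have hcard := SimpleGraph.ncard_edgeSet_deleteEdges a
      have := ih (hg.mono hle) (hI.restrict hle) (fun b => hS ⟨b.toProd, hle b.adj⟩) (by omega)
      have hlt := Set.ncard_lt_ncard ((Set.ssubset_iff_of_subset (restrict_crossings hle)).2
        ⟨x, ⟨h, hx, hc⟩, notMem_restrict_crossings hx hab⟩) (Set.toFinite _)
      omega

/-- A lower bound for the number of crossings, by removing edges crossed at least twice. -/
lemma thirty_mul_ncard_edgeSet_le (hg : H.NoShortCycles) (hI : T.Independent)
    (S : Finset V) (hS : ∀ a : H.Dart, a.fst ∈ S) :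
    30 * H.edgeSet.ncard ≤ 15 * T.crossings.ncard + 61 * S.card := by
  obtain ⟨n, hn⟩ : ∃ n, n = H.edgeSet.ncard := ⟨_, rfl⟩
  induction n generalizing H with
  | zero => omega
  | succ n ih =>
    by_cases h1 : T.CrossedOnce
    · have e1 := (card_le_of_crossedOnce hg hI h1 S hS).1
      have e2 := three_mul_ncard_edgeSet_le hg hI S hS
      omega
    · unfold CrossedOnce at h1
      push Not at h1
      obtain ⟨a, b, b', h, h', hc, hc', hne⟩ := h1
      obtain ⟨x, hx⟩ := hc.1
      obtain ⟨x', hx'⟩ := hc'.1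
      have hxx : x ≠ x' := by
        rintro rfl
        exact hne (hx.trans hx'.symm)
      have hle := H.deleteEdges_le {a.edge}
      have hcard := SimpleGraph.ncard_edgeSet_deleteEdges a
      have := ih (hg.mono hle) (hI.restrict hle) (fun b => hS ⟨b.toProd, hle b.adj⟩) (by omega)
      have hsub : (T.restrict hle).crossings ⊆ T.crossings \ {x, x'} := by
        intro y hy
        refine ⟨restrict_crossings hle hy, ?_⟩
        rintro (rfl | rfl)
        · exact notMem_restrict_crossings hx hc hy
        · exact notMem_restrict_crossings hx' hc' hy
      have h2 := Set.ncard_le_ncard hsub (Set.toFinite _)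
      have h3 := Set.ncard_sdiff_add_ncard_of_subset (s := {x, x'}) (t := T.crossings) (by
        rintro y (rfl | rfl)
        · exact ⟨h, hx, hc.crossed⟩
        · exact ⟨h', hx', hc'.crossed⟩)
      rw [Set.ncard_pair hxx] at h3
      omega

end TrailSystem

end Planarization

section Sampling

open Finset

variable {V : Type*} [Fintype V]

open Classical in
/-- The probability that a random set, containing every vertex independently with probability `p`,
equals `S`. -/
noncomputable def sampleWeight (p : ℝ) (S : Finset V) : ℝ := p ^ #S * (1 - p) ^ #(univ \ S)

lemma sampleWeight_nonneg {p : ℝ} (h0 : 0 ≤ p) (h1 : p ≤ 1) (S : Finset V) :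
    0 ≤ sampleWeight p S :=
  mul_nonneg (pow_nonneg h0 _) (pow_nonneg (sub_nonneg.2 h1) _)

open Classical in
lemma sum_sampleWeight_superset (p : ℝ) (A : Finset V) :
    ∑ S, (if A ⊆ S then sampleWeight p S else 0) = p ^ #A := by
  have h := prod_add (fun _ : V => p) (fun i => if i ∈ A then 0 else 1 - p) univ
  have h1 : ∏ i : V, (p + if i ∈ A then 0 else 1 - p) = p ^ #A := by
    rw [prod_congr rfl (g := fun i => if i ∈ A then p else 1) (fun i _ => by split_ifs <;> ring),
      prod_ite, prod_const, prod_const_one, mul_one]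
    congr 2
    ext; simp
  rw [← h1, h, powerset_univ]
  refine sum_congr rfl fun S _ => ?_
  rw [prod_const]
  split_ifs with hA
  · rw [sampleWeight, ← prod_const (s := univ \ S)]
    congr 1
    refine prod_congr rfl fun i hi => ?_
    rw [if_neg fun hiA => ?_]
    exact (mem_sdiff.1 hi).2 (hA hiA)
  · obtain ⟨i, hiA, hiS⟩ := not_subset.1 hA
    rw [prod_eq_zero (i := i) (by simp [hiS]) (by simp [hiA]), mul_zero]

open Classical in
lemma sum_sampleWeight_mul_card (p : ℝ) {ι : Type*} (s : Finset ι) (A : ι → Finset V) (r : ℕ)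
    (hA : ∀ i ∈ s, #(A i) = r) :
    ∑ S, sampleWeight p S * #{i ∈ s | A i ⊆ S} = #s * p ^ r := by
  have : ∀ S, sampleWeight p S * (#{i ∈ s | A i ⊆ S} : ℝ) =
      ∑ i ∈ s, if A i ⊆ S then sampleWeight p S else 0 := by
    intro S
    rw [← sum_filter, sum_const, nsmul_eq_mul, mul_comm]
  rw [sum_congr rfl fun S _ => this S, sum_comm,
    sum_congr rfl fun i hi => (sum_sampleWeight_superset p (A i)).trans (by rw [hA i hi]),
    sum_const, nsmul_eq_mul]

end Sampling

/-- The spanning subgraph of all edges within `S`. -/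
def SimpleGraph.within {V : Type*} (G : SimpleGraph V) (S : Finset V) : SimpleGraph V where
  Adj u v := G.Adj u v ∧ u ∈ S ∧ v ∈ S
  symm := ⟨fun _ _ h => ⟨h.1.symm, h.2.2, h.2.1⟩⟩
  loopless := ⟨fun _ h => h.1.ne rfl⟩

lemma SimpleGraph.within_le {V : Type*} (G : SimpleGraph V) (S : Finset V) : G.within S ≤ G :=
  fun _ _ h => h.1

namespace Planarization

open Equiv Finset

variable {V X D : Type*} {M : Planarization V X D}

namespace TrailSystem

variable {G : SimpleGraph V} {T : M.TrailSystem G} [Fintype D] [Fintype V] [Finite X]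

lemma sample_le (hg : G.NoShortCycles) (hI : T.Independent) {p : ℝ} (h0 : 0 ≤ p) (h1 : p ≤ 1) :
    30 * (G.edgeSet.ncard * p ^ 2) ≤
      15 * (T.crossings.ncard * p ^ 4) + 61 * (Fintype.card V * p) := by
  classical
  let E : Finset (Sym2 V) := (Set.toFinite G.edgeSet).toFinset
  let C : Finset X := (Set.toFinite T.crossings).toFinset
  have hC : ∀ x ∈ C, ∃ A : Finset V, #A = 4 ∧
      ∀ S, x ∈ (T.restrict (G.within_le S)).crossings → A ⊆ S := by
    intro x hx
    rw [Set.Finite.mem_toFinset] at hx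
    obtain ⟨h, hx, hc⟩ := hx
    obtain ⟨a, b, hab⟩ := hc.exists_cross hx
    obtain ⟨n1, n2, n3, n4⟩ := hI a b h x hx hab.2.1 hab.2.2
    refine ⟨{a.fst, a.snd, b.fst, b.snd}, ?_, fun S hS => ?_⟩
    · rw [card_insert_of_notMem, card_insert_of_notMem, card_pair b.adj.ne]
      · simpa using ⟨n2.symm, n4.symm⟩
      · simpa using ⟨n1.symm, n3.symm⟩
    · obtain ⟨⟨-, h1, h2⟩, ⟨-, h3, h4⟩⟩ := adj_of_mem_restrict_crossings hx hab hS
      intro v hv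
      simp only [mem_insert, mem_singleton] at hv
      rcases hv with rfl | rfl | rfl | rfl <;> assumption
  choose! A hA hA' using hC
  have key : ∀ S : Finset V, 30 * (#{e ∈ E | e.toFinset ⊆ S} : ℝ) ≤
      15 * #{x ∈ C | A x ⊆ S} + 61 * #{v : V | {v} ⊆ S} := by
    intro S
    have h := thirty_mul_ncard_edgeSet_le (T := T.restrict (G.within_le S))
      (hg.mono (G.within_le S)) (hI.restrict _) S (fun a => a.adj.2.1)
    have e1 : (G.within S).edgeSet.ncard = #{e ∈ E | e.toFinset ⊆ S} := by
      rw [← Set.ncard_coe_finset]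
      congr 1
      ext e
      induction e with
      | h u v => simp [E, SimpleGraph.within, Finset.subset_iff]
    have e2 : (T.restrict (G.within_le S)).crossings.ncard ≤ #{x ∈ C | A x ⊆ S} := by
      rw [← Set.ncard_coe_finset]
      refine Set.ncard_le_ncard (fun x hx => ?_) (Finset.finite_toSet _)
      have hxC : x ∈ C := by
        rw [Set.Finite.mem_toFinset]; exact restrict_crossings _ hx
      rw [Finset.mem_coe, Finset.mem_filter]
      exact ⟨hxC, hA' x hxC S hx⟩
    have e3 : #{v : V | {v} ⊆ S} = #S := by
      congr 1; ext; simp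
    rw [e3, ← e1]
    have : 30 * (G.within S).edgeSet.ncard ≤ 15 * #{x ∈ C | A x ⊆ S} + 61 * #S := by omega
    exact_mod_cast this
  have hsum := sum_le_sum fun (S : Finset V) (_ : S ∈ univ) =>
    mul_le_mul_of_nonneg_left (key S) (sampleWeight_nonneg h0 h1 S)
  have s1 := sum_sampleWeight_mul_card p E Sym2.toFinset 2 (fun e he => by
    refine Sym2.card_toFinset_of_not_isDiag e (G.not_isDiag_of_mem_edgeSet ?_)
    simpa [E] using he)
  have s2 := sum_sampleWeight_mul_card p C A 4 hA
  have s3 := sum_sampleWeight_mul_card p (univ : Finset V) (fun v => {v}) 1 (by simp)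
  simp only [mul_add, sum_add_distrib, mul_left_comm _ (30 : ℝ), mul_left_comm _ (15 : ℝ),
    mul_left_comm _ (61 : ℝ), ← mul_sum] at hsum
  rw [s1, s2, s3] at hsum
  have hE : G.edgeSet.ncard = #E := Set.ncard_eq_toFinset_card _ _
  have hC : T.crossings.ncard = #C := Set.ncard_eq_toFinset_card _ _
  rw [hE, hC]
  simpa using hsum

/-- The crossing lemma for graphs without short cycles. -/
theorem crossing_lemma (hg : G.NoShortCycles) (T : M.TrailSystem G)
    (hm : 3.05 * (Fintype.card V : ℝ) ≤ G.edgeSet.ncard) (hn : 0 < Fintype.card V) :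
    800 / 11163 * (G.edgeSet.ncard : ℝ) ^ 3 ≤ Nat.card X * (Fintype.card V : ℝ) ^ 2 := by
  let _ := Fintype.ofFinite G.Dart
  obtain ⟨T', hI⟩ := exists_independent T
  have hX : (T'.crossings.ncard : ℝ) ≤ Nat.card X := by
    exact_mod_cast Set.ncard_le_card _
  have hn' : (0 : ℝ) < Fintype.card V := by exact_mod_cast hn
  set n : ℝ := (Fintype.card V : ℝ)
  set m : ℝ := (G.edgeSet.ncard : ℝ) with hm_def
  have hm' : 0 < m := by linarith
  have hp : 0 < 3.05 * n / m := by positivity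
  have h := sample_le hg hI hp.le ((div_le_one hm').2 hm)
  rw [← hm_def] at h
  have e : 800 / 11163 * m ^ 3 ≤ T'.crossings.ncard * n ^ 2 := by
    have h2 : 30 * (m * (3.05 * n / m) ^ 2) = 30 * 3.05 ^ 2 * n ^ 2 / m := by field_simp
    have h3 : (61 : ℝ) * (n * (3.05 * n / m)) = 61 * 3.05 * n ^ 2 / m := by field_simp
    have h4 : 15 * ((T'.crossings.ncard : ℝ) * (3.05 * n / m) ^ 4) =
        15 * 3.05 ^ 4 * (T'.crossings.ncard * n ^ 2) / m ^ 3 * (n ^ 2 / m) := by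
      field_simp
    rw [h2, h3, h4] at h
    have h5 : (30 * 3.05 ^ 2 - 61 * 3.05) * (n ^ 2 / m) ≤
        15 * 3.05 ^ 4 * (T'.crossings.ncard * n ^ 2) / m ^ 3 * (n ^ 2 / m) := by
      have : (30 * 3.05 ^ 2 - 61 * 3.05) * (n ^ 2 / m) =
        30 * 3.05 ^ 2 * n ^ 2 / m - 61 * 3.05 * n ^ 2 / m := by ring
      linarith
    have h6 := le_of_mul_le_mul_right h5 (by positivity)
    rw [le_div_iff₀ (by positivity)] at h6
    linarith
  exact e.trans (mul_le_mul_of_nonneg_right hX (by positivity))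

end TrailSystem

end Planarization

section PlanarRotation

open Equiv Finset

/-- A rotation system with finite cycles in which every finite cut avoiding the loops is given
by a two-colouring of the faces. -/
structure IsPlanarRotation {E : Type*} (ρ : Perm E) (rev : E → E) : Prop where
  finite_cycle : ∀ e, {e' | ρ.SameCycle e e'}.Finite
  exists_colouring : ∀ Z : E → ZMod 2, (Function.support Z).Finite →
    (∀ e, Z e ≠ 0 → ¬ ρ.SameCycle e (rev e)) → (∀ e, Z (rev e) = Z e) →
    (∀ e, ∀ s : Finset E, (∀ e', e' ∈ s ↔ ρ.SameCycle e e') → ∑ e' ∈ s, Z e' = 0) →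
    ∃ c : E → ZMod 2, (∀ e, c e = c (ρ.symm e) + Z e) ∧
      ∀ e, ¬ ρ.SameCycle e (rev e) → c (rev e) = c (ρ.symm e)

lemma Equiv.Perm.SameCycle.of_step {E : Type*} {ρ : Perm E} {r : E → E → Prop}
    (hr : Equivalence r) (h : ∀ e, r e (ρ e)) {e e' : E} (hs : ρ.SameCycle e e') : r e e' := by
  obtain ⟨n, rfl⟩ := hs
  induction n with
  | zero => simpa using hr.refl e
  | succ n ih =>
    rw [add_comm, zpow_add, zpow_one, Perm.mul_apply]
    exact hr.trans ih (h _)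
  | pred n ih =>
    refine hr.trans ih (hr.symm ?_)
    have := h ((ρ ^ (-(n : ℤ) - 1)) e)
    rwa [← Perm.mul_apply, ← zpow_one_add, add_sub_cancel] at this

lemma Equiv.Perm.sameCycle_equivalence {E : Type*} (ρ : Perm E) : Equivalence ρ.SameCycle :=
  ⟨fun _ => .refl _ _, .symm, .trans⟩

lemma Equiv.Perm.exists_pow_eq_of_finite {E : Type*} {ρ : Perm E} {e : E}
    (h : {e' | ρ.SameCycle e e'}.Finite) : ∃ n > 0, (ρ ^ n) e = e := by
  have : ¬ Function.Injective (fun n : ℕ => (ρ ^ n) e) := by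
    intro hinj
    refine Set.infinite_range_of_injective hinj (h.subset ?_)
    rintro _ ⟨n, rfl⟩
    exact ⟨n, by simp⟩
  simp only [Function.Injective, not_forall] at this
  obtain ⟨a, b, hab, hne⟩ := this
  wlog hlt : a < b generalizing a b
  · exact this b a hab.symm (Ne.symm hne) (by lia)
  refine ⟨b - a, by lia, ?_⟩
  have : (ρ ^ a) ((ρ ^ (b - a)) e) = (ρ ^ a) e := by
    rw [← Perm.mul_apply, ← pow_add, show a + (b - a) = b by lia]
    exact hab.symm
  exact (ρ ^ a).injective this

variable {E : Type*} {ρ : Perm E}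

lemma sameCycle_mul_swap_aux [DecidableEq E] {t t' : E} (hfin : {e | ρ.SameCycle t' e}.Finite)
    (ht : ¬ ρ.SameCycle t t') : (ρ * swap t t').SameCycle t t' := by
  have key : ∀ n : ℕ, (ρ * swap t t').SameCycle t ((ρ ^ (n + 1)) t') := by
    intro n
    have h0 : (ρ * swap t t').SameCycle t (ρ t') := ⟨1, by simp⟩
    induction n with
    | zero => simpa using h0
    | succ n ih =>
      rw [pow_succ', Perm.mul_apply]
      set e := (ρ ^ (n + 1)) t' with he
      have het : e ≠ t := fun h =>
        ht (Perm.SameCycle.symm ⟨n + 1, by exact_mod_cast (he.symm.trans h)⟩)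
      by_cases het' : e = t'
      · rw [het']; exact h0
      · exact ih.trans ⟨1, by simp [swap_apply_of_ne_of_ne het het']⟩
  obtain ⟨n, hn, h⟩ := Perm.exists_pow_eq_of_finite hfin
  obtain ⟨m, rfl⟩ : ∃ m, n = m + 1 := ⟨n - 1, by lia⟩
  simpa [h] using key m

lemma sameCycle_mul_swap [DecidableEq E] (hfin : ∀ e, {e' | ρ.SameCycle e e'}.Finite) {t t' : E}
    (ht : ¬ ρ.SameCycle t t') (e e' : E) :
    (ρ * swap t t').SameCycle e e' ↔ ρ.SameCycle e e' ∨
      (ρ.SameCycle e t ∨ ρ.SameCycle e t') ∧ (ρ.SameCycle e' t ∨ ρ.SameCycle e' t') := by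
  have htt' := sameCycle_mul_swap_aux (hfin t') ht
  have hle : ∀ {e e'}, ρ.SameCycle e e' → (ρ * swap t t').SameCycle e e' := by
    intro e e'
    refine Perm.SameCycle.of_step (Perm.sameCycle_equivalence _) fun e => ?_
    by_cases h : e = t
    · subst h
      exact htt'.trans ⟨1, by simp⟩
    by_cases h' : e = t'
    · subst h'
      exact htt'.symm.trans ⟨1, by simp⟩
    exact ⟨1, by simp [swap_apply_of_ne_of_ne h h']⟩
  constructor
  · refine Perm.SameCycle.of_step (r := fun e e' => ρ.SameCycle e e' ∨
      (ρ.SameCycle e t ∨ ρ.SameCycle e t') ∧ (ρ.SameCycle e' t ∨ ρ.SameCycle e' t')) ?_ ?_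
    · refine ⟨fun _ => Or.inl (.refl _ _), ?_, ?_⟩
      · rintro a b (h | ⟨h, h'⟩)
        exacts [Or.inl h.symm, Or.inr ⟨h', h⟩]
      · rintro a b c (h | ⟨h, h'⟩) (h1 | ⟨h1, h1'⟩)
        · exact Or.inl (h.trans h1)
        · exact Or.inr ⟨h1.imp h.trans h.trans, h1'⟩
        · exact Or.inr ⟨h, h'.imp h1.symm.trans h1.symm.trans⟩
        · exact Or.inr ⟨h, h1'⟩
    · intro e
      by_cases h : e = t
      · subst h
        exact Or.inr ⟨Or.inl (.refl _ _), Or.inr (by simpa using Perm.SameCycle.refl _ _)⟩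
      by_cases h' : e = t'
      · subst h'
        exact Or.inr ⟨Or.inr (.refl _ _), Or.inl (by simpa using Perm.SameCycle.refl _ _)⟩
      exact Or.inl ⟨1, by simp [swap_apply_of_ne_of_ne h h']⟩
  · rintro (h | ⟨h, h'⟩)
    · exact hle h
    · have aux : ∀ {e}, ρ.SameCycle e t ∨ ρ.SameCycle e t' → (ρ * swap t t').SameCycle e t := by
        rintro e (h | h)
        exacts [hle h, (hle h).trans htt'.symm]
      exact (aux h).trans (aux h').symm

variable {rev : E → E}

/-- Contracting an edge which is not a loop preserves planarity. -/
lemma IsPlanarRotation.mul_swap [DecidableEq E] (h : IsPlanarRotation ρ rev)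
    (hrev : ∀ e, rev (rev e) = e) {t : E} (ht : ¬ ρ.SameCycle t (rev t)) :
    IsPlanarRotation (ρ * swap t (rev t)) rev := by
  classical
  have hsc := sameCycle_mul_swap h.finite_cycle ht
  have hne : t ≠ rev t := fun h => ht (h ▸ .refl _ _)
  refine ⟨fun e => ?_, fun Z hfin hB hZ hs => ?_⟩
  · refine (((h.finite_cycle e).union (h.finite_cycle t)).union (h.finite_cycle (rev t))).subset ?_
    intro e' he'
    rcases (hsc _ _).1 he' with h1 | ⟨-, h1 | h1⟩
    exacts [Or.inl (Or.inl h1), Or.inl (Or.inr h1.symm), Or.inr h1.symm]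
  have htt : (ρ * swap t (rev t)).SameCycle t (rev t) :=
    (hsc _ _).2 (Or.inr ⟨Or.inl (.refl _ _), Or.inr (.refl _ _)⟩)
  have hZt : Z t = 0 := by
    by_contra h0
    exact hB t h0 htt
  have hZt' : Z (rev t) = 0 := by rw [hZ, hZt]
  set s0 : Finset E := (h.finite_cycle t).toFinset with hs0
  set s1 : Finset E := (h.finite_cycle (rev t)).toFinset with hs1
  have hm0 : ∀ e, e ∈ s0 ↔ ρ.SameCycle t e := by simp [hs0]
  have hm1 : ∀ e, e ∈ s1 ↔ ρ.SameCycle (rev t) e := by simp [hs1]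
  set q : ZMod 2 := ∑ e ∈ s0, Z e with hq
  have hq1 : ∑ e ∈ s1, Z e = q := by
    have hd : Disjoint s0 s1 := by
      rw [Finset.disjoint_left]
      intro e h0 h1
      exact ht (((hm0 e).1 h0).trans ((hm1 e).1 h1).symm)
    have := hs t (s0 ∪ s1) (fun e' => by
      rw [Finset.mem_union, hm0, hm1, hsc]
      constructor
      · rintro (h1 | h1)
        exacts [Or.inl h1, Or.inr ⟨Or.inl (.refl _ _), Or.inr h1.symm⟩]
      · rintro (h1 | ⟨-, h1 | h1⟩)
        exacts [Or.inl h1, Or.inl h1.symm, Or.inr h1.symm])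
    rw [Finset.sum_union hd] at this
    calc ∑ e ∈ s1, Z e = (q + ∑ e ∈ s1, Z e) + q := by
          rw [add_comm q, add_assoc, CharTwo.add_self_eq_zero, add_zero]
      _ = q := by rw [this, zero_add]
  obtain ⟨c, hc, hc'⟩ := h.exists_colouring
    (fun e => Z e + ((if e = t then q else 0) + if e = rev t then q else 0)) (by
      refine (hfin.union (Set.toFinite {t, rev t})).subset ?_
      intro e he
      by_contra h0
      simp only [Set.mem_union, Function.mem_support, not_or, not_not, Set.mem_insert_iff,
        Set.mem_singleton_iff] at h0
      apply he
      simp [h0.1, h0.2.1, h0.2.2]) (by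
      intro e he hcyc
      by_cases h1 : e = t
      · subst h1; exact ht hcyc
      by_cases h2 : e = rev t
      · subst h2
        rw [hrev] at hcyc
        exact ht hcyc.symm
      · simp only [h1, h2, if_false, add_zero] at he
        exact hB e he ((hsc _ _).2 (Or.inl hcyc))) (by
      intro e
      have h1 : rev e = t ↔ e = rev t := ⟨fun h => by rw [← h, hrev], fun h => by rw [h, hrev]⟩
      have h2 : rev e = rev t ↔ e = t :=
        ⟨fun h => by rw [← hrev e, h, hrev], fun h => by rw [h]⟩
      simp only [hZ, h1, h2, add_comm]) (by
      intro e s hes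
      rw [Finset.sum_add_distrib, Finset.sum_add_distrib]
      simp only [Finset.sum_ite_eq']
      by_cases h1 : t ∈ s
      · have : s = s0 := by
          ext e'
          rw [hes, hm0]
          exact ⟨fun h' => ((hes t).1 h1).symm.trans h', fun h' => ((hes t).1 h1).trans h'⟩
        have h2 : rev t ∉ s := by rwa [this, hm0]
        rw [if_pos h1, if_neg h2, this, add_zero, ← hq, CharTwo.add_self_eq_zero]
      · by_cases h2 : rev t ∈ s
        · have : s = s1 := by
            ext e'
            rw [hes, hm1]
            exact ⟨fun h' => ((hes _).1 h2).symm.trans h', fun h' => ((hes _).1 h2).trans h'⟩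
          rw [if_neg h1, if_pos h2, this, zero_add, hq1, CharTwo.add_self_eq_zero]
        · rw [if_neg h1, if_neg h2, add_zero, add_zero]
          refine hs e s fun e' => ?_
          rw [hes, hsc]
          rw [hes] at h1 h2
          tauto)
  have hsymm : ∀ e, swap t (rev t) ((ρ * swap t (rev t)).symm e) = ρ.symm e := by
    intro e
    obtain ⟨e', rfl⟩ := (ρ * swap t (rev t)).surjective e
    rw [Equiv.symm_apply_apply, Perm.mul_apply, Equiv.symm_apply_apply]
  refine ⟨fun e => c (swap t (rev t) e), fun e => ?_, fun e he => ?_⟩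
  · beta_reduce
    rw [hsymm]
    by_cases h1 : e = t
    · subst h1
      rw [swap_apply_left, hZt, add_zero, hc' _ ht]
    by_cases h2 : e = rev t
    · subst h2
      rw [swap_apply_right, hZt', add_zero, ← hc', hrev]
      rw [hrev]
      exact fun h => ht h.symm
    · rw [swap_apply_of_ne_of_ne h1 h2, hc]
      simp [h1, h2]
  · beta_reduce
    rw [hsymm]
    have h1 : e ≠ t := by rintro rfl; exact he htt
    have h2 : e ≠ rev t := by rintro rfl; rw [hrev] at he; exact he htt.symm
    have h3 : rev e ≠ t := fun h => h2 (by rw [← h, hrev])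
    have h4 : rev e ≠ rev t := fun h => h1 (by rw [← hrev e, h, hrev])
    rw [swap_apply_of_ne_of_ne h3 h4]
    exact hc' e fun het => he ((hsc _ _).2 (Or.inl het))

/-- Contracting a finite set of edges of a planar rotation system. -/
lemma IsPlanarRotation.exists_contraction {P : Type*} {base : E → P} (h : IsPlanarRotation ρ rev)
    (hrev : ∀ e, rev (rev e) = e) (hbase : ∀ e e', ρ.SameCycle e e' ↔ base e = base e')
    (T : Finset E) : ∃ ρ' : Perm E, IsPlanarRotation ρ' rev ∧ ∀ e e', ρ'.SameCycle e e' ↔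
      Relation.EqvGen (fun x y => ∃ t ∈ T, base t = x ∧ base (rev t) = y) (base e) (base e') := by
  classical
  induction T using Finset.induction_on with
  | empty =>
    refine ⟨ρ, h, fun e e' => (hbase e e').trans ⟨fun h => h ▸ .refl _, fun h => ?_⟩⟩
    have : ∀ {x y}, Relation.EqvGen (fun x y => ∃ t ∈ (∅ : Finset E), base t = x ∧
        base (rev t) = y) x y → x = y := by
      intro x y h
      induction h with
      | rel x y h => simp at h
      | refl => rfl
      | symm _ _ _ ih => exact ih.symm
      | trans _ _ _ _ _ h1 h2 => exact h1.trans h2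
    exact this h
  | insert t T _ ih =>
    obtain ⟨ρ', hρ', hr⟩ := ih
    have hmono : ∀ x y, Relation.EqvGen (fun x y => ∃ t ∈ T, base t = x ∧ base (rev t) = y) x y →
        Relation.EqvGen (fun x y => ∃ t' ∈ insert t T, base t' = x ∧ base (rev t') = y) x y :=
      fun x y => Relation.EqvGen.mono (fun a b ⟨t', ht', h'⟩ =>
        ⟨t', Finset.mem_insert_of_mem ht', h'⟩) x y
    have ht : Relation.EqvGen (fun x y => ∃ t' ∈ insert t T, base t' = x ∧ base (rev t') = y)
      (base t) (base (rev t)) := .rel _ _ ⟨t, Finset.mem_insert_self _ _, rfl, rfl⟩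
    have hdown : ∀ {ρ'' : Perm E}, (∀ e e', ρ'.SameCycle e e' → ρ''.SameCycle e e') →
        ρ''.SameCycle t (rev t) → ∀ {x y},
        Relation.EqvGen (fun x y => ∃ t' ∈ insert t T, base t' = x ∧ base (rev t') = y) x y →
        ∀ e e', base e = x → base e' = y → ρ''.SameCycle e e' := by
      intro ρ'' h1 h2 x y hxy
      induction hxy with
      | rel x y h' =>
        obtain ⟨t', ht', rfl, rfl⟩ := h'
        intro e e' he he'
        refine (h1 e t' ((hr _ _).2 (he ▸ .refl _))).trans (Perm.SameCycle.trans ?_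
          (h1 (rev t') e' ((hr _ _).2 (he' ▸ .refl _))))
        rcases Finset.mem_insert.1 ht' with rfl | ht'
        · exact h2
        · exact h1 _ _ ((hr _ _).2 (.rel _ _ ⟨t', ht', rfl, rfl⟩))
      | refl x => exact fun e e' he he' => h1 _ _ ((hr _ _).2 (by rw [he, he']; exact .refl _))
      | symm x y _ ih => exact fun e e' he he' => (ih e' e he' he).symm
      | trans x y z hxy _ ih1 ih2 =>
        intro e e' he he'
        by_cases hy : ∃ e'', base e'' = y
        · obtain ⟨e'', he''⟩ := hy
          exact (ih1 e e'' he he'').trans (ih2 e'' e' he'' he')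
        · exfalso
          have : ∀ {x y}, Relation.EqvGen
              (fun x y => ∃ t' ∈ insert t T, base t' = x ∧ base (rev t') = y) x y →
              ((∃ e, base e = x) ↔ ∃ e, base e = y) := by
            intro x y h
            induction h with
            | rel x y h => 
              obtain ⟨t', -, h1, h2⟩ := h
              exact ⟨fun _ => ⟨_, h2⟩, fun _ => ⟨_, h1⟩⟩
            | refl => rfl
            | symm _ _ _ ih => exact ih.symm
            | trans _ _ _ _ _ h1 h2 => exact h1.trans h2
          exact hy ((this hxy).1 ⟨e, he⟩)
    by_cases hloop : ρ'.SameCycle t (rev t)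
    · exact ⟨ρ', hρ', fun e e' => ⟨fun h => hmono _ _ ((hr _ _).1 h),
        fun h => hdown (fun _ _ => id) hloop h _ _ rfl rfl⟩⟩
    · have hsc := sameCycle_mul_swap hρ'.finite_cycle hloop
      refine ⟨_, hρ'.mul_swap hrev hloop, fun e e' => ⟨fun h => ?_, fun h =>
        hdown (fun _ _ h => (hsc _ _).2 (Or.inl h))
        ((hsc _ _).2 (Or.inr ⟨Or.inl (.refl _ _), Or.inr (.refl _ _)⟩)) h _ _ rfl rfl⟩⟩
      have aux : ∀ {e}, ρ'.SameCycle e t ∨ ρ'.SameCycle e (rev t) →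
          Relation.EqvGen (fun x y => ∃ t' ∈ insert t T, base t' = x ∧ base (rev t') = y)
            (base e) (base t) := by
        rintro e (h | h)
        · exact hmono _ _ ((hr _ _).1 h)
        · exact .trans _ _ _ (hmono _ _ ((hr _ _).1 h)) (.symm _ _ ht)
      rcases (hsc _ _).1 h with h | ⟨h, h'⟩
      · exact hmono _ _ ((hr _ _).1 h)
      · exact .trans _ _ _ (aux h) (.symm _ _ (aux h'))

end PlanarRotation

namespace Grid

open Equiv Finset

/-- The unit step in one of the four directions east, north, west, south. -/
def step (k : Fin 4) : ℤ × ℤ := ![(1, 0), (0, 1), (-1, 0), (0, -1)] k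

/-- Reversal of the edges of the square grid. -/
def rev (e : (ℤ × ℤ) × Fin 4) : (ℤ × ℤ) × Fin 4 := (e.1 + step e.2, e.2 + 2)

/-- The counterclockwise rotation of the square grid. -/
def rot : Perm ((ℤ × ℤ) × Fin 4) := Equiv.prodCongr (Equiv.refl _) (Equiv.addRight 1)

lemma rev_rev (e : (ℤ × ℤ) × Fin 4) : rev (rev e) = e := by
  obtain ⟨⟨i, j⟩, k⟩ := e
  fin_cases k <;> simp [rev, step]

lemma rev_fst_ne (e : (ℤ × ℤ) × Fin 4) : (rev e).1 ≠ e.1 := by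
  obtain ⟨⟨i, j⟩, k⟩ := e
  fin_cases k <;> simp [rev, step]

lemma sameCycle_rot (e e' : (ℤ × ℤ) × Fin 4) : rot.SameCycle e e' ↔ e.1 = e'.1 := by
  constructor
  · exact Perm.SameCycle.of_step (r := fun e e' : (ℤ × ℤ) × Fin 4 => e.1 = e'.1)
      ⟨fun _ => rfl, fun h => h.symm, fun h h' => h.trans h'⟩ fun _ => rfl
  · obtain ⟨p, k⟩ := e
    obtain ⟨p', k'⟩ := e'
    rintro rfl
    have : ∀ n : ℕ, (rot ^ n) (p, k) = (p, k + Fin.ofNat 4 n) := by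
      intro n
      induction n with
      | zero => simp
      | succ n ih =>
        rw [pow_succ', Perm.mul_apply, ih]
        have : Fin.ofNat 4 (n + 1) = Fin.ofNat 4 n + 1 := by
          apply Fin.ext
          simp [Fin.val_add]
        rw [this, ← add_assoc]
        rfl
    refine ⟨((k' - k : Fin 4).val : ℕ), ?_⟩
    rw [zpow_natCast, this]
    simp

lemma isPlanarRotation : IsPlanarRotation rot rev := by
  classical
  refine ⟨fun e => ?_, fun Z hfin _ hZ hs => ?_⟩
  · refine (Set.finite_range fun k : Fin 4 => (e.1, k)).subset ?_
    intro e' he'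
    exact ⟨e'.2, Prod.ext ((sameCycle_rot e e').1 he') rfl⟩
  · obtain ⟨R, hR⟩ : ∃ R : ℤ, ∀ i j k, R ≤ i → Z ((i, j), k) = 0 := by
      obtain ⟨R, hR⟩ := (hfin.image (fun e => e.1.1)).bddAbove
      refine ⟨R + 1, fun i j k hi => ?_⟩
      by_contra h0
      have := hR ⟨((i, j), k), h0, rfl⟩
      simp only at this
      lia
    set F : ℤ → ℤ → ZMod 2 := fun i j => ∑ x ∈ Finset.Ioc i R, Z ((x, j), 1) with hF
    have hFR : ∀ i j, R ≤ i → F i j = 0 := by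
      intro i j hi
      rw [hF]
      simp [Finset.Ioc_eq_empty (not_lt.2 hi)]
    have hN : ∀ i j, F (i - 1) j = F i j + Z ((i, j), 1) := by
      intro i j
      by_cases hi : R < i
      · rw [hFR _ _ (by lia), hFR _ _ (by lia), hR _ _ _ hi.le, add_zero]
      · have : Finset.Ioc (i - 1) R = insert i (Finset.Ioc i R) := by
          ext x
          simp only [Finset.mem_Ioc, Finset.mem_insert]
          lia
        simp only [hF]
        rw [this, Finset.sum_insert (by simp), add_comm]
    have hE : ∀ i j, Z ((i, j), 2) = Z ((i - 1, j), 0) := by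
      intro i j
      rw [← hZ ((i - 1, j), 0)]
      simp [rev, step]
    have hS : ∀ i j, Z ((i, j), 3) = Z ((i, j - 1), 1) := by
      intro i j
      rw [← hZ ((i, j - 1), 1)]
      simp [rev, step]
    have hv : ∀ p, Z (p, 0) + Z (p, 1) + Z (p, 2) + Z (p, 3) = 0 := by
      intro p
      have := hs (p, 0) (univ.image fun k : Fin 4 => (p, k)) (fun e' => by
        rw [sameCycle_rot]
        simp only [mem_image, mem_univ, true_and]
        exact ⟨fun ⟨k, hk⟩ => by rw [← hk], fun h => ⟨e'.2, Prod.ext h rfl⟩⟩)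
      rw [Finset.sum_image (fun _ _ _ _ h => congrArg Prod.snd h), Fin.sum_univ_four] at this
      exact this
    have hEF : ∀ i j, F i j + F i (j - 1) = Z ((i, j), 0) := by
      intro i j
      have key : ∀ n : ℕ, ∀ i, R ≤ i + n → F i j + F i (j - 1) = Z ((i, j), 0) := by
        intro n
        induction n with
        | zero =>
          intro i hi
          rw [hFR _ _ (by lia), hFR _ _ (by lia), hR _ _ _ (by lia), add_zero]
        | succ n ih =>
          intro i hi
          have h1 := ih (i + 1) (by push_cast at hi; lia)
          have h2 := hN (i + 1) j
          have h3 := hN (i + 1) (j - 1)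
          have h4 := hv (i + 1, j)
          rw [hE, hS] at h4
          rw [add_sub_cancel_right] at h2 h3 h4
          rw [h2, h3]
          calc _ = (F (i + 1) j + F (i + 1) (j - 1)) +
                (Z ((i + 1, j), 1) + Z ((i + 1, j - 1), 1)) := by ring
            _ = (Z ((i + 1, j), 0) + Z ((i + 1, j), 1) + Z ((i, j), 0) + Z ((i + 1, j - 1), 1))
                - Z ((i, j), 0) := by rw [h1]; ring
            _ = _ := by rw [h4, zero_sub, ZModModule.neg_eq_self]
      exact key (R - i).toNat i (by lia)
    refine ⟨fun e => ![F e.1.1 e.1.2, F (e.1.1 - 1) e.1.2, F (e.1.1 - 1) (e.1.2 - 1),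
      F e.1.1 (e.1.2 - 1)] e.2, fun e => ?_, fun e _ => ?_⟩
    · have hs' : rot.symm e = (e.1, e.2 - 1) := by
        rw [Equiv.symm_apply_eq]
        simp [rot]
      rw [hs']
      obtain ⟨⟨i, j⟩, k⟩ := e
      have haux : ∀ a b z : ZMod 2, a + b = z → a = b + z := by decide
      fin_cases k
      · exact haux _ _ _ (hEF i j)
      · exact hN i j
      · refine (haux _ _ _ ((add_comm _ _).trans (hEF (i - 1) j))).trans ?_
        exact congrArg _ (hE i j).symm
      · refine (haux _ _ _ ?_)
        refine Eq.trans ?_ (hS i j).symm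
        have := hN i (j - 1)
        exact (eq_comm.1 (haux _ _ _ ((add_comm _ _).trans (this.symm)))).trans rfl
    · have hs' : rot.symm e = (e.1, e.2 - 1) := by
        rw [Equiv.symm_apply_eq]
        simp [rot]
      rw [hs']
      obtain ⟨⟨i, j⟩, k⟩ := e
      fin_cases k <;> simp [rev, step] <;> simp only [← sub_eq_add_neg]

end Grid

namespace Grid

open Equiv Finset

/-- Two points of the square lattice are joined by an edge of the grid. -/
def Adj (x y : ℤ × ℤ) : Prop := ∃ k, y = x + step k

lemma Adj.symm {x y : ℤ × ℤ} (h : Adj x y) : Adj y x := by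
  obtain ⟨k, rfl⟩ := h
  have := congrArg Prod.fst (rev_rev (x, k))
  exact ⟨k + 2, this.symm⟩

/-- `y` can be reached from `x` along edges of the grid inside the set `S`. -/
def Reach (S : Set (ℤ × ℤ)) : ℤ × ℤ → ℤ × ℤ → Prop :=
  Relation.ReflTransGen fun x y => x ∈ S ∧ y ∈ S ∧ Adj x y

lemma Reach.symm {S : Set (ℤ × ℤ)} {x y : ℤ × ℤ} (h : Reach S x y) : Reach S y x := by
  induction h with
  | refl => exact .refl
  | tail _ h ih => exact .head ⟨h.2.1, h.1, h.2.2.symm⟩ ih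

lemma Reach.mono {S S' : Set (ℤ × ℤ)} (hS : S ⊆ S') {x y : ℤ × ℤ} (h : Reach S x y) :
    Reach S' x y :=
  Relation.ReflTransGen.mono (fun _ _ ⟨h1, h2, h3⟩ => ⟨hS h1, hS h2, h3⟩) x y h

lemma Reach.mem {S : Set (ℤ × ℤ)} {x y : ℤ × ℤ} (h : Reach S x y) (hx : x ∈ S) : y ∈ S := by
  induction h with
  | refl => exact hx
  | tail _ h _ => exact h.2.1

/-- A path from outside `N` into `N` has a first edge entering `N`. -/
lemma Reach.exists_entry {S N : Set (ℤ × ℤ)} {x y : ℤ × ℤ} (h : Reach S x y) (hx : x ∉ N)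
    (hy : y ∈ N) : ∃ a b, Reach (S \ N) x a ∧ a ∉ N ∧ b ∈ N ∧ a ∈ S ∧ b ∈ S ∧ Adj a b := by
  have key : y ∉ N ∧ Reach (S \ N) x y ∨
      ∃ a b, Reach (S \ N) x a ∧ a ∉ N ∧ b ∈ N ∧ a ∈ S ∧ b ∈ S ∧ Adj a b := by
    clear hy
    induction h with
    | refl => exact Or.inl ⟨hx, .refl⟩
    | @tail b c _ h ih =>
      rcases ih with ⟨h1, h2⟩ | h'
      · by_cases hc : c ∈ N
        · exact Or.inr ⟨b, c, h2, h1, hc, h.1, h.2.1, h.2.2⟩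
        · exact Or.inl ⟨hc, h2.tail ⟨⟨h.1, h1⟩, ⟨h.2.1, hc⟩, h.2.2⟩⟩
      · exact Or.inr h'
  exact key.resolve_left fun hyS => hyS.1 hy

/-- A graph modelled by disjoint connected blobs of the square grid has a planar rotation
system. -/
lemma exists_rotation_of_blobs {D W : Type*} [Finite D] [Finite W] {rv : D → D} {vt : D → W}
    (C : W → Set (ℤ × ℤ)) (hfin : ∀ w, (C w).Finite)
    (hdisj : ∀ w w' x, x ∈ C w → x ∈ C w' → w = w')
    (hconn : ∀ w, ∀ x ∈ C w, ∀ y ∈ C w, Reach (C w) x y)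
    (hloop : ∀ d, vt d ≠ vt (rv d))
    {f : D → (ℤ × ℤ) × Fin 4} (hf : Function.Injective f) (hfrev : ∀ d, f (rv d) = rev (f d))
    (hfC : ∀ d, (f d).1 ∈ C (vt d)) :
    ∃ rot : Perm D, (∀ d d', rot.SameCycle d d' ↔ vt d = vt d') ∧
      ∀ Z : D → ZMod 2, (∀ d, Z (rv d) = Z d) →
        (∀ w, ∀ s : Finset D, (∀ d, d ∈ s ↔ vt d = w) → ∑ d ∈ s, Z d = 0) →
        ∃ c : D → ZMod 2, ∀ d, c (rot.symm d) = c (rv d) ∧ c d + c (rv d) = Z d := by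
  classical
  have hTfin : {e : (ℤ × ℤ) × Fin 4 | ∃ w, e.1 ∈ C w ∧ (rev e).1 ∈ C w}.Finite := by
    refine ((Set.finite_iUnion hfin).prod (Set.finite_univ (α := Fin 4))).subset ?_
    rintro e ⟨w, h, -⟩
    exact ⟨Set.mem_iUnion.2 ⟨w, h⟩, trivial⟩
  obtain ⟨ρ, hρ, hr⟩ := isPlanarRotation.exists_contraction rev_rev (base := Prod.fst)
    sameCycle_rot hTfin.toFinset
  simp only [Set.Finite.mem_toFinset] at hr
  have hgen : ∀ {x y}, Relation.EqvGen (fun x y => ∃ t ∈ {e : (ℤ × ℤ) × Fin 4 |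
      ∃ w, e.1 ∈ C w ∧ (rev e).1 ∈ C w}, t.1 = x ∧ (rev t).1 = y) x y →
      ∀ w, x ∈ C w ↔ y ∈ C w := by
    intro x y h
    induction h with
    | rel x y h =>
      obtain ⟨t, ⟨w', h1, h2⟩, rfl, rfl⟩ := h
      intro w
      exact ⟨fun h => hdisj _ _ _ h h1 ▸ h2, fun h => hdisj _ _ _ h h2 ▸ h1⟩
    | refl => exact fun _ => Iff.rfl
    | symm _ _ _ ih => exact fun w => (ih w).symm
    | trans _ _ _ _ _ h1 h2 => exact fun w => (h1 w).trans (h2 w)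
  have hcyc : ∀ d d', ρ.SameCycle (f d) (f d') ↔ vt d = vt d' := by
    intro d d'
    rw [hr]
    constructor
    · intro h
      exact hdisj _ _ _ (((hgen h _).1 (hfC d))) (hfC d')
    · intro h
      have : ∀ {w x y}, Reach (C w) x y → Relation.EqvGen (fun x y => ∃ t ∈ {e : (ℤ × ℤ) × Fin 4 |
          ∃ w, e.1 ∈ C w ∧ (rev e).1 ∈ C w}, t.1 = x ∧ (rev t).1 = y) x y := by
        intro w x y h
        induction h with
        | refl => exact .refl _
        | @tail b c _ h ih =>
          obtain ⟨h1, h2, k, rfl⟩ := h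
          exact .trans _ _ _ ih (.rel _ _ ⟨(b, k), ⟨w, h1, h2⟩, rfl, rfl⟩)
      exact this (hconn _ _ (hfC d) _ (h ▸ hfC d'))
  obtain ⟨rot, hrot, hrot'⟩ := exists_firstReturn ρ f hf
    fun a => Perm.exists_pow_eq_of_finite (hρ.finite_cycle _)
  refine ⟨rot, fun d d' => (hrot d d').trans (hcyc d d'), fun Z hZ hs => ?_⟩
  have hnl : ∀ d, ¬ ρ.SameCycle (f d) (rev (f d)) := by
    intro d
    rw [← hfrev, hcyc]
    exact hloop d
  set Z' : (ℤ × ℤ) × Fin 4 → ZMod 2 := Function.extend f Z 0 with hZ'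
  have hZf : ∀ d, Z' (f d) = Z d := fun d => hf.extend_apply _ _ _
  have hZ0 : ∀ e, (∀ d, f d ≠ e) → Z' e = 0 := by
    intro e he
    rw [hZ', Function.extend_apply' _ _ _ (fun ⟨d, hd⟩ => he d hd)]
    rfl
  obtain ⟨c, hc, hc'⟩ := hρ.exists_colouring Z' (by
      refine (Set.finite_range f).subset fun e he => ?_
      by_contra h0
      exact he (hZ0 e fun d hd => h0 ⟨d, hd⟩)) (by
      intro e he
      by_cases h : ∃ d, f d = e
      · obtain ⟨d, rfl⟩ := h
        exact hnl d
      · exact absurd (hZ0 e fun d hd => h ⟨d, hd⟩) he) (by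
      intro e
      by_cases h : ∃ d, f d = e
      · obtain ⟨d, rfl⟩ := h
        rw [← hfrev, hZf, hZf, hZ]
      · rw [hZ0 e fun d hd => h ⟨d, hd⟩, hZ0]
        intro d hd
        exact h ⟨rv d, by rw [hfrev, hd, rev_rev]⟩) (by
      intro e s hes
      let _ := Fintype.ofFinite D
      have h1 : ∑ e' ∈ s, Z' e' = ∑ d ∈ univ.filter (fun d => f d ∈ s), Z d := by
        rw [← Finset.sum_subset (Finset.image_subset_iff.2
          (fun d hd => (Finset.mem_filter.1 hd).2 : ∀ d ∈ univ.filter (fun d => f d ∈ s), f d ∈ s)),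
          Finset.sum_image fun _ _ _ _ h => hf h]
        · exact Finset.sum_congr rfl fun d _ => hZf d
        · intro e' he' hn
          refine hZ0 _ fun d hd => hn (Finset.mem_image.2 ⟨d, ?_, hd⟩)
          simpa [hd] using he'
      rw [h1]
      by_cases h : ∃ d, f d ∈ s
      · obtain ⟨d0, hd0⟩ := h
        refine hs (vt d0) _ fun d => ?_
        rw [Finset.mem_filter, hes, ← hcyc]
        rw [hes] at hd0
        simp only [mem_univ, true_and]
        exact ⟨fun h => h.symm.trans hd0, fun h => hd0.trans h.symm⟩
      · push Not at h
        refine Finset.sum_eq_zero fun d hd => ?_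
        exact absurd (Finset.mem_filter.1 hd).2 (h d))
  have key : ∀ d, c (f (rot.symm d)) = c (ρ.symm (f d)) := by
    refine hrot' c fun a d _ hd => ?_
    rw [hc d, hZ0 d hd, add_zero]
  refine ⟨fun d => c (f d), fun d => ?_⟩
  have h1 := hc' (f d) (hnl d)
  beta_reduce
  rw [key, hfrev, h1]
  refine ⟨rfl, ?_⟩
  rw [hc (f d), hZf, add_assoc, add_comm, add_assoc, CharTwo.add_self_eq_zero, add_zero]

end Grid

namespace Grid

open Set Filter Topology

/-- The lattice point below and to the left of `z` in the lattice of mesh `δ`. -/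
noncomputable def round (δ : ℝ) (z : ℝ × ℝ) : ℤ × ℤ := (⌊z.1 / δ⌋, ⌊z.2 / δ⌋)

/-- The lattice points of the lattice of mesh `δ` that are close to `K`. -/
def near (δ : ℝ) (K : Set (ℝ × ℝ)) : Set (ℤ × ℤ) :=
  {p | ∃ z ∈ K, |δ * p.1 - z.1| ≤ 2 * δ ∧ |δ * p.2 - z.2| ≤ 2 * δ}

lemma abs_floor_sub_le {δ x y : ℝ} (hδ : 0 < δ) (h : |x - y| ≤ δ) :
    |δ * ⌊x / δ⌋ - y| ≤ 2 * δ := by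
  have h1 := Int.floor_le (x / δ)
  have h2 := Int.lt_floor_add_one (x / δ)
  rw [le_div_iff₀ hδ] at h1
  rw [div_lt_iff₀ hδ] at h2
  rw [abs_le] at h ⊢
  constructor <;> nlinarith

lemma round_mem_near {δ : ℝ} (hδ : 0 < δ) {K : Set (ℝ × ℝ)} {z : ℝ × ℝ} (hz : z ∈ K) :
    round δ z ∈ near δ K :=
  ⟨z, hz, abs_floor_sub_le hδ (by simp [hδ.le]), abs_floor_sub_le hδ (by simp [hδ.le])⟩

lemma near_finite {δ : ℝ} (hδ : 0 < δ) {K : Set (ℝ × ℝ)} (hK : Bornology.IsBounded K) :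
    (near δ K).Finite := by
  obtain ⟨R, hR⟩ := hK.exists_norm_le
  obtain ⟨n, hn⟩ := exists_nat_gt (R / δ + 2)
  have aux : ∀ (p : ℤ) (x : ℝ), |x| ≤ R → |δ * p - x| ≤ 2 * δ → -(n : ℤ) ≤ p ∧ p ≤ n := by
    intro p x hx hp
    have h1 : R + 2 * δ < n * δ := by
      have := mul_lt_mul_of_pos_right hn hδ
      rwa [add_mul, div_mul_cancel₀ _ hδ.ne'] at this
    rw [abs_le] at hx hp
    constructor
    · by_contra hlt
      have : (p : ℝ) ≤ -n := by
        have : p ≤ -(n : ℤ) := by lia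
        exact_mod_cast this
      nlinarith
    · by_contra hlt
      have : (n : ℝ) ≤ p := by
        have : (n : ℤ) ≤ p := by lia
        exact_mod_cast this
      nlinarith
  refine (Set.finite_Icc ((-(n : ℤ), -(n : ℤ)) : ℤ × ℤ) (n, n)).subset ?_
  rintro ⟨p, q⟩ ⟨z, hz, h1, h2⟩
  have hzn := hR z hz
  have h3 := aux p z.1 ((norm_fst_le z).trans hzn) h1
  have h4 := aux q z.2 ((norm_snd_le z).trans hzn) h2
  exact ⟨⟨h3.1, h4.1⟩, ⟨h3.2, h4.2⟩⟩

lemma eventually_disjoint_near {K L : Set (ℝ × ℝ)} (hK : IsCompact K) (hL : IsCompact L)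
    (h : Disjoint K L) : ∀ᶠ δ in 𝓝[>] (0 : ℝ), Disjoint (near δ K) (near δ L) := by
  obtain ⟨ε, hε, hd⟩ := h.exists_thickenings hK hL.isClosed
  filter_upwards [Ioo_mem_nhdsGT (show 0 < ε / 4 by positivity)] with δ hδ
  rw [Set.disjoint_left]
  rintro p ⟨z, hz, h1, h2⟩ ⟨z', hz', h1', h2'⟩
  have hdist : dist z z' < ε := by
    rw [Prod.dist_eq, max_lt_iff, Real.dist_eq, Real.dist_eq]
    have := hδ.2
    rw [abs_le] at h1 h2 h1' h2'
    constructor <;> rw [abs_lt] <;> constructor <;> linarith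
  refine Set.disjoint_left.1 hd (Metric.mem_thickening_iff.2 ⟨z, hz, ?_⟩)
    (Metric.self_subset_thickening hε _ hz')
  rwa [dist_comm]

lemma reach_fst {S : Set (ℤ × ℤ)} {a a' b : ℤ} (h : |a - a'| ≤ 1) (h1 : (a, b) ∈ S)
    (h2 : (a', b) ∈ S) : Reach S (a, b) (a', b) := by
  rw [abs_le] at h
  obtain h | h | h : a' = a ∨ a' = a + 1 ∨ a' = a - 1 := by lia
  · exact h ▸ .refl
  · exact .single ⟨h1, h2, 0, by simp [step, h]⟩
  · exact .single ⟨h1, h2, 2, by simp [step, h, sub_eq_add_neg]⟩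

lemma reach_snd {S : Set (ℤ × ℤ)} {a b b' : ℤ} (h : |b - b'| ≤ 1) (h1 : (a, b) ∈ S)
    (h2 : (a, b') ∈ S) : Reach S (a, b) (a, b') := by
  rw [abs_le] at h
  obtain h | h | h : b' = b ∨ b' = b + 1 ∨ b' = b - 1 := by lia
  · exact h ▸ .refl
  · exact .single ⟨h1, h2, 1, by simp [step, h]⟩
  · exact .single ⟨h1, h2, 3, by simp [step, h, sub_eq_add_neg]⟩

lemma abs_floor_sub_floor_le {δ x y : ℝ} (hδ : 0 < δ) (h : |x - y| < δ) :
    |⌊x / δ⌋ - ⌊y / δ⌋| ≤ 1 := by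
  have h1 : |x / δ - y / δ| < 1 := by
    rw [← sub_div, abs_div, abs_of_pos hδ, div_lt_one hδ]
    exact h
  rw [abs_lt] at h1
  rw [abs_le]
  have a1 := Int.floor_le (x / δ)
  have a2 := Int.lt_floor_add_one (x / δ)
  have b1 := Int.floor_le (y / δ)
  have b2 := Int.lt_floor_add_one (y / δ)
  constructor
  · have : (⌊y / δ⌋ : ℝ) < ⌊x / δ⌋ + 2 := by linarith
    have : ⌊y / δ⌋ < ⌊x / δ⌋ + 2 := by exact_mod_cast this
    lia
  · have : (⌊x / δ⌋ : ℝ) < ⌊y / δ⌋ + 2 := by linarith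
    have : ⌊x / δ⌋ < ⌊y / δ⌋ + 2 := by exact_mod_cast this
    lia

lemma reach_round {δ : ℝ} (hδ : 0 < δ) {K : Set (ℝ × ℝ)} {z z' : ℝ × ℝ} (hz : z ∈ K)
    (hz' : z' ∈ K) (h : dist z z' < δ) : Reach (near δ K) (round δ z) (round δ z') := by
  rw [Prod.dist_eq, max_lt_iff, Real.dist_eq, Real.dist_eq] at h
  have hm : ((⌊z'.1 / δ⌋, ⌊z.2 / δ⌋) : ℤ × ℤ) ∈ near δ K :=
    ⟨z', hz', abs_floor_sub_le hδ (by simp [hδ.le]), abs_floor_sub_le hδ h.2.le⟩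
  exact (reach_fst (abs_floor_sub_floor_le hδ h.1) (round_mem_near hδ hz) hm).trans
    (reach_snd (abs_floor_sub_floor_le hδ h.2) hm (round_mem_near hδ hz'))

lemma reach_round_of_isPreconnected {δ : ℝ} (hδ : 0 < δ) {γ : ℝ → ℝ × ℝ} (hγ : Continuous γ)
    {s : Set ℝ} (hs : IsPreconnected s) {x y : ℝ} (hx : x ∈ s) (hy : y ∈ s) :
    Reach (near δ (γ '' s)) (round δ (γ x)) (round δ (γ y)) := by
  refine hs.induction₂ (fun x y => Reach (near δ (γ '' s)) (round δ (γ x)) (round δ (γ y)))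
    ?_ (fun x y z _ _ _ h h' => h.trans h') (fun x y _ _ h => h.symm) hx hy
  intro x hx
  have : ∀ᶠ y in 𝓝[s] x, dist (γ y) (γ x) < δ :=
    (hγ.continuousAt.mono_left nhdsWithin_le_nhds).eventually (Metric.ball_mem_nhds _ hδ)
  filter_upwards [this, self_mem_nhdsWithin] with y hy hys
  exact reach_round hδ (mem_image_of_mem _ hx) (mem_image_of_mem _ hys) (by rwa [dist_comm])

end Grid

namespace Grid

open Set Filter Topology

/-- A finite family of internally disjoint arcs in the plane has a planar rotation system. -/
lemma exists_rotation_of_arcs {D W : Type*} [Finite D] [Finite W] {rv : D → D} {vt : D → W}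
    (hrv : ∀ d, rv (rv d) = d) (hloop : ∀ d, vt d ≠ vt (rv d))
    (pt : W → ℝ × ℝ) (hpt : Function.Injective pt)
    (γ : D → ℝ → ℝ × ℝ) (hγ : ∀ d, Continuous (γ d)) (hγ0 : ∀ d, γ d 0 = pt (vt d))
    (hγr : ∀ d s, γ (rv d) s = γ d (1 - s))
    (hdisj : ∀ d d' s s', s ∈ Ioo (0 : ℝ) 1 → s' ∈ Icc (0 : ℝ) 1 → γ d s = γ d' s' →
      d' = d ∧ s' = s ∨ d' = rv d ∧ s' = 1 - s) :
    ∃ rot : Equiv.Perm D, (∀ d d', rot.SameCycle d d' ↔ vt d = vt d') ∧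
      ∀ Z : D → ZMod 2, (∀ d, Z (rv d) = Z d) →
        (∀ w, ∀ s : Finset D, (∀ d, d ∈ s ↔ vt d = w) → ∑ d ∈ s, Z d = 0) →
        ∃ c : D → ZMod 2, ∀ d, c (rot.symm d) = c (rv d) ∧ c d + c (rv d) = Z d := by
  classical
  set K : W → Set (ℝ × ℝ) := fun w => ⋃ d : {d // vt d = w}, γ d '' Icc 0 (1 / 3) with hK
  set L : D → Set (ℝ × ℝ) := fun d => γ d '' Icc (1 / 3) (2 / 3) with hL
  have hKmem : ∀ d s, s ∈ Icc (0 : ℝ) (1 / 3) → γ d s ∈ K (vt d) :=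
    fun d s hs => mem_iUnion.2 ⟨⟨d, rfl⟩, s, hs, rfl⟩
  have hKc : ∀ w, IsCompact (K w) := fun w => isCompact_iUnion fun d => isCompact_Icc.image (hγ _)
  have hLc : ∀ d, IsCompact (L d) := fun d => isCompact_Icc.image (hγ d)
  have hLr : ∀ d, L (rv d) ⊆ L d := by
    rintro d _ ⟨s, hs, rfl⟩
    exact ⟨1 - s, ⟨by linarith [hs.2], by linarith [hs.1]⟩, (hγr d s).symm⟩
  have hKK : ∀ w w', w ≠ w' → Disjoint (K w) (K w') := by
    intro w w' hw
    rw [Set.disjoint_left]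
    intro z hz hz'
    obtain ⟨⟨d, rfl⟩, s, hs, rfl⟩ := mem_iUnion.1 hz
    obtain ⟨⟨d', rfl⟩, s', hs', h⟩ := mem_iUnion.1 hz'
    rcases hs.1.eq_or_lt with rfl | h0
    · rcases hs'.1.eq_or_lt with rfl | h0'
      · rw [hγ0, hγ0] at h
        exact hw (hpt h).symm
      · rcases hdisj d' d s' 0 ⟨h0', by linarith [hs'.2]⟩ ⟨le_rfl, zero_le_one⟩ h with h1 | h1
        · exact hw (congrArg vt h1.1)
        · linarith [hs'.2, h1.2]
    · rcases hdisj d d' s s' ⟨h0, by linarith [hs.2]⟩ ⟨hs'.1, by linarith [hs'.2]⟩ h.symm with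
        h1 | h1
      · exact hw (congrArg vt h1.1).symm
      · linarith [hs'.2, hs.2, h1.2]
  have hLK : ∀ d w, w ≠ vt d → w ≠ vt (rv d) → Disjoint (L d) (K w) := by
    intro d w hw hw'
    rw [Set.disjoint_left]
    rintro _ ⟨s, hs, rfl⟩ hz'
    obtain ⟨⟨d', rfl⟩, s', hs', h⟩ := mem_iUnion.1 hz'
    rcases hdisj d d' s s' ⟨by linarith [hs.1], by linarith [hs.2]⟩
      ⟨hs'.1, by linarith [hs'.2]⟩ h.symm with h1 | h1
    · exact hw (congrArg vt h1.1)
    · exact hw' (congrArg vt h1.1)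
  have hLL : ∀ d d', d' ≠ d → d' ≠ rv d → Disjoint (L d) (L d') := by
    intro d d' hd hd'
    rw [Set.disjoint_left]
    rintro _ ⟨s, hs, rfl⟩ ⟨s', hs', h⟩
    rcases hdisj d d' s s' ⟨by linarith [hs.1], by linarith [hs.2]⟩
      ⟨by linarith [hs'.1], by linarith [hs'.2]⟩ h.symm with h1 | h1
    exacts [hd h1.1, hd' h1.1]
  obtain ⟨δ, hδ, hnKK, hnLK, hnLL⟩ : ∃ δ : ℝ, 0 < δ ∧
      (∀ w w', w ≠ w' → Disjoint (near δ (K w)) (near δ (K w'))) ∧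
      (∀ d w, w ≠ vt d → w ≠ vt (rv d) → Disjoint (near δ (L d)) (near δ (K w))) ∧
      ∀ d d', d' ≠ d → d' ≠ rv d → Disjoint (near δ (L d)) (near δ (L d')) := by
    have h1 : ∀ᶠ δ in 𝓝[>] (0 : ℝ), ∀ w w', w ≠ w' → Disjoint (near δ (K w)) (near δ (K w')) := by
      simp only [eventually_all]
      exact fun w w' h => eventually_disjoint_near (hKc _) (hKc _) (hKK w w' h)
    have h2 : ∀ᶠ δ in 𝓝[>] (0 : ℝ), ∀ d w, w ≠ vt d → w ≠ vt (rv d) →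
        Disjoint (near δ (L d)) (near δ (K w)) := by
      simp only [eventually_all]
      exact fun d w h h' => eventually_disjoint_near (hLc _) (hKc _) (hLK d w h h')
    have h3 : ∀ᶠ δ in 𝓝[>] (0 : ℝ), ∀ d d', d' ≠ d → d' ≠ rv d →
        Disjoint (near δ (L d)) (near δ (L d')) := by
      simp only [eventually_all]
      exact fun d w h h' => eventually_disjoint_near (hLc _) (hLc _) (hLL d w h h')
    obtain ⟨δ, ⟨⟨h1, h2⟩, h3⟩, h4⟩ := (((h1.and h2).and h3).and self_mem_nhdsWithin).exists
    exact ⟨δ, h4, h1, h2, h3⟩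
  set N : W → Set (ℤ × ℤ) := fun w =>
    {p | p ∈ near δ (K w) ∧ Reach (near δ (K w)) (round δ (pt w)) p} with hN
  have hNstart : ∀ d, round δ (γ d (1 / 3)) ∈ N (vt d) := by
    intro d
    refine ⟨round_mem_near hδ (hKmem d _ ⟨by norm_num, le_rfl⟩), ?_⟩
    rw [← hγ0]
    refine (reach_round_of_isPreconnected hδ (hγ d) isPreconnected_Icc (s := Icc 0 (1 / 3))
      ⟨le_rfl, by norm_num⟩ ⟨by norm_num, le_rfl⟩).mono ?_
    rintro p ⟨z, ⟨s, hs, rfl⟩, h⟩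
    exact ⟨_, hKmem d s hs, h⟩
  have hNN : ∀ w w' p, p ∈ N w → p ∈ N w' → w = w' := by
    intro w w' p hp hp'
    by_contra h
    exact Set.disjoint_left.1 (hnKK w w' h) hp.1 hp'.1
  set M : D → Set (ℤ × ℤ) := fun d =>
    {p | Reach (near δ (L d) \ N (vt (rv d))) (round δ (γ d (1 / 3))) p} with hM
  have hMstart : ∀ d, round δ (γ d (1 / 3)) ∈ near δ (L d) \ N (vt (rv d)) := by
    intro d
    refine ⟨round_mem_near hδ ⟨_, ⟨le_rfl, by norm_num⟩, rfl⟩, fun h => ?_⟩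
    exact hloop d (hNN _ _ _ (hNstart d) h)
  have hMmem : ∀ d p, p ∈ M d → p ∈ near δ (L d) \ N (vt (rv d)) :=
    fun d p hp => Reach.mem hp (hMstart d)
  have hentry : ∀ d, ∃ e : (ℤ × ℤ) × Fin 4, e.1 ∈ M d ∧ (rev e).1 ∈ N (vt (rv d)) ∧
      e.1 ∈ near δ (L d) ∧ (rev e).1 ∈ near δ (L d) := by
    intro d
    have h1 := reach_round_of_isPreconnected hδ (hγ d) isPreconnected_Icc
      (s := Icc (1 / 3) (2 / 3)) (x := 1 / 3) (y := 2 / 3)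
      ⟨le_rfl, by norm_num⟩ ⟨by norm_num, le_rfl⟩
    have h2 := hNstart (rv d)
    rw [hγr, show (1 : ℝ) - 1 / 3 = 2 / 3 by norm_num] at h2
    obtain ⟨a, b, hr, ha, hb, haL, hbL, k, rfl⟩ := h1.exists_entry (hMstart d).2 h2
    exact ⟨(a, k), hr, hb, haL, hbL⟩
  choose e heM heN heL heL' using hentry
  obtain ⟨O, hO⟩ : ∃ O : Set D, ∀ d, d ∈ O ↔ rv d ∉ O := by
    let i := Finite.equivFin D
    refine ⟨{d | i d < i (rv d)}, fun d => ?_⟩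
    have : i d ≠ i (rv d) := fun h => hloop d (congrArg vt (i.injective h))
    simp only [mem_ofPred_eq, hrv, not_lt]
    exact ⟨le_of_lt, fun h => lt_of_le_of_ne h this⟩
  set f : D → (ℤ × ℤ) × Fin 4 := fun d => if d ∈ O then e d else rev (e (rv d)) with hf
  have hfrev : ∀ d, f (rv d) = rev (f d) := by
    intro d
    by_cases h : d ∈ O
    · simp only [hf, if_pos h, if_neg ((hO d).1 h), hrv]
    · simp only [hf, if_neg h, if_pos (not_not.1 (mt (hO d).2 h)), rev_rev]
  have hfL : ∀ d, (f d).1 ∈ near δ (L d) := by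
    intro d
    by_cases h : d ∈ O
    · simp only [hf, if_pos h, heL]
    · simp only [hf, if_neg h]
      obtain ⟨z, hz, h⟩ := heL' (rv d)
      exact ⟨z, hLr d hz, h⟩
  refine exists_rotation_of_blobs (fun w => N w ∪ ⋃ d : {d // d ∈ O ∧ vt d = w}, M d)
    (fun w => ?_) ?_ ?_ hloop (f := f) ?_ hfrev ?_
  · refine Set.Finite.union ?_ (Set.finite_iUnion fun d => ?_)
    · exact (near_finite hδ (hKc w).isBounded).subset fun p hp => hp.1
    · exact (near_finite hδ (hLc d).isBounded).subset fun p hp => (hMmem _ _ hp).1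
  · have hNM : ∀ w d p, d ∈ O → p ∈ N w → p ∈ M d → w = vt d := by
      intro w d p hd hp hp'
      have h1 := hMmem d p hp'
      by_contra hw
      refine Set.disjoint_left.1 (hnLK d w hw ?_) h1.1 hp.1
      rintro rfl
      exact h1.2 hp
    rintro w w' p (hp | hp) (hp' | hp')
    · exact hNN _ _ _ hp hp'
    · obtain ⟨⟨d, hd, rfl⟩, h⟩ := mem_iUnion.1 hp'
      exact hNM _ d p hd hp h
    · obtain ⟨⟨d, hd, rfl⟩, h⟩ := mem_iUnion.1 hp
      exact (hNM _ d p hd hp' h).symm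
    · obtain ⟨⟨d, hd, rfl⟩, h⟩ := mem_iUnion.1 hp
      obtain ⟨⟨d', hd', rfl⟩, h'⟩ := mem_iUnion.1 hp'
      by_contra hne
      refine Set.disjoint_left.1 (hnLL d d' ?_ ?_) (hMmem _ _ h).1 (hMmem _ _ h').1
      · rintro rfl
        exact hne rfl
      · rintro rfl
        exact (hO d).1 hd hd'
  · intro w
    have key : ∀ x ∈ N w ∪ ⋃ d : {d // d ∈ O ∧ vt d = w}, M d,
        Reach (N w ∪ ⋃ d : {d // d ∈ O ∧ vt d = w}, M d) (round δ (pt w)) x := by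
      have hNr : ∀ x ∈ N w, Reach (N w) (round δ (pt w)) x := by
        rintro x ⟨-, h⟩
        induction h with
        | refl => exact .refl
        | tail h h' ih => exact ih.tail ⟨⟨h'.1, h⟩, ⟨h'.2.1, h.tail h'⟩, h'.2.2⟩
      rintro x (hx | hx)
      · exact (hNr x hx).mono subset_union_left
      · obtain ⟨⟨d, hd, rfl⟩, h⟩ := mem_iUnion.1 hx
        refine ((hNr _ (hNstart d)).mono subset_union_left).trans
          (Reach.mono (S := M d) (fun p hp => Or.inr (mem_iUnion.2 ⟨⟨d, hd, rfl⟩, hp⟩)) ?_)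
        simp only [hM, mem_ofPred_eq] at h
        clear hx
        induction h with
        | refl => exact .refl
        | tail h h' ih =>
          exact ih.tail ⟨h, h.tail h', h'.2.2⟩
    exact fun x hx y hy => (key x hx).symm.trans (key y hy)
  · intro d d' h
    by_contra hne
    have h1 := hfL d'
    rw [← h] at h1
    by_cases h2 : d' = rv d
    · rw [h2, hfrev] at h
      exact rev_fst_ne _ (congrArg Prod.fst h).symm
    · exact Set.disjoint_left.1 (hnLL d d' (Ne.symm hne) h2) (hfL d) h1
  · intro d
    by_cases h : d ∈ O
    · simp only [hf, if_pos h]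
      exact Or.inr (mem_iUnion.2 ⟨⟨d, h, rfl⟩, heM d⟩)
    · simp only [hf, if_neg h]
      refine Or.inl ?_
      have := heN (rv d)
      rwa [hrv] at this

end Grid

namespace PlaneDrawing

open Set

variable {V : Type*} {G : SimpleGraph V} (D : PlaneDrawing G)

/-- The arc of a dart, parametrized by the real line and constant outside of `[0, 1]`. -/
noncomputable def curve (a : G.Dart) : ℝ → ℝ × ℝ := (D.arc a.adj).extend

lemma continuous_curve (a : G.Dart) : Continuous (D.curve a) := (D.arc a.adj).continuous_extend

lemma curve_zero (a : G.Dart) : D.curve a 0 = D.pos a.fst := (D.arc a.adj).extend_zero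

lemma curve_one (a : G.Dart) : D.curve a 1 = D.pos a.snd := (D.arc a.adj).extend_one

lemma curve_symm (a : G.Dart) (t : ℝ) : D.curve a.symm t = D.curve a (1 - t) := by
  have : D.arc a.symm.adj = (D.arc a.adj).symm := D.arc_symm a.adj
  rw [curve, this]
  exact (D.arc a.adj).extend_symm_apply t

lemma curve_injOn (a : G.Dart) : InjOn (D.curve a) (Icc 0 1) := by
  intro s hs t ht h
  rw [curve, (D.arc a.adj).extend_apply hs, (D.arc a.adj).extend_apply ht] at h
  exact congrArg Subtype.val (D.arc_inj a.adj h)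

lemma isInteriorPoint_iff {u v : V} (h : G.Adj u v) (p : ℝ × ℝ) :
    D.IsInteriorPoint h p ↔ ∃ t ∈ Ioo (0 : ℝ) 1, D.curve ⟨(u, v), h⟩ t = p := by
  constructor
  · rintro ⟨t, h0, h1, rfl⟩
    exact ⟨t, ⟨lt_of_le_of_ne t.2.1 fun h => h0 (Subtype.ext h.symm),
      lt_of_le_of_ne t.2.2 fun h => h1 (Subtype.ext h)⟩, (D.arc h).extend_apply t.2⟩
  · rintro ⟨t, ht, rfl⟩
    refine ⟨⟨t, ht.1.le, ht.2.le⟩, fun h => ht.1.ne' (congrArg Subtype.val h),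
      fun h => ht.2.ne (congrArg Subtype.val h), ?_⟩
    exact ((D.arc h).extend_apply _).symm

lemma curve_ne_pos (a : G.Dart) {t : ℝ} (ht : t ∈ Ioo (0 : ℝ) 1) (w : V) :
    D.curve a t ≠ D.pos w := by
  intro h
  have ht' : t ∈ Icc (0 : ℝ) 1 := ⟨ht.1.le, ht.2.le⟩
  have h' := h
  rw [curve, (D.arc a.adj).extend_apply ht'] at h'
  rcases D.no_vertex_mem a.adj w _ h' with rfl | rfl
  · exact ht.1.ne' (D.curve_injOn a ht' ⟨le_rfl, zero_le_one⟩ (h.trans (D.curve_zero a).symm))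
  · exact ht.2.ne (D.curve_injOn a ht' ⟨zero_le_one, le_rfl⟩ (h.trans (D.curve_one a).symm))

lemma mem_crossings_iff {p : ℝ × ℝ} : p ∈ D.crossings ↔ ∃ a b : G.Dart, a.edge ≠ b.edge ∧
    (∃ s ∈ Ioo (0 : ℝ) 1, D.curve a s = p) ∧ ∃ t ∈ Ioo (0 : ℝ) 1, D.curve b t = p := by
  constructor
  · rintro ⟨u, v, x, y, h₁, h₂, hne, hp, hp'⟩
    exact ⟨⟨(u, v), h₁⟩, ⟨(x, y), h₂⟩, hne, (D.isInteriorPoint_iff _ _).1 hp,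
      (D.isInteriorPoint_iff _ _).1 hp'⟩
  · rintro ⟨⟨⟨u, v⟩, h₁⟩, ⟨⟨x, y⟩, h₂⟩, hne, hp, hp'⟩
    exact ⟨u, v, x, y, h₁, h₂, hne, (D.isInteriorPoint_iff _ _).2 hp,
      (D.isInteriorPoint_iff _ _).2 hp'⟩

lemma pos_notMem_crossings (w : V) : D.pos w ∉ D.crossings := by
  rw [mem_crossings_iff]
  rintro ⟨a, -, -, ⟨s, hs, h⟩, -⟩
  exact D.curve_ne_pos a hs w h

lemma finite_crossings [Finite V] : D.crossings.Finite := by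
  have : Finite G.Dart := Finite.of_injective _ (SimpleGraph.Dart.toProd_injective (G := G))
  refine (Set.finite_iUnion (ι := {q : G.Dart × G.Dart // q.1.edge ≠ q.2.edge}) fun q =>
    D.finite_inter q.1.1.adj q.1.2.adj q.2).subset ?_
  intro p hp
  obtain ⟨a, b, hne, ⟨s, hs, has⟩, t, ht, hbt⟩ := D.mem_crossings_iff.1 hp
  refine mem_iUnion.2 ⟨⟨(a, b), hne⟩, ?_, ?_⟩
  · rw [← (D.arc a.adj).extend_range]
    exact ⟨s, has⟩
  · rw [← (D.arc b.adj).extend_range]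
    exact ⟨t, hbt⟩

/-- Every crossing lies on exactly two edges. -/
lemma exists_edges_of_mem_crossings {p : ℝ × ℝ} (hp : p ∈ D.crossings) :
    ∃ a b : G.Dart, a.edge ≠ b.edge ∧ ∀ c : G.Dart, (∃ s ∈ Ioo (0 : ℝ) 1, D.curve c s = p) ↔
      c = a ∨ c = a.symm ∨ c = b ∨ c = b.symm := by
  obtain ⟨a, b, hne, ha, hb⟩ := D.mem_crossings_iff.1 hp
  have hsymm : ∀ {c : G.Dart}, (∃ s ∈ Ioo (0 : ℝ) 1, D.curve c s = p) →
      ∃ s ∈ Ioo (0 : ℝ) 1, D.curve c.symm s = p := by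
    rintro c ⟨s, hs, h⟩
    exact ⟨1 - s, ⟨by linarith [hs.2], by linarith [hs.1]⟩, by rw [curve_symm, sub_sub_cancel, h]⟩
  refine ⟨a, b, hne, fun c => ⟨fun hc => ?_, ?_⟩⟩
  · by_contra hn
    simp only [not_or] at hn
    have h1 : c.edge ≠ a.edge := fun h => ((SimpleGraph.dart_edge_eq_iff _ _).1 h).elim hn.1 hn.2.1
    have h2 : c.edge ≠ b.edge :=
      fun h => ((SimpleGraph.dart_edge_eq_iff _ _).1 h).elim hn.2.2.1 hn.2.2.2
    obtain ⟨s₁, h0₁, h1₁, e₁⟩ := (D.isInteriorPoint_iff c.adj p).2 hc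
    obtain ⟨s₂, h0₂, h1₂, e₂⟩ := (D.isInteriorPoint_iff a.adj p).2 ha
    obtain ⟨s₃, h0₃, h1₃, e₃⟩ := (D.isInteriorPoint_iff b.adj p).2 hb
    exact D.no_triple_point c.adj a.adj b.adj h1 h2 hne s₁ s₂ s₃ h0₁ h1₁ h0₂ h1₂ h0₃ h1₃
      (e₁.trans e₂.symm) (e₂.trans e₃.symm)
  · rintro (rfl | rfl | rfl | rfl)
    exacts [ha, hsymm ha, hb, hsymm hb]

lemma four_darts [DecidableEq G.Dart] {a b : G.Dart} (h : a.edge ≠ b.edge) :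
    ({a, a.symm, b, b.symm} : Finset G.Dart).card = 4 := by
  have h1 : a ≠ b := fun e => h (e ▸ rfl)
  have h2 : a ≠ b.symm := fun e => h (by rw [e, SimpleGraph.Dart.edge_symm])
  have h3 : a.symm ≠ b := fun e => h (by rw [← e, SimpleGraph.Dart.edge_symm])
  have h4 : a.symm ≠ b.symm := fun e => h1 (SimpleGraph.Dart.symm_involutive.injective e)
  rw [Finset.card_insert_of_notMem, Finset.card_insert_of_notMem, Finset.card_pair]
  · exact b.symm_ne.symm
  · simp [h3, h4]
  · simp [h1, h2, a.symm_ne.symm]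

lemma two_mul_ncard_crossings_le [Finite V] {k : ℕ} (hk : D.IsKPlane k) :
    2 * D.crossings.ncard ≤ k * G.edgeSet.ncard := by
  classical
  let _ := Fintype.ofFinite V
  let _ : Fintype G.Dart := Fintype.ofFinite _
  have hfin := D.finite_crossings
  have := Finset.card_mul_le_card_mul (s := hfin.toFinset) (t := (Finset.univ : Finset G.Dart))
    (fun p a => ∃ s ∈ Ioo (0 : ℝ) 1, D.curve a s = p) (m := 4) (n := k) (fun p hp => by
      obtain ⟨a, b, hne, h⟩ := D.exists_edges_of_mem_crossings (hfin.mem_toFinset.1 hp)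
      rw [← four_darts hne]
      refine Finset.card_le_card fun c hc => ?_
      simp only [Finset.mem_insert, Finset.mem_singleton] at hc
      simp only [Finset.bipartiteAbove, Finset.mem_filter, Finset.mem_univ, true_and, h]
      exact hc) (fun a _ => by
      refine le_trans ?_ (hk a.adj)
      rw [← Set.ncard_coe_finset]
      refine Set.ncard_le_ncard ?_ (hfin.subset ?_)
      · intro p hp
        simp only [Finset.bipartiteBelow, Finset.coe_filter, Set.Finite.mem_toFinset,
          mem_ofPred_eq] at hp
        obtain ⟨hp, ha⟩ := hp
        refine ⟨(D.isInteriorPoint_iff _ _).2 ha, ?_⟩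
        obtain ⟨b, c, hne, h⟩ := D.exists_edges_of_mem_crossings hp
        have hb := (h b).2 (Or.inl rfl)
        have hc := (h c).2 (Or.inr (Or.inr (Or.inl rfl)))
        by_cases hab : a.edge = b.edge
        · exact ⟨c.fst, c.snd, c.adj, fun h' => hne (hab.symm.trans h'),
            (D.isInteriorPoint_iff _ _).2 hc⟩
        · exact ⟨b.fst, b.snd, b.adj, hab, (D.isInteriorPoint_iff _ _).2 hb⟩
      · rintro p ⟨hp, x, y, h₂, hne, hp'⟩
        exact ⟨_, _, x, y, a.adj, h₂, hne, hp, hp'⟩)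
  rw [← Set.ncard_eq_toFinset_card _ hfin, Finset.card_univ, ← Nat.card_eq_fintype_card,
    SimpleGraph.natCard_dart] at this
  lia

end PlaneDrawing

namespace PlaneDrawing

open Set

variable {V : Type*} {G : SimpleGraph V} (D : PlaneDrawing G)

/-- The parameters at which a curve visits a vertex or a crossing. -/
def marks (a : G.Dart) : Set ℝ :=
  {t | t ∈ Icc 0 1 ∧ (t = 0 ∨ t = 1 ∨ D.curve a t ∈ D.crossings)}

variable {D} in
lemma one_sub_mem_marks {a : G.Dart} {t : ℝ} (h : t ∈ D.marks a) : 1 - t ∈ D.marks a.symm := by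
  obtain ⟨⟨h0, h1⟩, h⟩ := h
  refine ⟨⟨by linarith, by linarith⟩, ?_⟩
  rw [curve_symm, sub_sub_cancel]
  rcases h with rfl | rfl | h
  · exact Or.inr (Or.inl (sub_zero 1))
  · exact Or.inl (sub_self 1)
  · exact Or.inr (Or.inr h)

lemma finite_marks [Finite V] (a : G.Dart) : (D.marks a).Finite := by
  have h : (Icc (0 : ℝ) 1 ∩ D.curve a ⁻¹' D.crossings).Finite :=
    Set.Finite.of_finite_image (D.finite_crossings.subset (by rintro _ ⟨t, ht, rfl⟩; exact ht.2))
      ((D.curve_injOn a).mono inter_subset_left)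
  refine (h.union (Set.toFinite {0, 1})).subset ?_
  rintro t ⟨ht, rfl | rfl | h⟩
  · simp
  · simp
  · exact Or.inl ⟨ht, h⟩

/-- The points of the planarization: vertices and crossings. -/
def point : V ⊕ D.crossings → ℝ × ℝ := Sum.elim D.pos Subtype.val

lemma point_injective : Function.Injective D.point :=
  Function.Injective.sumElim D.pos_inj Subtype.val_injective fun v p h =>
    D.pos_notMem_crossings v (h ▸ p.2)

variable {D} in
lemma exists_point_eq {a : G.Dart} {t : ℝ} (h : t ∈ D.marks a) :
    ∃ w, D.point w = D.curve a t := by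
  obtain ⟨-, rfl | rfl | h⟩ := h
  · exact ⟨Sum.inl a.fst, (D.curve_zero a).symm⟩
  · exact ⟨Sum.inl a.snd, (D.curve_one a).symm⟩
  · exact ⟨Sum.inr ⟨_, h⟩, rfl⟩

lemma notMem_marks {a : G.Dart} {t : ℝ} (ht : t ∈ Icc (0 : ℝ) 1) (h : t ∉ D.marks a) (w) :
    D.curve a t ≠ D.point w := by
  have h' : ¬ (t = 0 ∨ t = 1 ∨ D.curve a t ∈ D.crossings) := fun h' => h ⟨ht, h'⟩
  simp only [not_or] at h'
  rcases w with v | p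
  · exact D.curve_ne_pos a ⟨lt_of_le_of_ne ht.1 (Ne.symm h'.1), lt_of_le_of_ne ht.2 h'.2.1⟩ v
  · exact fun e => h'.2.2 (e ▸ p.2)

/-- A maximal piece of a directed edge between consecutive marks. -/
@[ext]
structure Piece where
  dart : G.Dart
  source : ℝ
  target : ℝ
  source_mem : source ∈ D.marks dart
  target_mem : target ∈ D.marks dart
  lt : source < target
  consecutive : ∀ s ∈ D.marks dart, s ≤ source ∨ target ≤ s

namespace Piece

variable {D}

lemma eq_of_source {p q : D.Piece} (h : p.dart = q.dart) (h' : p.source = q.source) : p = q := by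
  have h1 := p.consecutive q.target (h ▸ q.target_mem)
  have h2 := q.consecutive p.target (h ▸ p.target_mem)
  have h3 := p.lt
  have h4 := q.lt
  refine Piece.ext h h' (le_antisymm ?_ ?_)
  · rcases h1 with h1 | h1
    · linarith
    · exact h1
  · rcases h2 with h2 | h2
    · linarith
    · exact h2

lemma exists_source [Finite V] {a : G.Dart} {t : ℝ} (ht : t ∈ D.marks a) (ht1 : t < 1) :
    ∃ p : D.Piece, p.dart = a ∧ p.source = t := by
  have hfin : (D.marks a ∩ Ioi t).Finite := (D.finite_marks a).inter_of_left _
  obtain ⟨s, ⟨hs, hts⟩, hmin⟩ := hfin.exists_minimal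
    ⟨1, ⟨⟨zero_le_one, le_rfl⟩, Or.inr (Or.inl rfl)⟩, ht1⟩
  refine ⟨⟨a, t, s, ht, hs, hts, fun r hr => ?_⟩, rfl, rfl⟩
  by_contra! h
  exact absurd (hmin ⟨hr, h.1⟩ h.2.le) (not_le.2 h.2)

instance [Finite V] : Finite D.Piece := by
  have : ∀ a : G.Dart, Finite (D.marks a) := fun a => (D.finite_marks a).to_subtype
  refine Finite.of_injective
    (fun p : D.Piece => (⟨p.dart, p.source, p.source_mem⟩ : Σ a : G.Dart, D.marks a)) ?_
  intro p q h
  have h1 : p.dart = q.dart := congrArg Sigma.fst h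
  exact eq_of_source h1 (congrArg (fun x : Σ a : G.Dart, D.marks a => (x.2 : ℝ)) h)

/-- The reversal of a piece. -/
def rev (p : D.Piece) : D.Piece where
  dart := p.dart.symm
  source := 1 - p.target
  target := 1 - p.source
  source_mem := one_sub_mem_marks p.target_mem
  target_mem := one_sub_mem_marks p.source_mem
  lt := by linarith [p.lt]
  consecutive s hs := by
    have h := one_sub_mem_marks hs
    rw [SimpleGraph.Dart.symm_symm] at h
    rcases p.consecutive _ h with h | h
    · exact Or.inr (by linarith)
    · exact Or.inl (by linarith)

lemma rev_rev (p : D.Piece) : p.rev.rev = p :=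
  Piece.ext (SimpleGraph.Dart.symm_symm _) (sub_sub_cancel _ _) (sub_sub_cancel _ _)

lemma mem_Icc (p : D.Piece) {s : ℝ} (hs : s ∈ Icc p.source p.target) : s ∈ Icc (0 : ℝ) 1 :=
  ⟨p.source_mem.1.1.trans hs.1, hs.2.trans p.target_mem.1.2⟩

lemma notMem_marks (p : D.Piece) {s : ℝ} (hs : s ∈ Ioo p.source p.target) : s ∉ D.marks p.dart :=
  fun h => (p.consecutive s h).elim (not_le.2 hs.1) (not_le.2 hs.2)

/-- The point of the planarization at which a piece starts. -/
noncomputable def vt (p : D.Piece) : V ⊕ D.crossings := (exists_point_eq p.source_mem).choose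

lemma point_vt (p : D.Piece) : D.point p.vt = D.curve p.dart p.source :=
  (exists_point_eq p.source_mem).choose_spec

lemma point_vt_rev (p : D.Piece) : D.point p.rev.vt = D.curve p.dart p.target := by
  rw [point_vt]
  change D.curve p.dart.symm (1 - p.target) = _
  rw [curve_symm, sub_sub_cancel]

/-- The curve traversing a piece. -/
noncomputable def curve (p : D.Piece) (s : ℝ) : ℝ × ℝ :=
  D.curve p.dart (p.source + s * (p.target - p.source))

lemma continuous_curve (p : D.Piece) : Continuous p.curve :=
  (D.continuous_curve p.dart).comp (by fun_prop)

lemma curve_rev (p : D.Piece) (s : ℝ) : p.rev.curve s = p.curve (1 - s) := by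
  change D.curve p.dart.symm (1 - p.target + s * (1 - p.source - (1 - p.target))) = _
  rw [curve_symm, curve]
  congr 1
  ring

lemma add_mul_mem (p : D.Piece) {s : ℝ} (hs : s ∈ Icc (0 : ℝ) 1) :
    p.source + s * (p.target - p.source) ∈ Icc p.source p.target := by
  have := p.lt
  constructor <;> nlinarith [hs.1, hs.2]

lemma add_mul_mem_Ioo (p : D.Piece) {s : ℝ} (hs : s ∈ Ioo (0 : ℝ) 1) :
    p.source + s * (p.target - p.source) ∈ Ioo p.source p.target := by
  have := p.lt
  constructor <;> nlinarith [hs.1, hs.2]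

lemma eq_of_curve_eq {p q : D.Piece} {s t : ℝ} (hs : s ∈ Ioo (0 : ℝ) 1)
    (ht : t ∈ Icc (0 : ℝ) 1) (hpq : p.dart = q.dart) (h : p.curve s = q.curve t) :
    q = p ∧ t = s := by
  have h1 := p.add_mul_mem_Ioo hs
  have h2 := q.add_mul_mem ht
  have h3 := D.curve_injOn p.dart (p.mem_Icc ⟨h1.1.le, h1.2.le⟩) (q.mem_Icc h2)
    (by rw [curve, curve, ← hpq] at h; exact h)
  have h4 := p.consecutive q.source (hpq ▸ q.source_mem)
  have h5 := p.consecutive q.target (hpq ▸ q.target_mem)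
  have h6 := q.consecutive p.source (hpq ▸ p.source_mem)
  have h7 : p.source = q.source := by
    rcases h4 with h4 | h4
    · rcases h6 with h6 | h6
      · exact le_antisymm h6 h4
      · linarith [h1.1, h2.2]
    · linarith [h1.2, h2.1]
  obtain rfl := eq_of_source hpq h7
  refine ⟨rfl, ?_⟩
  have h8 : s * (p.target - p.source) = t * (p.target - p.source) := by linarith
  exact (mul_right_cancel₀ (sub_pos.2 p.lt).ne' h8).symm

lemma eq_or_eq_rev_of_curve_eq {p q : D.Piece} {s t : ℝ} (hs : s ∈ Ioo (0 : ℝ) 1)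
    (ht : t ∈ Icc (0 : ℝ) 1) (h : p.curve s = q.curve t) :
    q = p ∧ t = s ∨ q = p.rev ∧ t = 1 - s := by
  have h1 := p.add_mul_mem_Ioo hs
  have h1' := p.mem_Icc ⟨h1.1.le, h1.2.le⟩
  have h2 := q.mem_Icc (q.add_mul_mem ht)
  have hne := D.notMem_marks h1' (p.notMem_marks h1)
  by_cases he : p.dart.edge = q.dart.edge
  · rcases (SimpleGraph.dart_edge_eq_iff _ _).1 he with he | he
    · exact Or.inl (eq_of_curve_eq hs ht he h)
    · right
      have h3 : p.curve s = q.rev.curve (1 - t) := by rw [curve_rev, sub_sub_cancel, h]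
      obtain ⟨h4, h5⟩ := eq_of_curve_eq hs ⟨by linarith [ht.2], by linarith [ht.1]⟩ he h3
      exact ⟨by rw [← h4, rev_rev], by linarith⟩
  · exfalso
    have h0 : 0 < p.source + s * (p.target - p.source) := p.source_mem.1.1.trans_lt h1.1
    have h01 : p.source + s * (p.target - p.source) < 1 := h1.2.trans_le p.target_mem.1.2
    rcases eq_or_lt_of_le h2.1 with h3 | h3
    · exact hne (Sum.inl q.dart.fst) (h.trans (by rw [curve, ← h3, curve_zero]; rfl))
    rcases eq_or_lt_of_le h2.2 with h4 | h4
    · exact hne (Sum.inl q.dart.snd) (h.trans (by rw [curve, h4, curve_one]; rfl))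
    exact p.notMem_marks h1 ⟨h1', Or.inr (Or.inr (D.mem_crossings_iff.2
      ⟨_, _, he, ⟨_, ⟨h0, h01⟩, rfl⟩, _, ⟨h3, h4⟩, h.symm⟩))⟩

lemma vt_ne_vt_rev (p : D.Piece) : p.vt ≠ p.rev.vt := by
  intro h
  have h' := congrArg D.point h
  rw [point_vt, point_vt_rev] at h'
  exact p.lt.ne (D.curve_injOn _ p.source_mem.1 p.target_mem.1 h')

lemma vt_eq_inr_iff (p : D.Piece) (x : D.crossings) :
    p.vt = Sum.inr x ↔ D.curve p.dart p.source = x := by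
  rw [← D.point_injective.eq_iff, point_vt]
  rfl

lemma source_mem_Ioo {p : D.Piece} {x : D.crossings} (h : D.curve p.dart p.source = x) :
    p.source ∈ Ioo (0 : ℝ) 1 := by
  refine ⟨lt_of_le_of_ne p.source_mem.1.1 fun h' => ?_, p.lt.trans_le p.target_mem.1.2⟩
  rw [← h', curve_zero] at h
  exact D.pos_notMem_crossings _ (h ▸ x.2)

lemma card_vt_eq_inr [Finite V] (x : D.crossings) :
    Nat.card {p : D.Piece // p.vt = Sum.inr x} = 4 := by
  classical
  obtain ⟨a, b, hne, hx⟩ := D.exists_edges_of_mem_crossings x.2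
  rw [← four_darts hne, ← Fintype.card_coe, ← Nat.card_eq_fintype_card]
  refine Nat.card_congr (Equiv.ofBijective (fun p => ⟨p.1.dart, ?_⟩) ⟨?_, ?_⟩)
  · have h := (p.1.vt_eq_inr_iff x).1 p.2
    simpa using (hx p.1.dart).1 ⟨_, source_mem_Ioo h, h⟩
  · intro p q h
    have h : p.1.dart = q.1.dart := congrArg Subtype.val h
    have hp := (p.1.vt_eq_inr_iff x).1 p.2
    have hq := (q.1.vt_eq_inr_iff x).1 q.2
    refine Subtype.ext (eq_of_source h
      (D.curve_injOn p.1.dart p.1.source_mem.1 q.1.source_mem.1 ?_))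
    rw [hp, h, hq]
  · rintro ⟨c, hc⟩
    obtain ⟨s, hs, h⟩ := (hx c).2 (by simpa using hc)
    obtain ⟨p, rfl, rfl⟩ := exists_source (D := D) (a := c) (t := s)
      ⟨⟨hs.1.le, hs.2.le⟩, Or.inr (Or.inr (h ▸ x.2))⟩ hs.2
    exact ⟨⟨p, (p.vt_eq_inr_iff x).2 h⟩, rfl⟩

end Piece

lemma exists_planarization [Finite V] : ∃ M : Planarization V D.crossings D.Piece,
    M.rev = Piece.rev ∧ M.vt = Piece.vt := by
  have := D.finite_crossings.to_subtype
  obtain ⟨rot, h1, h2⟩ := Grid.exists_rotation_of_arcs (D := D.Piece) (rv := Piece.rev)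
    (vt := Piece.vt) Piece.rev_rev Piece.vt_ne_vt_rev D.point D.point_injective Piece.curve
    Piece.continuous_curve (fun p => by rw [Piece.curve, zero_mul, add_zero, Piece.point_vt])
    Piece.curve_rev (fun p q s t hs ht h => Piece.eq_or_eq_rev_of_curve_eq hs ht h)
  exact ⟨⟨rot, Piece.rev, Piece.vt, Piece.rev_rev, h1, Piece.card_vt_eq_inr, h2⟩, rfl, rfl⟩

end PlaneDrawing

namespace PlaneDrawing

open Set

variable {V : Type*} {G : SimpleGraph V} (D : PlaneDrawing G)

/-- The list `l` consists of the pieces of the directed edge `a` in their order along `a`. -/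
def IsSubdivision (a : G.Dart) (l : List D.Piece) : Prop :=
  (∀ p, p ∈ l ↔ p.dart = a) ∧ l.Pairwise fun p q => p.source < q.source

lemma exists_isSubdivision [Finite V] (a : G.Dart) : ∃ l, D.IsSubdivision a l := by
  classical
  let _ := Fintype.ofFinite D.Piece
  let r : D.Piece → D.Piece → Prop := fun p q => p.source ≤ q.source
  have : Std.Total r := ⟨fun p q => le_total p.source q.source⟩
  have : IsTrans D.Piece r := ⟨fun p q s h h' => le_trans (α := ℝ) h h'⟩
  let l := (Finset.univ.filter fun p : D.Piece => p.dart = a).toList.insertionSort r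
  have hmem : ∀ p, p ∈ l ↔ p.dart = a := fun p => by simp [l]
  refine ⟨l, hmem, ?_⟩
  have h1 : l.Pairwise r := List.pairwise_insertionSort r _
  have h2 : l.Nodup := (List.perm_insertionSort r _).nodup_iff.2 (Finset.nodup_toList _)
  refine (h1.and h2).imp_of_mem fun {p q} hp hq h => lt_of_le_of_ne h.1 fun e => h.2 ?_
  exact Piece.eq_of_source (((hmem p).1 hp).trans ((hmem q).1 hq).symm) e

namespace IsSubdivision

variable {D} {a : G.Dart} {l l' : List D.Piece}

lemma nodup (h : D.IsSubdivision a l) : l.Nodup :=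
  h.2.imp fun hpq e => (e ▸ hpq).ne rfl

lemma eq (h : D.IsSubdivision a l) (h' : D.IsSubdivision a l') : l = l' :=
  ((List.perm_ext_iff_of_nodup h.nodup h'.nodup).2 fun p =>
    (h.1 p).trans (h'.1 p).symm).eq_of_pairwise
      (fun _ _ _ _ h1 h2 => (lt_asymm h1 h2).elim) h.2 h'.2

lemma symm (h : D.IsSubdivision a l) : D.IsSubdivision a.symm (l.map Piece.rev).reverse := by
  refine ⟨fun p => ?_, ?_⟩
  · simp only [List.mem_reverse, List.mem_map, h.1]
    constructor
    · rintro ⟨q, rfl, rfl⟩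
      rfl
    · intro hp
      exact ⟨p.rev, by rw [← a.symm_symm, ← hp]; rfl, p.rev_rev⟩
  · rw [List.pairwise_reverse, List.pairwise_map]
    refine h.2.imp_of_mem fun {p q} hp hq hpq => ?_
    change 1 - q.target < 1 - p.target
    have h1 := p.consecutive q.source (((h.1 q).1 hq).trans ((h.1 p).1 hp).symm ▸ q.source_mem)
    have h2 := q.lt
    rcases h1 with h1 | h1 <;> linarith

lemma target_eq_source [Finite V] {l₁ l₂ : List D.Piece} {p q : D.Piece}
    (h : D.IsSubdivision a (l₁ ++ p :: q :: l₂)) : p.target = q.source := by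
  obtain rfl : p.dart = a := (h.1 p).1 (by simp)
  have hq : q.dart = p.dart := (h.1 q).1 (by simp)
  have hs := h.2
  simp only [List.pairwise_append, List.pairwise_cons, List.mem_cons] at hs
  have hpq : p.source < q.source := hs.2.1.1 q (Or.inl rfl)
  have hle : p.target ≤ q.source :=
    (p.consecutive q.source (hq ▸ q.source_mem)).resolve_left (not_le.2 hpq)
  by_contra hne
  have hlt := lt_of_le_of_ne hle hne
  obtain ⟨r, hr, hr'⟩ := Piece.exists_source p.target_mem
    (hlt.trans (q.lt.trans_le q.target_mem.1.2))
  have hp := p.lt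
  have hrl := (h.1 r).2 hr
  simp only [List.mem_append, List.mem_cons] at hrl
  rcases hrl with hrl | rfl | rfl | hrl
  · have := hs.2.2 r hrl p (Or.inl rfl)
    linarith
  · exact hp.ne hr'
  · exact hne hr'.symm
  · have := hs.2.1.2.1 r hrl
    linarith

variable {M : Planarization V D.crossings D.Piece}

lemma isChain [Finite V] (h : D.IsSubdivision a l) (hrev : M.rev = Piece.rev)
    (hvt : M.vt = Piece.vt) : l.IsChain M.Step := by
  rw [List.isChain_iff_forall_rel_of_append_cons_cons]
  rintro p q l₁ l₂ rfl
  have hpq := h.target_eq_source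
  have hp := (h.1 p).1 (by simp)
  have hq := (h.1 q).1 (by simp)
  have h0 : 0 < p.target := p.source_mem.1.1.trans_lt p.lt
  have h1 : p.target < 1 := hpq ▸ q.lt.trans_le q.target_mem.1.2
  have hX := (p.target_mem.2.resolve_left h0.ne').resolve_left h1.ne
  refine ⟨⟨_, hX⟩, ?_, ?_⟩
  · rw [hvt, hrev, ← D.point_injective.eq_iff, Piece.point_vt_rev]
    rfl
  · rw [hvt, Piece.vt_eq_inr_iff, ← hpq, hq.trans hp.symm]

lemma head?_map_vt [Finite V] (h : D.IsSubdivision a l) :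
    l.head?.map Piece.vt = some (Sum.inl a.fst) := by
  obtain ⟨p, rfl, hp⟩ := Piece.exists_source (D := D) (a := a) (t := 0)
    ⟨⟨le_rfl, zero_le_one⟩, Or.inl rfl⟩ zero_lt_one
  have hpl := (h.1 p).2 rfl
  rcases l with _ | ⟨q, l⟩
  · simp at hpl
  · have hqp : p = q := by
      rcases List.mem_cons.1 hpl with hpl | hpl
      · exact hpl
      · have := (List.pairwise_cons.1 h.2).1 p hpl
        linarith [q.source_mem.1.1]
    subst hqp
    refine congrArg some (D.point_injective ?_)
    rw [Piece.point_vt, hp, curve_zero]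
    rfl

lemma isTrail [Finite V] (h : D.IsSubdivision a l) (hrev : M.rev = Piece.rev)
    (hvt : M.vt = Piece.vt) : M.IsTrail a.fst a.snd l := by
  refine ⟨h.isChain hrev hvt, hvt ▸ h.head?_map_vt, ?_⟩
  have := h.symm.head?_map_vt
  rw [List.head?_reverse, List.getLast?_map, Option.map_map] at this
  rw [hvt, hrev]
  exact this

end IsSubdivision

/-- A drawing can be planarized by turning its crossings into vertices. -/
lemma exists_trailSystem [Finite V] : ∃ M : Planarization V D.crossings D.Piece,
    Nonempty (M.TrailSystem G) := by
  obtain ⟨M, hrev, hvt⟩ := D.exists_planarization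
  choose L hL using D.exists_isSubdivision
  refine ⟨M, ⟨⟨L, fun a => (hL a).isTrail hrev hvt, fun a => (hL a.symm).eq ?_,
    fun a => (hL a).nodup, fun a b p ha hb => ?_⟩⟩⟩
  · rw [Planarization.revList, hrev]
    exact (hL a).symm
  · rw [← ((hL a).1 p).1 ha, ((hL b).1 p).1 hb]

end PlaneDrawing

lemma HasNoCycleOfLength.noShortCycles {V : Type*} {G : SimpleGraph V}
    (h3 : HasNoCycleOfLength G 3) (h4 : HasNoCycleOfLength G 4) : G.NoShortCycles := by
  refine ⟨fun a b c hab hbc hca => ?_, fun a b c d hac hbd hab hbc hcd hda => ?_⟩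
  · refine h3 a (.cons hab (.cons hbc (.cons hca .nil))) ?_ rfl
    have h1 := hab.ne
    have h2 := hbc.ne
    have h3 := hca.ne
    rw [SimpleGraph.Walk.cons_isCycle_iff]
    simp [SimpleGraph.Walk.isPath_def]
    grind
  · refine h4 a (.cons hab (.cons hbc (.cons hcd (.cons hda .nil)))) ?_ rfl
    have h1 := hab.ne
    have h2 := hbc.ne
    have h3 := hcd.ne
    have h4 := hda.ne
    rw [SimpleGraph.Walk.cons_isCycle_iff]
    simp [SimpleGraph.Walk.isPath_def]
    grind

theorem stmt_14 (k : ℕ) (hk : 1 ≤ k) {V : Type} [Fintype V]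
    (G : SimpleGraph V) (hC3 : HasNoCycleOfLength G 3)
    (hC4 : HasNoCycleOfLength G 4) (hG : KPlanar G k)
    (hn : 2 ≤ Fintype.card V)
    (hm : (3.05 : ℝ) * Fintype.card V ≤ G.edgeSet.ncard) :
    (G.edgeSet.ncard : ℝ) ≤ Real.sqrt (11163 * k / 1600) * Fintype.card V ∧
      (G.edgeSet.ncard : ℝ) < 2.642 * Real.sqrt k * Fintype.card V := by
  obtain ⟨D, hD⟩ := hG
  obtain ⟨M, ⟨T⟩⟩ := D.exists_trailSystem
  have := D.finite_crossings.to_subtype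
  let _ := Fintype.ofFinite D.Piece
  have hcr := Planarization.TrailSystem.crossing_lemma (hC3.noShortCycles hC4) T hm (by lia)
  have hX : 2 * (Nat.card D.crossings : ℝ) ≤ k * G.edgeSet.ncard := by
    exact_mod_cast D.two_mul_ncard_crossings_le hD
  have hn0 : (0 : ℝ) < Fintype.card V := by exact_mod_cast (by lia : 0 < Fintype.card V)
  have hk0 : (0 : ℝ) < k := by exact_mod_cast hk
  generalize (Fintype.card V : ℝ) = n at *
  generalize (G.edgeSet.ncard : ℝ) = m at *
  generalize (Nat.card D.crossings : ℝ) = x at *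
  have hm0 : 0 < m := by linarith
  have hsq : m ^ 2 ≤ 11163 * k / 1600 * n ^ 2 := by
    refine le_of_mul_le_mul_left (a := m) ?_ hm0
    nlinarith [mul_le_mul_of_nonneg_right hX (sq_nonneg n)]
  have h1 : m ≤ Real.sqrt (11163 * k / 1600) * n := by
    rw [← Real.sqrt_sq hn0.le, ← Real.sqrt_mul (by positivity)]
    exact Real.le_sqrt_of_sq_le hsq
  refine ⟨h1, h1.trans_lt (mul_lt_mul_of_pos_right ?_ hn0)⟩
  rw [Real.sqrt_lt' (by positivity), mul_pow, Real.sq_sqrt hk0.le]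
  norm_num
  linarith
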